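/- There exists a field F of characteristic 2 with I_q^3 F = 0 over which there is an anisotropic trialitarian triple of index (2,4,4); moreover, there also exists a field F' of characteristic 2 with I_q^3 F' = 0 over which there is an anisotropic trialitarian triple of index (2,2,4). Concretely, with k' = k(X₁,Y₁,X₂,Y₂) for k of characteristic 2 and (A, σ, f) an orthogonal sum of ([X₁+X₂,Y₁)⊗[X₁+X₂,Y₂), γ₁⊗γ₂, f₁₂) and ([X₁,Y₁Y₂)⊗[X₂,Y₁Y₂), γ₃⊗γ₄, f₃₄), Merkurjev's construction yields field extensions F/k' and F'/k'' (k'' the function field of an Albert form of B⁺ = [X₁,Y₂)⊗[X₂,Y₁)) with I_q^3 = 0 realizing these indices for the triple formed by (A, σ, f) and the two components of its Clifford algebra. -/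

import Mathlib

/-!  Common definitions for formalizing results of
"Triality over fields with I³ = 0" (F. K. Bingöl, A. Quéguiner-Mathieu).

We model an algebra with quadratic pair `(A, σ, f)` by the data of the reduced trace
`T` of `A` (given together with the property `IsReducedTrace` characterising it via a
splitting field), the involution `σ`, and an element `ℓ ∈ A` with `ℓ + σ(ℓ) = 1`; the
semi-trace is `f = f_ℓ : s ↦ T(ℓ s)`.  By [KMRT, (5.7)] every semi-trace is of this
form, so this is an equivalent description of quadratic pairs.  -/

open scoped TensorProduct
open Module

noncomputable section

namespace Triality

variable (F : Type) [CommRing F]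

/-- A (finite-dimensional) central simple algebra. -/
def IsCSA (A : Type) [Ring A] [Algebra F A] : Prop :=
  Algebra.IsCentral F A ∧ IsSimpleRing A ∧ Module.Finite F A

/-- The degree of a central simple algebra: the square root of its dimension. -/
def deg (A : Type) [Ring A] [Algebra F A] : ℕ := Nat.sqrt (Module.finrank F A)

/-- Brauer equivalence of two algebras. -/
def BrauerEquiv (A B : Type) [Ring A] [Algebra F A] [Ring B] [Algebra F B] : Prop :=
  ∃ n m : ℕ, 0 < n ∧ 0 < m ∧
    Nonempty (Matrix (Fin n) (Fin n) A ≃ₐ[F] Matrix (Fin m) (Fin m) B)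

/-- An algebra is split if it is isomorphic to a matrix algebra over the base. -/
def IsSplit (A : Type) [Ring A] [Algebra F A] : Prop :=
  ∃ n : ℕ, 0 < n ∧ Nonempty (A ≃ₐ[F] Matrix (Fin n) (Fin n) F)

/-- The Schur index of a central simple algebra: the smallest degree of a central
simple algebra in its Brauer class (realised by the underlying division algebra). -/
def schurIndex (A : Type) [Ring A] [Algebra F A] : ℕ :=
  sInf { d : ℕ | 0 < d ∧ ∃ (D : Type) (_ : Ring D) (_ : Algebra F D),
    IsCSA F D ∧ Module.finrank F D = d * d ∧ BrauerEquiv F A D }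

/-- A linear involution (anti-automorphism of period 2) on an algebra. -/
def IsInvolution {A : Type} [Ring A] [Algebra F A] (σ : A →ₗ[F] A) : Prop :=
  (∀ x y : A, σ (x * y) = σ y * σ x) ∧ (∀ x : A, σ (σ x) = x)

/-- `T` is the reduced trace of the central simple algebra `A`: over some splitting field
it is given by the trace of matrices. -/
def IsReducedTrace (A : Type) [Ring A] [Algebra F A] (T : A →ₗ[F] F) : Prop :=
  ∃ (E : Type) (_ : Field E) (_ : Algebra F E) (n : ℕ)
    (e : E ⊗[F] A ≃ₐ[E] Matrix (Fin n) (Fin n) E),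
    ∀ a : A, algebraMap F E (T a) = Matrix.trace (e ((1 : E) ⊗ₜ[F] a))

/-- The submodule of symmetric elements of an involution. -/
def symSet {A : Type} [Ring A] [Algebra F A] (σ : A →ₗ[F] A) : Submodule F A :=
  LinearMap.ker (σ - LinearMap.id)

/-- A quadratic pair on a central simple algebra `A` with reduced trace `T`, encoded
by the involution `σ` together with an element `ℓ` with `ℓ + σ(ℓ) = 1`; the semi-trace of
the pair is `f_ℓ : s ↦ T(ℓ s)` on symmetric elements. -/
def IsQuadraticPair (A : Type) [Ring A] [Algebra F A] (T : A →ₗ[F] F)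
    (σ : A →ₗ[F] A) (ℓ : A) : Prop :=
  IsInvolution F σ ∧
  2 * Module.finrank F (symSet F σ) = deg F A * (deg F A + 1) ∧
  (∀ x : A, σ x = -x → T x = 0) ∧
  ℓ + σ ℓ = 1

/-- A right ideal of `A`, as a submodule over the base. -/
def IsRightIdeal (A : Type) [Ring A] [Algebra F A] (I : Submodule F A) : Prop :=
  ∀ x ∈ I, ∀ a : A, x * a ∈ I

/-- An isotropic right ideal for the quadratic pair `(σ, f_ℓ)`:
`σ(I)·I = 0` and the semi-trace `f_ℓ = T(ℓ·)` vanishes on `I ∩ Sym(A,σ)`. -/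
def IsIsotropicIdeal (A : Type) [Ring A] [Algebra F A] (T : A →ₗ[F] F)
    (σ : A →ₗ[F] A) (ℓ : A) (I : Submodule F A) : Prop :=
  IsRightIdeal F A I ∧
  (∀ x ∈ I, ∀ y ∈ I, σ x * y = 0) ∧
  (∀ x ∈ I, σ x = x → T (ℓ * x) = 0)

/-- The algebra with quadratic pair `(A, σ, f_ℓ)` is isotropic. -/
def QPIsotropic (A : Type) [Ring A] [Algebra F A] (T : A →ₗ[F] F)
    (σ : A →ₗ[F] A) (ℓ : A) : Prop :=
  ∃ I : Submodule F A, IsIsotropicIdeal F A T σ ℓ I ∧ I ≠ ⊥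

/-- The algebra with quadratic pair `(A, σ, f_ℓ)` is hyperbolic. -/
def QPHyperbolic (A : Type) [Ring A] [Algebra F A] (T : A →ₗ[F] F)
    (σ : A →ₗ[F] A) (ℓ : A) : Prop :=
  ∃ I : Submodule F A, IsIsotropicIdeal F A T σ ℓ I ∧
    2 * Module.finrank F I = Module.finrank F A

/-- The index of an algebra with quadratic pair: the set of reduced dimensions
`dim_F I / deg A` of isotropic right ideals `I`. -/
def qpIndexSet (A : Type) [Ring A] [Algebra F A] (T : A →ₗ[F] F)
    (σ : A →ₗ[F] A) (ℓ : A) : Set ℕ :=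
  { r : ℕ | ∃ I : Submodule F A, IsIsotropicIdeal F A T σ ℓ I ∧
      Module.finrank F I = r * deg F A }

/-- A symplectic involution, characterised characteristic-freely: in characteristic 2,
`1` is an alternating element; in characteristic `≠ 2`, the symmetric elements have
dimension `n(n-1)/2`. -/
def IsSymplectic (A : Type) [Ring A] [Algebra F A] (σ : A →ₗ[F] A) : Prop :=
  IsInvolution F σ ∧
    ((ringChar F = 2 ∧ ∃ y : A, 1 = y + σ y) ∨
     (ringChar F ≠ 2 ∧ 2 * Module.finrank F (symSet F σ) = deg F A * (deg F A - 1)))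

/-- The sandwich map `Sand : A ⊗ A → End_F(A)`, `Sand(a ⊗ b)(x) = a x b`. -/
def sand (A : Type) [Ring A] [Algebra F A] : A ⊗[F] A →ₗ[F] A →ₗ[F] A :=
  TensorProduct.lift
    (LinearMap.mk₂ F (fun a b => (LinearMap.mulRight F b).comp (LinearMap.mulLeft F a))
      (fun a a' b => by ext x; simp [add_mul])
      (fun c a b => by ext x; simp [smul_mul_assoc])
      (fun a b b' => by ext x; simp [mul_add])
      (fun c a b => by ext x; simp [mul_smul_comm]))

/-- The degree-two part map `A ⊗ A → T(A)`, `a ⊗ b ↦ ι a * ι b`. -/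
def mu2 (A : Type) [Ring A] [Algebra F A] : A ⊗[F] A →ₗ[F] TensorAlgebra F A :=
  TensorProduct.lift
    (LinearMap.mk₂ F (fun a b => TensorAlgebra.ι F a * TensorAlgebra.ι F b)
      (fun a a' b => by simp [add_mul])
      (fun c a b => by simp [smul_mul_assoc])
      (fun a b b' => by simp [mul_add])
      (fun c a b => by simp [mul_smul_comm]))

/-- The defining relations of the Clifford algebra `C(A, σ, f)` of an algebra with
quadratic pair, following [KMRT, §8.B]: in the tensor algebra `T(A)`, a symmetric
element `s`, viewed in degree one, is identified with the scalar `f(s) = T(ℓ s)`, and a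
`σ₂`-symmetric element `c ∈ A ⊗ A` (i.e. `Sand(c) ∘ σ = Sand(c)`), viewed in degree two,
is identified with the degree-one element `Sand(c)(ℓ)`.  (In the split case
`A = End(V)`, `(σ, f) = ad(q)`, these are the Bichsel–Knus relations presenting
the even Clifford algebra `C₀(q)`.) -/
inductive CliffordRel (A : Type) [Ring A] [Algebra F A] (T : A →ₗ[F] F)
    (σ : A →ₗ[F] A) (ℓ : A) : TensorAlgebra F A → TensorAlgebra F A → Prop
  | sym (s : A) (hs : σ s = s) :
      CliffordRel A T σ ℓ (TensorAlgebra.ι F s) (algebraMap F _ (T (ℓ * s)))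
  | deg2 (c : A ⊗[F] A) (hc : ∀ x : A, sand F A c (σ x) = sand F A c x) :
      CliffordRel A T σ ℓ (mu2 F A c) (TensorAlgebra.ι F (sand F A c ℓ))

/-- The Clifford algebra of an algebra with quadratic pair [KMRT, §8.B]. -/
def CliffordAlg (A : Type) [Ring A] [Algebra F A] (T : A →ₗ[F] F)
    (σ : A →ₗ[F] A) (ℓ : A) : Type :=
  RingQuot (CliffordRel F A T σ ℓ)

instance (A : Type) [Ring A] [Algebra F A] (T : A →ₗ[F] F) (σ : A →ₗ[F] A) (ℓ : A) :
    Ring (CliffordAlg F A T σ ℓ) := inferInstanceAs (Ring (RingQuot _))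

instance (A : Type) [Ring A] [Algebra F A] (T : A →ₗ[F] F) (σ : A →ₗ[F] A) (ℓ : A) :
    Algebra F (CliffordAlg F A T σ ℓ) := inferInstanceAs (Algebra F (RingQuot _))

/-- The canonical image of `a ∈ A` as a degree-one element of the Clifford algebra. -/
def cliffGen (A : Type) [Ring A] [Algebra F A] (T : A →ₗ[F] F)
    (σ : A →ₗ[F] A) (ℓ : A) (a : A) : CliffordAlg F A T σ ℓ :=
  RingQuot.mkAlgHom F (CliffordRel F A T σ ℓ) (TensorAlgebra.ι F a)

/-- The quadratic pair `(σ, f)` has trivial discriminant: the centre of its Clifford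
algebra is the split étale quadratic algebra, i.e. contains a nontrivial idempotent. -/
def HasTrivialDiscriminant (A : Type) [Ring A] [Algebra F A] (T : A →ₗ[F] F)
    (σ : A →ₗ[F] A) (ℓ : A) : Prop :=
  ∃ e : CliffordAlg F A T σ ℓ, e ∈ Subalgebra.center F (CliffordAlg F A T σ ℓ) ∧
    e * e = e ∧ e ≠ 0 ∧ e ≠ 1

/-- `(A, σ)` (an algebra with involution) is a quadratic extension of the algebra with
unitary involution `(C, σ_C)`, where `uC` is a distinguished generator of the centre `K`
of `C` over `F`:  `C` embeds in `A` compatibly with the involutions, with image the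
centralizer of the image of `K`. -/
def IsInvQuadExt (A : Type) [Ring A] [Algebra F A] (σ : A →ₗ[F] A)
    (C : Type) [Ring C] [Algebra F C] (σC : C →ₗ[F] C) (uC : C) : Prop :=
  ∃ j : C →ₐ[F] A, Function.Injective j ∧ (∀ x : C, σ (j x) = j (σC x)) ∧
    (Set.range (j : C → A) = Set.centralizer {j uC})

/-- `(A, σ, f_ℓ)` (an algebra with quadratic pair) is a quadratic extension of the
algebra with unitary involution `(C, σ_C)`:  in addition to the conditions of
`IsInvQuadExt`, the semi-trace `f_ℓ` coincides on symmetric elements with `f_{ℓK}` for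
some generator `ℓK` of the quadratic étale algebra `K = F[j(uC)] ⊆ A` with
`ℓK² - ℓK ∈ F`. -/
def IsQPQuadExt (A : Type) [Ring A] [Algebra F A] (T : A →ₗ[F] F)
    (σ : A →ₗ[F] A) (ℓ : A)
    (C : Type) [Ring C] [Algebra F C] (σC : C →ₗ[F] C) (uC : C) : Prop :=
  ∃ j : C →ₐ[F] A, Function.Injective j ∧ (∀ x : C, σ (j x) = j (σC x)) ∧
    (Set.range (j : C → A) = Set.centralizer {j uC}) ∧
    ∃ ℓK ∈ Algebra.adjoin F ({j uC} : Set A),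
      ℓK ∉ Set.range (algebraMap F A) ∧
      (ℓK * ℓK - ℓK) ∈ Set.range (algebraMap F A) ∧
      ∀ s : A, σ s = s → T (ℓ * s) = T (ℓK * s)

/-- The algebra with unitary involution `(C, σ_C)` is isotropic: there is a nonzero
right ideal `J` with `σ_C(J)·J = 0`. -/
def UnitaryIsotropic (C : Type) [Ring C] [Algebra F C] (σC : C →ₗ[F] C) : Prop :=
  ∃ J : Submodule F C, IsRightIdeal F C J ∧ (∀ x ∈ J, ∀ y ∈ J, σC x * y = 0) ∧ J ≠ ⊥

/-- The algebra with unitary involution `(C, σ_C)` is hyperbolic: there is a right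
ideal `J` with `σ_C(J)·J = 0` of half the dimension (over `F`; equivalently, of half the
dimension over the centre). -/
def UnitaryHyperbolic (C : Type) [Ring C] [Algebra F C] (σC : C →ₗ[F] C) : Prop :=
  ∃ J : Submodule F C, IsRightIdeal F C J ∧ (∀ x ∈ J, ∀ y ∈ J, σC x * y = 0) ∧
    2 * Module.finrank F J = Module.finrank F C

/-- The 3-fold quadratic Pfister form `⟨⟨a, b, c]]` on `F⁸`. -/
def pfister3Form (a b c : F) : (Fin 8 → F) → F := fun v =>
  (v 0 * v 0 + v 0 * v 1 + c * (v 1 * v 1))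
  + a * (v 2 * v 2 + v 2 * v 3 + c * (v 3 * v 3))
  + b * (v 4 * v 4 + v 4 * v 5 + c * (v 5 * v 5))
  + a * b * (v 6 * v 6 + v 6 * v 7 + c * (v 7 * v 7))

/-- `I_q³ F = 0`: every 3-fold quadratic Pfister form over `F` is hyperbolic, i.e.
vanishes on a totally isotropic subspace of half the dimension. -/
def I3Trivial : Prop :=
  ∀ a b c : F, a ≠ 0 → b ≠ 0 → (1 : F) - 4 * c ≠ 0 →
    ∃ W : Submodule F (Fin 8 → F), Module.finrank F W = 4 ∧
      ∀ v ∈ W, pfister3Form F a b c v = 0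

/-- An algebra with quadratic pair, bundled. -/
structure QPAlgebra : Type 1 where
  A : Type
  [ring : Ring A]
  [alg : Algebra F A]
  T : A →ₗ[F] F
  σ : A →ₗ[F] A
  ℓ : A
  csa : IsCSA F A
  trd : IsReducedTrace F A T
  pair : IsQuadraticPair F A T σ ℓ

attribute [instance] QPAlgebra.ring QPAlgebra.alg

/-- A trialitarian triple: three degree-8 algebras with quadratic pair such that the
Clifford algebra of the first, with its canonical quadratic pair, is isomorphic to the
product of the other two.  The isomorphism intertwines the canonical involution of the
Clifford algebra (which maps the degree-one generator attached to `a` to the one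
attached to `σ(a)`) with the product involution; since the degree-one elements generate
the Clifford algebra, this is recorded on generators. -/
def IsTrialitarianTriple (X Y Z : QPAlgebra F) : Prop :=
  Module.finrank F X.A = 64 ∧ Module.finrank F Y.A = 64 ∧ Module.finrank F Z.A = 64 ∧
  ∃ φ : CliffordAlg F X.A X.T X.σ X.ℓ ≃ₐ[F] (Y.A × Z.A),
    ∀ a : X.A,
      φ (cliffGen F X.A X.T X.σ X.ℓ (X.σ a)) =
        (Y.σ (φ (cliffGen F X.A X.T X.σ X.ℓ a)).1,
         Z.σ (φ (cliffGen F X.A X.T X.σ X.ℓ a)).2)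

/-- A trialitarian triple is isotropic if one of its three members is isotropic
(equivalently, by triality, each of them is). -/
def TripleIsotropic (X Y Z : QPAlgebra F) : Prop :=
  QPIsotropic F X.A X.T X.σ X.ℓ ∨ QPIsotropic F Y.A Y.T Y.σ Y.ℓ ∨
    QPIsotropic F Z.A Z.T Z.σ Z.ℓ

/-- The (unordered) triple of Schur indices of a trialitarian triple; the index
`ind T = (a, b, c)` with `a ≤ b ≤ c` of the paper corresponds to this multiset being
`{a, b, c}`. -/
def indexMultiset (X Y Z : QPAlgebra F) : Multiset ℕ :=
  {schurIndex F X.A, schurIndex F Y.A, schurIndex F Z.A}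

/-- The relations of the quaternion algebra `[a, b)_F = F⟨i, j⟩` with
`i² - i = a`, `j² = b`, `ji = (1 - i)j`. -/
inductive QuatRel (a b : F) : FreeAlgebra F (Fin 2) → FreeAlgebra F (Fin 2) → Prop
  | ii : QuatRel a b (FreeAlgebra.ι F 0 * FreeAlgebra.ι F 0)
      (FreeAlgebra.ι F 0 + algebraMap F _ a)
  | jj : QuatRel a b (FreeAlgebra.ι F 1 * FreeAlgebra.ι F 1) (algebraMap F _ b)
  | ji : QuatRel a b (FreeAlgebra.ι F 1 * FreeAlgebra.ι F 0)
      ((1 - FreeAlgebra.ι F 0) * FreeAlgebra.ι F 1)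

/-- The quaternion algebra `[a, b)_F`, presented by generators and relations. -/
def QuatAlg (a b : F) : Type := RingQuot (QuatRel F a b)

instance (a b : F) : Ring (QuatAlg F a b) := inferInstanceAs (Ring (RingQuot _))
instance (a b : F) : Algebra F (QuatAlg F a b) := inferInstanceAs (Algebra F (RingQuot _))

/-- A ring in which every nonzero element is invertible. -/
def IsDivision (A : Type) [Ring A] : Prop := ∀ x : A, x ≠ 0 → IsUnit x

end Triality

end

namespace Triality

/-- A witness for the existence of an anisotropic trialitarian triple of prescribed
index over some field of characteristic 2 satisfying `I_q³ = 0`. -/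
structure AnisotropicTripleWitness (idx : Multiset ℕ) : Type 1 where
  F : Type
  [field : Field F]
  char2 : ringChar F = 2
  i3 : I3Trivial F
  X : QPAlgebra F
  Y : QPAlgebra F
  Z : QPAlgebra F
  trial : IsTrialitarianTriple F X Y Z
  aniso : ¬ TripleIsotropic F X Y Z
  idx_eq : indexMultiset F X Y Z = idx

set_option linter.unusedSectionVars false

open scoped Quaternion

section Forms

variable {Ω : Type*} [Field Ω] {R : Type*} [Ring R] [Algebra Ω R] {ι : Type*}

/-- The `K`-form of the `Ω`-span of `v` inside the `Ω`-algebra `R`. -/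
def form (K : Subfield Ω) (v : ι → R) : Submodule K R := Submodule.span K (Set.range v)

/-- The family `v` is `Ω`-independent and its `K`-span is a subring. -/
structure IsForm (K : Subfield Ω) (v : ι → R) : Prop where
  li : LinearIndependent Ω v
  one : (1 : R) ∈ form K v
  mul : ∀ i j, v i * v j ∈ form K v

/-- The `K`-span of `v` has no zero divisors. -/
def Dom (K : Subfield Ω) (v : ι → R) : Prop :=
  ∀ r ∈ form K v, ∀ s ∈ form K v, r * s = 0 → r = 0 ∨ s = 0

lemma form_mono {K K' : Subfield Ω} (h : K ≤ K') (v : ι → R) {r : R} (hr : r ∈ form K v) :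
    r ∈ form K' v := by
  induction hr using Submodule.span_induction with
  | mem x hx => exact Submodule.subset_span hx
  | zero => exact zero_mem _
  | add x y _ _ hx hy => exact add_mem hx hy
  | smul a x _ hx => exact (form K' v).smul_mem (⟨a.1, h a.2⟩ : K') hx

lemma IsForm.mono {K K' : Subfield Ω} (h : K ≤ K') {v : ι → R} (hv : IsForm K v) :
    IsForm K' v :=
  ⟨hv.li, form_mono h v hv.one, fun i j => form_mono h v (hv.mul i j)⟩

/-- The `K`-span of `v` as a subalgebra. -/
def IsForm.alg {K : Subfield Ω} {v : ι → R} (hv : IsForm K v) : Subalgebra K R where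
  carrier := form K v
  mul_mem' {a b} ha hb := by
    have : form K v * form K v ≤ form K v := by
      rw [form, Submodule.span_mul_span, Submodule.span_le]
      rintro _ ⟨_, ⟨i, rfl⟩, _, ⟨j, rfl⟩, rfl⟩
      exact hv.mul i j
    exact this (Submodule.mul_mem_mul ha hb)
  add_mem' ha hb := add_mem ha hb
  algebraMap_mem' r := by
    rw [Algebra.algebraMap_eq_smul_one]
    exact (form K v).smul_mem r hv.one

lemma IsForm.algebraMap_mem {K : Subfield Ω} {v : ι → R} (hv : IsForm K v) {a : Ω}
    (ha : a ∈ K) : algebraMap Ω R a ∈ form K v := hv.alg.algebraMap_mem ⟨a, ha⟩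

lemma IsForm.nontrivial {K : Subfield Ω} {v : ι → R} (hv : IsForm K v) [Nonempty ι] :
    Nontrivial R := ⟨⟨v (Classical.arbitrary ι), 0, hv.li.ne_zero _⟩⟩

/-- `v` as a basis of the subalgebra. -/
noncomputable def IsForm.basis {K : Subfield Ω} {v : ι → R} (hv : IsForm K v) :
    Basis ι K hv.alg :=
  Basis.span (hv.li.restrict_scalars (R := K) (by
    intro a b hab
    ext
    simpa [Algebra.smul_def] using hab))

lemma IsForm.coe_basis {K : Subfield Ω} {v : ι → R} (hv : IsForm K v) (i : ι) :
    (hv.basis i : R) = v i := by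
  exact congrArg Subtype.val (Basis.span_apply (hv.li.restrict_scalars (R := K) (by
    intro a b hab
    ext
    simpa [Algebra.smul_def] using hab)) i)

lemma IsForm.noZeroDivisors {K : Subfield Ω} {v : ι → R} (hv : IsForm K v) (hd : Dom K v) :
    NoZeroDivisors hv.alg := by
  refine ⟨fun {a b} h => ?_⟩
  have := hd a a.2 b b.2 (by simpa using congrArg Subtype.val h)
  simpa using this

lemma IsForm.exists_inv [Finite ι] [Nonempty ι] {K : Subfield Ω} {v : ι → R} (hv : IsForm K v)
    (hd : Dom K v) {r : R} (hr : r ∈ form K v) (h0 : r ≠ 0) :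
    ∃ s ∈ form K v, r * s = 1 ∧ s * r = 1 := by
  have := hv.noZeroDivisors hd
  have := hv.nontrivial
  have : IsDomain hv.alg := NoZeroDivisors.to_isDomain _
  have : FiniteDimensional K hv.alg := Module.Finite.of_basis hv.basis
  let _ := divisionRingOfFiniteDimensional K hv.alg
  have h1 : (⟨r, hr⟩ : hv.alg) ≠ 0 := by simpa [Subtype.ext_iff] using h0
  refine ⟨((⟨r, hr⟩ : hv.alg)⁻¹ : hv.alg), Subtype.property _, ?_, ?_⟩
  · simpa using congrArg Subtype.val (mul_inv_cancel₀ h1)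
  · simpa using congrArg Subtype.val (inv_mul_cancel₀ h1)

/-- Every element of `K'` is a quotient of polynomials in `x` over `K`. -/
structure IsSimpleExt (K K' : Subfield Ω) (x : Ω) : Prop where
  le : K ≤ K'
  mem : x ∈ K'
  frac : ∀ a ∈ K', ∃ p q : Polynomial K, Polynomial.aeval x q ≠ 0 ∧
    a * Polynomial.aeval x q = Polynomial.aeval x p

section Poly
open Polynomial

variable {K K' : Subfield Ω} {v : ι → R} (hv : IsForm K v) (x : Ω)

/-- Evaluation at the central element `x` of polynomials over the `K`-form. -/
noncomputable def IsForm.ev : Polynomial hv.alg →+* R :=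
  Polynomial.eval₂RingHom' hv.alg.val.toRingHom (algebraMap Ω R x)
    (fun a => (Algebra.commutes x (a : R)).symm)

lemma IsForm.ev_C (a : hv.alg) : hv.ev x (C a) = a := by
  simp [IsForm.ev, eval₂RingHom']

lemma IsForm.ev_X : hv.ev x X = algebraMap Ω R x := by
  simp [IsForm.ev, eval₂RingHom']

lemma IsForm.ev_map (p : Polynomial K) :
    hv.ev x (p.map (algebraMap K hv.alg)) = algebraMap Ω R (aeval x p) := by
  induction p using Polynomial.induction_on' with
  | add p q hp hq => simp [hp, hq]
  | monomial n a =>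
    rw [map_monomial, ← C_mul_X_pow_eq_monomial, map_mul, map_pow, hv.ev_X, hv.ev_C,
      aeval_monomial, map_mul, map_pow]
    rfl

/-- The image of the evaluation map. -/
noncomputable def IsForm.evRange : Subring R := RingHom.range (R := Polynomial hv.alg) (hv.ev x)

lemma IsForm.ev_injective [Finite ι] (hx : Transcendental K x) :
    Function.Injective (hv.ev x) := by
  have := Fintype.ofFinite ι
  rw [injective_iff_map_eq_zero]
  intro P hP
  let p : ι → Polynomial K := fun i => ∑ n ∈ P.support, monomial n (hv.basis.repr (P.coeff n) i)
  have hc : ∀ i n, (p i).coeff n = hv.basis.repr (P.coeff n) i := by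
    intro i n
    simp only [p, finsetSum_coeff, coeff_monomial]
    by_cases hn : n ∈ P.support
    · simp [hn]
    · have h0 : P.coeff n = 0 := by simpa using hn
      simp [h0]
  have key : hv.ev x P = ∑ i, aeval x (p i) • v i := by
    have h1 : hv.ev x P = ∑ n ∈ P.support, (x ^ n) • (P.coeff n : R) := by
      conv_lhs => rw [P.as_sum_support]
      rw [map_sum]
      refine Finset.sum_congr rfl fun n _ => ?_
      rw [← C_mul_X_pow_eq_monomial, map_mul, map_pow, hv.ev_X, hv.ev_C, ← map_pow,
        Algebra.smul_def, Algebra.commutes]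
    have h2 : ∀ a : hv.alg, (a : R) = ∑ i, (hv.basis.repr a i : Ω) • v i := by
      intro a
      conv_lhs => rw [← hv.basis.sum_repr a]
      simp only [AddSubmonoidClass.coe_finsetSum]
      exact Finset.sum_congr rfl fun i _ => by rw [← hv.coe_basis]; rfl
    rw [h1]
    simp only [p, map_sum, aeval_monomial, Finset.sum_smul]
    rw [Finset.sum_comm]
    refine Finset.sum_congr rfl fun n _ => ?_
    rw [h2 (P.coeff n), Finset.smul_sum]
    refine Finset.sum_congr rfl fun i _ => ?_
    rw [smul_smul, mul_comm]; rfl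
  rw [key] at hP
  have h3 := Fintype.linearIndependent_iff.1 hv.li _ hP
  have h4 : ∀ i, p i = 0 := fun i => (transcendental_iff.1 hx) _ (h3 i)
  ext n
  have : P.coeff n = 0 := by
    apply hv.basis.repr.injective
    ext i
    rw [← hc, h4]; simp
  simp [this]

lemma IsForm.ev_mem (hK : K ≤ K') (hxm : x ∈ K') (P : Polynomial hv.alg) :
    hv.ev x P ∈ form K' v := by
  have hv' := hv.mono hK
  have : ∀ P, hv.ev x P ∈ hv'.alg := by
    intro P
    induction P using Polynomial.induction_on' with
    | add p q hp hq => rw [map_add]; exact add_mem hp hq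
    | monomial n a =>
      rw [← C_mul_X_pow_eq_monomial, map_mul, map_pow, hv.ev_X, hv.ev_C]
      exact hv'.alg.mul_mem (form_mono hK v a.2) (hv'.alg.pow_mem (hv'.algebraMap_mem hxm) _)
  exact this P

lemma IsForm.clear (hK : IsSimpleExt K K' x) {r : R} (hr : r ∈ form K' v) :
    ∃ q : Polynomial K, aeval x q ≠ 0 ∧ algebraMap Ω R (aeval x q) * r ∈ hv.evRange x := by
  have hR : ∀ p : Polynomial K, algebraMap Ω R (aeval x p) ∈ hv.evRange x :=
    fun p => ⟨_, hv.ev_map x p⟩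
  induction hr using Submodule.span_induction with
  | mem r hr =>
    obtain ⟨i, rfl⟩ := hr
    refine ⟨1, by simp, ⟨C ⟨v i, Submodule.subset_span ⟨i, rfl⟩⟩, ?_⟩⟩
    rw [hv.ev_C]; simp
  | zero => exact ⟨1, by simp, by simp⟩
  | add r s _ _ hr hs =>
    obtain ⟨q, hq, h⟩ := hr
    obtain ⟨q', hq', h'⟩ := hs
    refine ⟨q * q', by simp [hq, hq'], ?_⟩
    have : algebraMap Ω R (aeval x (q * q')) * (r + s) =
        algebraMap Ω R (aeval x q') * (algebraMap Ω R (aeval x q) * r) +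
        algebraMap Ω R (aeval x q) * (algebraMap Ω R (aeval x q') * s) := by
      rw [mul_add, ← mul_assoc, ← mul_assoc, ← map_mul, ← map_mul, ← map_mul, ← map_mul,
        mul_comm q' q]
    rw [this]
    exact add_mem (mul_mem (hR _) h) (mul_mem (hR _) h')
  | smul a r _ hr =>
    obtain ⟨q, hq, h⟩ := hr
    obtain ⟨p', q', hq', h'⟩ := hK.frac a a.2
    refine ⟨q' * q, by simp [hq, hq'], ?_⟩
    have : algebraMap Ω R (aeval x (q' * q)) * (a • r) =
        algebraMap Ω R (aeval x p') * (algebraMap Ω R (aeval x q) * r) := by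
      have e : a • r = algebraMap Ω R a * r := by rw [← Algebra.smul_def]; rfl
      rw [e, ← h', ← mul_assoc, ← mul_assoc, ← map_mul, ← map_mul, map_mul (aeval x)]
      congr 2; ring
    rw [this]
    exact mul_mem (hR _) h

/-- Adjoining a transcendental central element preserves the absence of zero divisors. -/
lemma Dom.adjoin_transcendental [Finite ι] {x : Ω} (hd : Dom K v) (hx : Transcendental K x)
    (hK : IsSimpleExt K K' x) (hv : IsForm K v) : Dom K' v := by
  intro r hr s hs h
  have := hv.noZeroDivisors hd
  obtain ⟨q, hq, ⟨P, hP⟩⟩ := hv.clear x hK hr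
  obtain ⟨q', hq', ⟨P', hP'⟩⟩ := hv.clear x hK hs
  have hz : P * P' = 0 := by
    apply hv.ev_injective x hx
    rw [map_mul, hP, hP', map_zero, mul_assoc, ← mul_assoc r, ← Algebra.commutes, mul_assoc, h]
    simp
  have hu : ∀ q : Polynomial K, aeval x q ≠ 0 → ∀ r : R, algebraMap Ω R (aeval x q) * r = 0 → r = 0 := by
    intro q hq r h
    have := congrArg (fun t => algebraMap Ω R (aeval x q)⁻¹ * t) h
    simpa [← mul_assoc, ← map_mul, inv_mul_cancel₀ hq] using this
  rcases mul_eq_zero.1 hz with h | h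
  · left; exact hu q hq r (by rw [← hP, h, map_zero])
  · right; exact hu q' hq' s (by rw [← hP', h, map_zero])

/-- Two commuting elements of the form over `K(x)` which are quadratic over `K[x]` can be
simultaneously conjugated into the form over `K[x]`. -/
lemma IsForm.exists_conj [Finite ι] [Nonempty ι] {x : Ω} (hd : Dom K v) (hx : Transcendental K x)
    (hK : IsSimpleExt K K' x) {e f : R} (he : e ∈ form K' v) (hf : f ∈ form K' v)
    (hef : e * f = f * e)
    (he2 : ∃ p q : Polynomial K, e * e = algebraMap Ω R (aeval x p) * e + algebraMap Ω R (aeval x q))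
    (hf2 : ∃ p q : Polynomial K, f * f = algebraMap Ω R (aeval x p) * f + algebraMap Ω R (aeval x q)) :
    ∃ g g' : R, g * g' = 1 ∧ g' * g = 1 ∧ g' * e * g ∈ hv.evRange x ∧
      g' * f * g ∈ hv.evRange x := by
  have hv' := hv.mono hK.le
  have := hv.noZeroDivisors hd
  have := hv.nontrivial
  have hinj := hv.ev_injective x hx
  set S := hv.evRange x with hS
  have hR : ∀ p : Polynomial K, algebraMap Ω R (aeval x p) ∈ S :=
    fun p => ⟨_, hv.ev_map x p⟩
  let J : Set (Polynomial hv.alg) := {P | e * hv.ev x P ∈ S ∧ f * hv.ev x P ∈ S ∧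
    e * f * hv.ev x P ∈ S}
  have Jsub : ∀ P ∈ J, ∀ Q ∈ J, P - Q ∈ J := by
    rintro P ⟨h1, h2, h3⟩ Q ⟨k1, k2, k3⟩
    have : hv.ev x (P - Q) = hv.ev x P - hv.ev x Q :=
      eq_sub_of_add_eq ((map_add _ _ _).symm.trans (congrArg (hv.ev x) (sub_add_cancel P Q)))
    simp only [J, Set.mem_ofPred_eq, this, mul_sub]
    exact ⟨sub_mem h1 k1, sub_mem h2 k2, sub_mem h3 k3⟩
  have Jmul : ∀ P ∈ J, ∀ Q, P * Q ∈ J := by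
    rintro P ⟨h1, h2, h3⟩ Q
    simp only [J, Set.mem_ofPred_eq, map_mul, ← mul_assoc]
    exact ⟨mul_mem h1 ⟨Q, rfl⟩, mul_mem h2 ⟨Q, rfl⟩, mul_mem h3 ⟨Q, rfl⟩⟩
  have Jne : ∃ P ∈ J, P ≠ 0 := by
    have hm : ∀ a ∈ form K' v, ∀ b ∈ form K' v, a * b ∈ form K' v :=
      fun a ha b hb => hv'.alg.mul_mem ha hb
    obtain ⟨q1, h1, k1⟩ := hv.clear x hK he
    obtain ⟨q2, h2, k2⟩ := hv.clear x hK hf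
    obtain ⟨q3, h3, k3⟩ := hv.clear x hK (hm e he f hf)
    have hc : ∀ q : Polynomial K, ∀ r, r * algebraMap Ω R (aeval x q) =
      algebraMap Ω R (aeval x q) * r := fun q r => (Algebra.commutes _ _).symm
    refine ⟨(q1 * q2 * q3).map (algebraMap K hv.alg), ⟨?_, ?_, ?_⟩, ?_⟩
    · rw [hv.ev_map, hc, show q1 * q2 * q3 = q2 * q3 * q1 by ring, map_mul, map_mul, mul_assoc]
      exact mul_mem (hR _) k1
    · rw [hv.ev_map, hc, show q1 * q2 * q3 = q1 * q3 * q2 by ring, map_mul, map_mul, mul_assoc]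
      exact mul_mem (hR _) k2
    · rw [hv.ev_map, hc, map_mul, map_mul, mul_assoc]
      exact mul_mem (hR _) k3
    · intro h
      have := congrArg (hv.ev x) h
      rw [hv.ev_map, map_zero, map_eq_zero_iff _ (algebraMap Ω R).injective] at this
      simp [h1, h2, h3] at this
  have Je : ∀ P ∈ J, ∀ Q, hv.ev x Q = e * hv.ev x P → Q ∈ J := by
    rintro P ⟨h1, h2, h3⟩ Q hQ
    obtain ⟨p, q, hpq⟩ := he2
    have h4 : f * (e * hv.ev x P) ∈ S := by rw [← mul_assoc, ← hef]; exact h3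
    refine ⟨?_, ?_, ?_⟩
    · rw [hQ, ← mul_assoc, hpq, add_mul, mul_assoc]
      exact add_mem (mul_mem (hR _) h1) (mul_mem (hR _) ⟨P, rfl⟩)
    · rw [hQ]; exact h4
    · rw [hQ, mul_assoc, ← mul_assoc f, ← hef, ← mul_assoc, ← mul_assoc, hpq, add_mul, add_mul,
        mul_assoc, mul_assoc, mul_assoc, ← mul_assoc e]
      exact add_mem (mul_mem (hR _) h3) (mul_mem (hR _) h2)
  have Jf : ∀ P ∈ J, ∀ Q, hv.ev x Q = f * hv.ev x P → Q ∈ J := by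
    rintro P ⟨h1, h2, h3⟩ Q hQ
    obtain ⟨p, q, hpq⟩ := hf2
    refine ⟨?_, ?_, ?_⟩
    · rw [hQ, ← mul_assoc]; exact h3
    · rw [hQ, ← mul_assoc, hpq, add_mul, mul_assoc]
      exact add_mem (mul_mem (hR _) h2) (mul_mem (hR _) ⟨P, rfl⟩)
    · have : e * f * hv.ev x Q = algebraMap Ω R (aeval x p) * (e * f * hv.ev x P) +
          algebraMap Ω R (aeval x q) * (e * hv.ev x P) := by
        rw [hQ, mul_assoc, ← mul_assoc f, hpq, add_mul, mul_add, mul_assoc, ← mul_assoc e,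
          ← Algebra.commutes, ← mul_assoc e _ (hv.ev x P), ← Algebra.commutes]
        simp only [mul_assoc]
      rw [this]
      exact add_mem (mul_mem (hR _) h3) (mul_mem (hR _) h1)
  obtain ⟨P, hPJ, hPm, hPmin⟩ : ∃ P ∈ J, P.Monic ∧ ∀ Q ∈ J, Q ≠ 0 → P.degree ≤ Q.degree := by
    obtain ⟨P0, h0, h0'⟩ := Jne
    obtain ⟨P1, ⟨h1, h1'⟩, hmin⟩ := (WellFounded.has_min
      (InvImage.wf (fun P : Polynomial hv.alg => P.degree) wellFounded_lt)
      {P | P ∈ J ∧ P ≠ 0} ⟨P0, h0, h0'⟩)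
    obtain ⟨s, hs, hs1, hs2⟩ := hv.exists_inv hd P1.leadingCoeff.2
      (by simpa [Subtype.ext_iff] using leadingCoeff_ne_zero.2 h1')
    have hs1' : P1.leadingCoeff * (⟨s, hs⟩ : hv.alg) = 1 := Subtype.ext hs1
    have hdeg : P1.degree = (P1 * C (⟨s, hs⟩ : hv.alg)).degree := by
      rw [degree_mul, degree_C, add_zero]
      rintro h
      rw [h] at hs1'
      simp at hs1'
    refine ⟨P1 * C (⟨s, hs⟩ : hv.alg), Jmul _ h1 _, ?_, ?_⟩
    · rw [Monic, leadingCoeff_mul, leadingCoeff_C, hs1']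
    · intro Q hQ hQ0
      rw [← hdeg]
      exact not_lt.1 (hmin Q ⟨hQ, hQ0⟩)
  have hdvd : ∀ Q ∈ J, ∃ H, Q = P * H := by
    intro Q hQ
    refine ⟨Q /ₘ P, ?_⟩
    have h1 := modByMonic_add_div Q P
    have h2 : Q %ₘ P = 0 := by
      by_contra hne
      have h3 : Q %ₘ P ∈ J := by
        have : Q %ₘ P = Q - P * (Q /ₘ P)  := eq_sub_of_add_eq h1
        rw [this]
        exact Jsub _ hQ _ (Jmul _ hPJ _)
      exact absurd (degree_modByMonic_lt Q hPm) (not_lt.2 (hPmin _ h3 hne))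
    rw [h2, zero_add] at h1
    exact h1.symm
  have hg0 : hv.ev x P ≠ 0 := by
    rw [Ne, map_eq_zero_iff _ hinj]
    exact hPm.ne_zero
  obtain ⟨g', -, hg1, hg2⟩ := hv'.exists_inv (hd.adjoin_transcendental hx hK hv)
    (hv.ev_mem x hK.le hK.mem P) hg0
  refine ⟨hv.ev x P, g', hg1, hg2, ?_, ?_⟩
  · obtain ⟨Q, hQ⟩ := hPJ.1
    obtain ⟨H, rfl⟩ := hdvd Q (Je P hPJ Q hQ)
    rw [mul_assoc, ← hQ, map_mul, ← mul_assoc, hg2, one_mul]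
    exact ⟨H, rfl⟩
  · obtain ⟨Q, hQ⟩ := hPJ.2.1
    obtain ⟨H, rfl⟩ := hdvd Q (Jf P hPJ Q hQ)
    rw [mul_assoc, ← hQ, map_mul, ← mul_assoc, hg2, one_mul]
    exact ⟨H, rfl⟩

end Poly
end Forms

section FormsB
open Polynomial
variable {Ω : Type*} [Field Ω] {R : Type*} [Ring R] [Algebra Ω R] {ι : Type*}
variable {K K' : Subfield Ω} {v : ι → R}

lemma natDegree_le_one_of_mul_self {S : Type*} [Ring S] [NoZeroDivisors S] {P A : S[X]} {c : S}
    (h : P * P = C c * P + A) (hA : A.natDegree ≤ 2) : P.natDegree ≤ 1 := by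
  by_contra hn
  push Not at hn
  have h0 : P ≠ 0 := by rintro rfl; simp at hn
  have h1 : (P * P).natDegree = P.natDegree + P.natDegree := natDegree_mul h0 h0
  have h2 : (C c * P + A).natDegree ≤ max (C c * P).natDegree A.natDegree := natDegree_add_le _ _
  have h3 : (C c * P).natDegree ≤ P.natDegree := natDegree_C_mul_le _ _
  rw [← h, h1] at h2
  have : max (C c * P).natDegree A.natDegree ≤ max P.natDegree 2 := max_le_max h3 hA
  have := h2.trans this
  rcases le_max_iff.1 this with h | h <;> omega

lemma eq_linear {S : Type*} [Ring S] {P : S[X]} (h : P.natDegree ≤ 1) :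
    P = C (P.coeff 0) + C (P.coeff 1) * X := by
  rw [add_comm]
  exact eq_X_add_C_of_natDegree_le_one h

lemma coeff_quad {S : Type*} [Ring S] (a0 a1 a2 : S) :
    (C a0 + C a1 * X + C a2 * X ^ 2 : S[X]).coeff 0 = a0 ∧
    (C a0 + C a1 * X + C a2 * X ^ 2 : S[X]).coeff 1 = a1 ∧
    (C a0 + C a1 * X + C a2 * X ^ 2 : S[X]).coeff 2 = a2 := by
  refine ⟨?_, ?_, ?_⟩ <;> simp [coeff_X, coeff_C, coeff_X_pow]

lemma linear_mul_linear {S : Type*} [Ring S] (e0 e1 f0 f1 : S) :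
    (C e0 + C e1 * X : S[X]) * (C f0 + C f1 * X) =
      C (e0 * f0) + C (e0 * f1 + e1 * f0) * X + C (e1 * f1) * X ^ 2 := by
  have h := X_mul_C f0
  have h' := X_mul_C f1
  simp only [add_mul, mul_add, map_mul, map_add, mul_assoc, X_mul_C, pow_two]
  rw [← mul_assoc X (C f1), X_mul_C, mul_assoc]
  abel

lemma quad_inj {S : Type*} [Ring S] {a0 a1 a2 b0 b1 b2 : S}
    (h : (C a0 + C a1 * X + C a2 * X ^ 2 : S[X]) = C b0 + C b1 * X + C b2 * X ^ 2) :
    a0 = b0 ∧ a1 = b1 ∧ a2 = b2 := by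
  obtain ⟨h0, h1, h2⟩ := coeff_quad a0 a1 a2
  obtain ⟨k0, k1, k2⟩ := coeff_quad b0 b1 b2
  exact ⟨by rw [← h0, h, k0], by rw [← h1, h, k1], by rw [← h2, h, k2]⟩

lemma IsForm.ev_quad (hv : IsForm K v) (x : Ω) (a0 a1 a2 : hv.alg) :
    hv.ev x (C a0 + C a1 * X + C a2 * X ^ 2) =
      a0 + algebraMap Ω R x * a1 + algebraMap Ω R (x ^ 2) * a2 := by
  simp only [map_add, map_mul, map_pow, hv.ev_C, hv.ev_X]
  rw [← map_pow, ← Algebra.commutes, ← Algebra.commutes]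

/-- Two commuting elements over `K(x)`, satisfying quadratic equations with coefficients of
degree at most two in `x`, yield linear polynomials over `K` satisfying the same relations. -/
lemma IsForm.descend [Finite ι] [Nonempty ι] (hv : IsForm K v) (hd : Dom K v) {x : Ω}
    (hx : Transcendental K x) (hK : IsSimpleExt K K' x) {e f : R} (he : e ∈ form K' v)
    (hf : f ∈ form K' v) (hef : e * f = f * e) (c a0 a1 a2 d b0 b1 b2 : K)
    (he2 : e * e = algebraMap Ω R c * e + algebraMap Ω R (a0 + x * a1 + x ^ 2 * a2))
    (hf2 : f * f = algebraMap Ω R d * f + algebraMap Ω R (b0 + x * b1 + x ^ 2 * b2)) :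
    ∃ e0 ∈ form K v, ∃ e1 ∈ form K v, ∃ f0 ∈ form K v, ∃ f1 ∈ form K v,
      e0 * e0 = algebraMap Ω R c * e0 + algebraMap Ω R a0 ∧
      e0 * e1 + e1 * e0 = algebraMap Ω R c * e1 + algebraMap Ω R a1 ∧
      e1 * e1 = algebraMap Ω R a2 ∧
      f0 * f0 = algebraMap Ω R d * f0 + algebraMap Ω R b0 ∧
      f0 * f1 + f1 * f0 = algebraMap Ω R d * f1 + algebraMap Ω R b1 ∧
      f1 * f1 = algebraMap Ω R b2 ∧
      e0 * f0 = f0 * e0 ∧ e0 * f1 + e1 * f0 = f0 * e1 + f1 * e0 ∧ e1 * f1 = f1 * e1 := by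
  have := hv.noZeroDivisors hd
  have hinj := hv.ev_injective x hx
  have key : ∀ c a0 a1 a2 : K, ∃ p q : Polynomial K, algebraMap Ω R (aeval x p) = algebraMap Ω R c ∧
      algebraMap Ω R (aeval x q) = algebraMap Ω R (a0 + x * a1 + x ^ 2 * a2) := by
    intro c a0 a1 a2
    refine ⟨C c, C a0 + X * C a1 + X ^ 2 * C a2, ?_, ?_⟩
    · rw [aeval_C]; rfl
    · simp only [map_add, map_mul, aeval_C, aeval_X, map_pow]; rfl
  obtain ⟨g, g', h1, h2, ⟨P, hP⟩, ⟨Q, hQ⟩⟩ := hv.exists_conj hd hx hK he hf hef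
    (by obtain ⟨p, q, hp, hq⟩ := key c a0 a1 a2; exact ⟨p, q, by rw [hp, hq, he2]⟩)
    (by obtain ⟨p, q, hp, hq⟩ := key d b0 b1 b2; exact ⟨p, q, by rw [hp, hq, hf2]⟩)
  have conj : ∀ s t : R, (g' * s * g) * (g' * t * g) = g' * (s * t) * g := by
    intro s t
    calc _ = g' * s * (g * g') * t * g := by simp only [mul_assoc]
      _ = _ := by rw [h1]; simp only [mul_assoc, mul_one]
  have quadP : ∀ (c a0 a1 a2 : K) (s : R) (P : hv.alg[X]), hv.ev x P = g' * s * g →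
      s * s = algebraMap Ω R c * s + algebraMap Ω R (a0 + x * a1 + x ^ 2 * a2) →
      P * P = C (algebraMap K hv.alg c) * P + (C (algebraMap K hv.alg a0) +
        C (algebraMap K hv.alg a1) * X + C (algebraMap K hv.alg a2) * X ^ 2) := by
    intro c a0 a1 a2 s P hP hs
    apply hinj
    rw [map_add, hv.ev_quad, map_mul, map_mul, hv.ev_C, hP, conj, hs]
    have t1 : ∀ (z : Ω) (s : R), g' * (algebraMap Ω R z * s) * g = algebraMap Ω R z * (g' * s * g) := by
      intro z s
      rw [← mul_assoc, ← Algebra.commutes, mul_assoc, mul_assoc, mul_assoc]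
    have t2 : ∀ z : Ω, g' * algebraMap Ω R z * g = algebraMap Ω R z := by
      intro z
      rw [← Algebra.commutes, mul_assoc, h2, mul_one]
    rw [mul_add, add_mul, t1, t2, map_add, map_add, map_mul, map_mul]
    rfl
  have hPq := quadP c a0 a1 a2 e P hP he2
  have hQq := quadP d b0 b1 b2 f Q hQ hf2
  have hdeg : ∀ a0 a1 a2 : hv.alg, (C a0 + C a1 * X + C a2 * X ^ 2).natDegree ≤ 2 := by
    intro a0 a1 a2
    rw [natDegree_le_iff_degree_le, add_comm, add_comm (C a0), ← add_assoc]
    exact degree_quadratic_le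
  have hPl := eq_linear (natDegree_le_one_of_mul_self hPq (hdeg _ _ _))
  have hQl := eq_linear (natDegree_le_one_of_mul_self hQq (hdeg _ _ _))
  have hcomm : P * Q = Q * P := by
    apply hinj
    rw [map_mul, map_mul, hP, hQ, conj, conj, hef]
  set e0 := P.coeff 0
  set e1 := P.coeff 1
  set f0 := Q.coeff 0
  set f1 := Q.coeff 1
  have expand : ∀ (c a0 a1 a2 e0 e1 : hv.alg), C c * (C e0 + C e1 * X) +
      (C a0 + C a1 * X + C a2 * X ^ 2) = C (c * e0 + a0) + C (c * e1 + a1) * X + C a2 * X ^ 2 := by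
    intro c a0 a1 a2 e0 e1
    simp only [mul_add, map_add, map_mul, add_mul, mul_assoc]
    abel
  rw [hPl, linear_mul_linear, expand] at hPq
  rw [hQl, linear_mul_linear, expand] at hQq
  rw [hPl, hQl, linear_mul_linear, linear_mul_linear] at hcomm
  obtain ⟨i1, i2, i3⟩ := quad_inj hPq
  obtain ⟨j1, j2, j3⟩ := quad_inj hQq
  obtain ⟨k1, k2, k3⟩ := quad_inj hcomm
  refine ⟨e0, e0.2, e1, e1.2, f0, f0.2, f1, f1.2, ?_, ?_, ?_, ?_, ?_, ?_, ?_, ?_, ?_⟩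
  · exact congrArg Subtype.val i1
  · exact congrArg Subtype.val i2
  · exact congrArg Subtype.val i3
  · exact congrArg Subtype.val j1
  · exact congrArg Subtype.val j2
  · exact congrArg Subtype.val j3
  · exact congrArg Subtype.val k1
  · exact congrArg Subtype.val k2
  · exact congrArg Subtype.val k3

end FormsB

section FormsC
open Polynomial
variable {Ω : Type*} [Field Ω] {R : Type*} [Ring R] [Algebra Ω R] {ι : Type*}
variable {K K' : Subfield Ω} {v : ι → R}

/-- Commuting quadratic extension. -/
lemma no_zero_of_commuting [CharP R 2] {S : Subring R}
    (hinv : ∀ s ∈ S, s ≠ 0 → ∃ t ∈ S, t * s = 1) {w ε δ : R} (hε : ε ∈ S) (hδ : δ ∈ S)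
    (hεc : ∀ s ∈ S, s * ε = ε * s) (hδc : ∀ s ∈ S, s * δ = δ * s) (hw : ∀ s ∈ S, w * s = s * w)
    (hw2 : w * w = ε * w + δ) (hno : ∀ θ ∈ S, θ * θ ≠ ε * θ + δ) {u0 u1 v0 v1 : R}
    (hu0 : u0 ∈ S) (hu1 : u1 ∈ S) (hv0 : v0 ∈ S) (hv1 : v1 ∈ S)
    (h : (u0 + u1 * w) * (v0 + v1 * w) = 0) : u0 + u1 * w = 0 ∨ v0 + v1 * w = 0 := by
  by_cases hz : u1 = 0
  · subst hz
    by_cases hz0 : u0 = 0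
    · left; simp [hz0]
    · right
      obtain ⟨t, -, ht⟩ := hinv _ hu0 hz0
      have := congrArg (t * ·) h
      simpa [← mul_assoc, ht] using this
  · right
    obtain ⟨t, htS, ht⟩ := hinv _ hu1 hz
    set θ := t * u0 with hθ
    have hθS : θ ∈ S := S.mul_mem htS hu0
    have h1 : (θ + w) * (v0 + v1 * w) = 0 := by
      have := congrArg (t * ·) h
      simp only [← mul_assoc, mul_add, ht, one_mul, mul_zero] at this
      simpa [hθ, mul_add, mul_assoc] using this
    have h2 : (θ * v0 + v1 * δ) + (v0 + θ * v1 + v1 * ε) * w = 0 := by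
      have e : w * (v1 * w) = v1 * ε * w + v1 * δ := by
        rw [← mul_assoc, hw v1 hv1, mul_assoc, hw2]
        simp only [mul_add, mul_assoc]
      rw [← h1, add_mul θ w, mul_add θ, mul_add w, e, hw v0 hv0]
      simp only [add_mul, mul_assoc]
      abel
    have indep : ∀ a ∈ S, ∀ b ∈ S, a + b * w = 0 → a = 0 ∧ b = 0 := by
      intro a ha b hb hab
      by_cases hb0 : b = 0
      · subst hb0; simpa using hab
      · exfalso
        obtain ⟨s, hs, hsb⟩ := hinv _ hb hb0
        have e1 : s * a + w = 0 := by
          have := congrArg (s * ·) hab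
          simpa [← mul_assoc, mul_add, hsb] using this
        have e2 : w = s * a := by
          rw [← CharTwo.neg_eq (s * a)]; exact eq_neg_of_add_eq_zero_right e1
        exact hno w (by rw [e2]; exact S.mul_mem hs ha) hw2
    obtain ⟨h3, h4⟩ := indep _ (S.add_mem (S.mul_mem hθS hv0) (S.mul_mem hv1 hδ)) _
      (S.add_mem (S.add_mem hv0 (S.mul_mem hθS hv1)) (S.mul_mem hv1 hε)) h2
    have h5 : v0 = θ * v1 + v1 * ε := by
      have : v0 + (θ * v1 + v1 * ε) = 0 := by rw [← add_assoc]; exact h4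
      rw [eq_neg_of_add_eq_zero_left this, CharTwo.neg_eq]
    by_cases hv10 : v1 = 0
    · simp [h5, hv10]
    · exfalso
      obtain ⟨s, hs, hsv⟩ : ∃ s ∈ S, v1 * s = 1 := by
        obtain ⟨s, hs, hsv⟩ := hinv _ hv1 hv10
        by_cases hs0 : s = 0
        · have : (1 : R) = 0 := by rw [← hsv, hs0, zero_mul]
          exact ⟨0, S.zero_mem, by rw [mul_zero, this]⟩
        · obtain ⟨r, hr, hrs⟩ := hinv _ hs hs0
          refine ⟨s, hs, ?_⟩
          have : v1 = r := by rw [← one_mul v1, ← hrs, mul_assoc, hsv, mul_one]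
          rw [this, hrs]
      refine hno θ hθS ?_
      have e : (θ * θ + ε * θ + δ) * v1 = 0 := by
        rw [← h3, h5, hεc v1 hv1, hδc v1 hv1, mul_add, ← mul_assoc θ ε, hεc θ hθS]
        simp only [add_mul, mul_assoc]
      have e' : θ * θ + ε * θ + δ = 0 := by
        have := congrArg (· * s) e
        simpa [mul_assoc, hsv] using this
      rw [add_assoc] at e'
      rw [eq_neg_of_add_eq_zero_left e', CharTwo.neg_eq]

/-- Twisted quadratic extension. -/
lemma no_zero_of_twisted [CharP R 2] {S : Subring R}
    (hinv : ∀ s ∈ S, s ≠ 0 → ∃ t ∈ S, t * s = 1) {j δ : R} {σ : R →+* R} (hδ : δ ∈ S)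
    (hδc : ∀ s : R, s * δ = δ * s) (hσS : ∀ s ∈ S, σ s ∈ S) (hσσ : ∀ s, σ (σ s) = s)
    (hj : ∀ s, j * s = σ s * j)
    (hj2 : j * j = δ) (hno : ∀ θ ∈ S, θ * σ θ ≠ δ) {u0 u1 v0 v1 : R}
    (hu0 : u0 ∈ S) (hu1 : u1 ∈ S) (hv0 : v0 ∈ S) (hv1 : v1 ∈ S)
    (h : (u0 + u1 * j) * (v0 + v1 * j) = 0) : u0 + u1 * j = 0 ∨ v0 + v1 * j = 0 := by
  by_cases hz : u1 = 0
  · subst hz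
    by_cases hz0 : u0 = 0
    · left; simp [hz0]
    · right
      obtain ⟨t, -, ht⟩ := hinv _ hu0 hz0
      have := congrArg (t * ·) h
      simpa [← mul_assoc, ht] using this
  · right
    obtain ⟨t, htS, ht⟩ := hinv _ hu1 hz
    set θ := t * u0 with hθ
    have hθS : θ ∈ S := S.mul_mem htS hu0
    have h1 : (θ + j) * (v0 + v1 * j) = 0 := by
      have := congrArg (t * ·) h
      simp only [← mul_assoc, mul_add, ht, one_mul, mul_zero] at this
      simpa [hθ, mul_add, mul_assoc] using this
    have h2 : (θ * v0 + σ v1 * δ) + (σ v0 + θ * v1) * j = 0 := by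
      have e : j * (v1 * j) = σ v1 * δ := by
        rw [← mul_assoc, hj v1, mul_assoc, hj2]
      rw [← h1, add_mul θ j, mul_add θ, mul_add j, e, hj v0]
      simp only [add_mul, mul_assoc]
      abel
    have indep : ∀ a ∈ S, ∀ b ∈ S, a + b * j = 0 → a = 0 ∧ b = 0 := by
      intro a ha b hb hab
      by_cases hb0 : b = 0
      · subst hb0; simpa using hab
      · exfalso
        obtain ⟨s, hs, hsb⟩ := hinv _ hb hb0
        have e1 : s * a + j = 0 := by
          have := congrArg (s * ·) hab
          simpa [← mul_assoc, mul_add, hsb] using this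
        have e2 : j = s * a := by
          rw [← CharTwo.neg_eq (s * a)]; exact eq_neg_of_add_eq_zero_right e1
        have hjS : j ∈ S := by rw [e2]; exact S.mul_mem hs ha
        refine hno (σ j) (hσS _ hjS) ?_
        rw [hσσ, ← hj, hj2]
    obtain ⟨h3, h4⟩ := indep _ (S.add_mem (S.mul_mem hθS hv0) (S.mul_mem (hσS _ hv1) hδ)) _
      (S.add_mem (hσS _ hv0) (S.mul_mem hθS hv1)) h2
    have h5 : σ v0 = θ * v1 := by
      rw [eq_neg_of_add_eq_zero_left h4, CharTwo.neg_eq]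
    have h6 : v0 = σ θ * σ v1 := by rw [← map_mul, ← h5, hσσ]
    by_cases hv10 : v1 = 0
    · simp [h6, hv10]
    · exfalso
      have hs10 : σ v1 ≠ 0 := fun h => hv10 (by rw [← hσσ v1, h, map_zero])
      obtain ⟨s, hs, hsv⟩ : ∃ s ∈ S, σ v1 * s = 1 := by
        obtain ⟨s, hs, hsv⟩ := hinv _ (hσS _ hv1) hs10
        by_cases hs0 : s = 0
        · have : (1 : R) = 0 := by rw [← hsv, hs0, zero_mul]
          exact ⟨0, S.zero_mem, by rw [mul_zero, this]⟩
        · obtain ⟨r, hr, hrs⟩ := hinv _ hs hs0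
          refine ⟨s, hs, ?_⟩
          have : σ v1 = r := by rw [← one_mul (σ v1), ← hrs, mul_assoc, hsv, mul_one]
          rw [this, hrs]
      refine hno θ hθS ?_
      have e : (θ * σ θ + δ) * σ v1 = 0 := by
        rw [← h3, h6, add_mul, hδc]
        simp only [mul_assoc]
      have e' : θ * σ θ + δ = 0 := by
        have := congrArg (· * s) e
        simpa [mul_assoc, hsv] using this
      rw [eq_neg_of_add_eq_zero_left e', CharTwo.neg_eq]

/-- `K(x)`. -/
def adj (K : Subfield Ω) (x : Ω) : Subfield Ω := K ⊔ Subfield.closure {x}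

lemma le_adj (K : Subfield Ω) (x : Ω) : K ≤ adj K x := le_sup_left

lemma mem_adj (K : Subfield Ω) (x : Ω) : x ∈ adj K x :=
  (le_sup_right : Subfield.closure {x} ≤ adj K x) (Subfield.subset_closure rfl)

lemma adj_le {K L : Subfield Ω} {x : Ω} (h : K ≤ L) (hx : x ∈ L) : adj K x ≤ L :=
  sup_le h (Subfield.closure_le.2 (by simpa using hx))

lemma isSimpleExt_adj (K : Subfield Ω) (x : Ω) : IsSimpleExt K (adj K x) x := by
  refine ⟨le_adj K x, mem_adj K x, ?_⟩
  let L : Subfield Ω :=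
    { carrier := {a | ∃ p q : Polynomial K, aeval x q ≠ 0 ∧ a * aeval x q = aeval x p}
      mul_mem' := by
        rintro a b ⟨p, q, h, h'⟩ ⟨p', q', k, k'⟩
        exact ⟨p * p', q * q', by simp [h, k], by rw [map_mul, map_mul, ← h', ← k']; ring⟩
      one_mem' := ⟨1, 1, by simp, by simp⟩
      add_mem' := by
        rintro a b ⟨p, q, h, h'⟩ ⟨p', q', k, k'⟩
        exact ⟨p * q' + p' * q, q * q', by simp [h, k],
          by rw [map_mul, map_add, map_mul, map_mul, ← h', ← k']; ring⟩
      zero_mem' := ⟨0, 1, by simp, by simp⟩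
      neg_mem' := by
        rintro a ⟨p, q, h, h'⟩
        exact ⟨-p, q, h, by rw [map_neg, ← h']; ring⟩
      inv_mem' := by
        rintro a ⟨p, q, h, h'⟩
        by_cases ha : a = 0
        · exact ⟨0, 1, by simp, by simp [ha]⟩
        · refine ⟨q, p, by rw [← h']; exact mul_ne_zero ha h, ?_⟩
          rw [← h', ← mul_assoc, inv_mul_cancel₀ ha, one_mul] }
  have : adj K x ≤ L := by
    refine adj_le (fun a ha => ⟨C ⟨a, ha⟩, 1, by simp, ?_⟩) ⟨X, 1, by simp, by simp⟩
    rw [aeval_C]; simp; rfl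
  intro a ha
  exact this ha

lemma adj_add {K : Subfield Ω} (x : Ω) {c : Ω} (hc : c ∈ K) : adj K (x + c) = adj K x := by
  apply le_antisymm
  · exact adj_le (le_adj _ _) (add_mem (mem_adj _ _) (le_adj K x hc))
  · refine adj_le (le_adj _ _) ?_
    have := sub_mem (mem_adj K (x + c)) (le_adj K (x + c) hc)
    simpa using this

lemma adj_mul {K : Subfield Ω} (x : Ω) {c : Ω} (hc : c ∈ K) (h0 : c ≠ 0) :
    adj K (c * x) = adj K x := by
  apply le_antisymm
  · exact adj_le (le_adj _ _) (mul_mem (le_adj K x hc) (mem_adj _ _))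
  · refine adj_le (le_adj _ _) ?_
    have := mul_mem (inv_mem (le_adj K (c * x) hc)) (mem_adj K (c * x))
    simpa [h0] using this

lemma mem_adj_sqrt {K : Subfield Ω} {w a : Ω} (hw : w * w ∈ K) (ha : a ∈ adj K w) :
    ∃ b ∈ K, ∃ c ∈ K, a = b + c * w := by
  by_cases hwK : w ∈ K
  · exact ⟨a, adj_le le_rfl hwK ha, 0, zero_mem _, by simp⟩
  let L : Subfield Ω :=
    { carrier := {a | ∃ b ∈ K, ∃ c ∈ K, a = b + c * w}
      mul_mem' := by
        rintro _ _ ⟨b, hb, c, hc, rfl⟩ ⟨b', hb', c', hc', rfl⟩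
        exact ⟨b * b' + c * c' * (w * w), add_mem (mul_mem hb hb') (mul_mem (mul_mem hc hc') hw),
          b * c' + c * b', add_mem (mul_mem hb hc') (mul_mem hc hb'), by ring⟩
      one_mem' := ⟨1, one_mem _, 0, zero_mem _, by simp⟩
      add_mem' := by
        rintro _ _ ⟨b, hb, c, hc, rfl⟩ ⟨b', hb', c', hc', rfl⟩
        exact ⟨b + b', add_mem hb hb', c + c', add_mem hc hc', by ring⟩
      zero_mem' := ⟨0, zero_mem _, 0, zero_mem _, by simp⟩
      neg_mem' := by
        rintro _ ⟨b, hb, c, hc, rfl⟩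
        exact ⟨-b, neg_mem hb, -c, neg_mem hc, by ring⟩
      inv_mem' := by
        rintro _ ⟨b, hb, c, hc, rfl⟩
        have hn : b * b - c * c * (w * w) ∈ K :=
          sub_mem (mul_mem hb hb) (mul_mem (mul_mem hc hc) hw)
        by_cases hc0 : c = 0
        · exact ⟨b⁻¹, inv_mem hb, 0, zero_mem _, by simp [hc0]⟩
        have h1 : b + c * w ≠ 0 := by
          intro h
          apply hwK
          have : w = -(b * c⁻¹) := by field_simp; linear_combination h
          rw [this]
          exact neg_mem (mul_mem hb (inv_mem hc))
        have h2 : b - c * w ≠ 0 := by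
          intro h
          apply hwK
          have : w = (b * c⁻¹) := by field_simp; linear_combination -h
          rw [this]
          exact (mul_mem hb (inv_mem hc))
        have h3 : b * b - c * c * (w * w) = (b + c * w) * (b - c * w) := by ring
        refine ⟨b * (b * b - c * c * (w * w))⁻¹, mul_mem hb (inv_mem hn),
          -c * (b * b - c * c * (w * w))⁻¹, mul_mem (neg_mem hc) (inv_mem hn), ?_⟩
        rw [h3]
        field_simp
        ring }
  have : adj K w ≤ L := adj_le (fun a ha => ⟨a, ha, 0, zero_mem _, by simp⟩)
    ⟨0, zero_mem _, 1, one_mem _, by simp⟩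
  exact this ha

end FormsC

section FormsD
open Polynomial
variable {Ω : Type*} [Field Ω] {R : Type*} [Ring R] [Algebra Ω R] {ι : Type*}
variable {K K' : Subfield Ω} {v : ι → R}

/-- The family `v` together with `v·w`. -/
def extend (v : ι → R) (w : R) : ι ⊕ ι → R := Sum.elim v (fun i => v i * w)

lemma mem_form_extend {w r : R} :
    r ∈ form K (extend v w) ↔ ∃ a ∈ form K v, ∃ b ∈ form K v, r = a + b * w := by
  have h : form K (extend v w) = form K v ⊔ (form K v).map (LinearMap.mulRight K w) := by
    rw [form, form, extend, Set.Sum.elim_range, Submodule.span_union, Submodule.map_span,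
      ← Set.range_comp]
    rfl
  rw [h, Submodule.mem_sup]
  constructor
  · rintro ⟨a, ha, _, ⟨b, hb, rfl⟩, rfl⟩
    exact ⟨a, ha, b, hb, rfl⟩
  · rintro ⟨a, ha, b, hb, rfl⟩
    exact ⟨a, ha, _, ⟨b, hb, rfl⟩, rfl⟩

lemma form_le_extend {w r : R} (hr : r ∈ form K v) : r ∈ form K (extend v w) :=
  mem_form_extend.2 ⟨r, hr, 0, zero_mem _, by simp⟩

lemma conj_mem {w : R} (hw : ∀ i, ∃ s ∈ form K v, w * v i = s * w)
    {r : R} (hr : r ∈ form K v) : ∃ s ∈ form K v, w * r = s * w := by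
  induction hr using Submodule.span_induction with
  | mem x hx => obtain ⟨i, rfl⟩ := hx; exact hw i
  | zero => exact ⟨0, zero_mem _, by simp⟩
  | add x y _ _ hx hy =>
    obtain ⟨s, hs, h⟩ := hx
    obtain ⟨t, ht, h'⟩ := hy
    exact ⟨s + t, add_mem hs ht, by rw [mul_add, add_mul, h, h']⟩
  | smul a x _ hx =>
    obtain ⟨s, hs, h⟩ := hx
    exact ⟨a • s, (form K v).smul_mem a hs, by rw [mul_smul_comm, smul_mul_assoc, h]⟩

lemma IsForm.extend (hv : IsForm K v) {w : R} (hli : LinearIndependent Ω (extend v w))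
    (hw : ∀ i, ∃ s ∈ form K v, w * v i = s * w) (hw2 : ∃ a ∈ form K v, ∃ b ∈ form K v,
      w * w = a + b * w) : IsForm K (extend v w) := by
  have hm : ∀ a ∈ form K v, ∀ b ∈ form K v, a * b ∈ form K v :=
    fun a ha b hb => hv.alg.mul_mem ha hb
  have hmv : ∀ i, v i ∈ form K v := fun i => Submodule.subset_span ⟨i, rfl⟩
  have key : ∀ a ∈ form K v, ∀ b ∈ form K v, ∀ c ∈ form K v, ∀ d ∈ form K v,
      (a + b * w) * (c + d * w) ∈ form K (Triality.extend v w) := by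
    intro a ha b hb c hc d hd
    obtain ⟨c', hc', hc2⟩ := conj_mem hw hc
    obtain ⟨d', hd', hd2⟩ := conj_mem hw hd
    obtain ⟨p, hp, q, hq, hpq⟩ := hw2
    refine mem_form_extend.2 ⟨a * c + b * d' * p, add_mem (hm _ ha _ hc) (hm _ (hm _ hb _ hd') _ hp),
      a * d + b * c' + b * d' * q, add_mem (add_mem (hm _ ha _ hd) (hm _ hb _ hc'))
        (hm _ (hm _ hb _ hd') _ hq), ?_⟩
    have : b * w * (d * w) = b * d' * (p + q * w) := by
      rw [← hpq, mul_assoc, ← mul_assoc w, hd2]; simp only [mul_assoc]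
    rw [add_mul, mul_add, mul_add, this, mul_assoc b w c, hc2]
    simp only [mul_add, add_mul, mul_assoc]
    abel
  refine ⟨hli, form_le_extend hv.one, ?_⟩
  have gen : ∀ i, ∃ a ∈ form K v, ∃ b ∈ form K v, Triality.extend v w i = a + b * w :=
    fun i => mem_form_extend.1 (Submodule.subset_span ⟨i, rfl⟩)
  intro i j
  obtain ⟨a, ha, b, hb, h⟩ := gen i
  obtain ⟨c, hc, d, hd, h'⟩ := gen j
  rw [h, h']
  exact key a ha b hb c hc d hd

lemma IsForm.left_inv [Finite ι] [Nonempty ι] (hv : IsForm K v) (hd : Dom K v) :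
    ∀ s ∈ hv.alg.toSubring, s ≠ 0 → ∃ t ∈ hv.alg.toSubring, t * s = 1 := by
  intro s hs h0
  obtain ⟨t, ht, -, h⟩ := hv.exists_inv hd hs h0
  exact ⟨t, ht, h⟩

lemma mul_comm_of {w : R} (hw : ∀ i, w * v i = v i * w) :
    ∀ s ∈ form K v, w * s = s * w := by
  intro s hs
  induction hs using Submodule.span_induction with
  | mem x hx => obtain ⟨i, rfl⟩ := hx; exact hw i
  | zero => simp
  | add x y _ _ hx hy => rw [mul_add, add_mul, hx, hy]
  | smul a x _ hx => rw [mul_smul_comm, smul_mul_assoc, hx]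

/-- Artin–Schreier step. -/
lemma Dom.extend_artinSchreier [CharP R 2] [Finite ι] [Nonempty ι] (hv : IsForm K v)
    (hd : Dom K v) {x ρ : Ω} (hx : Transcendental K x)
    (hρ : ρ = x ∨ ∃ q ∈ K, q ≠ 0 ∧ ρ = q * x ^ 2) {w : R} (hw : ∀ i, w * v i = v i * w)
    (hw2 : w * w = w + algebraMap Ω R ρ) (hli : LinearIndependent Ω (extend v w)) :
    IsForm (adj K x) (extend v w) ∧ Dom (adj K x) (extend v w) := by
  have hK := isSimpleExt_adj K x
  have hv' := hv.mono hK.le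
  have hd' := hd.adjoin_transcendental hx hK hv
  have hρm : ρ ∈ adj K x := by
    rcases hρ with rfl | ⟨q, hq, -, rfl⟩
    · exact mem_adj _ _
    · exact mul_mem (le_adj _ _ hq) (pow_mem (mem_adj _ _) 2)
  have hno : ∀ θ ∈ form (adj K x) v, θ * θ ≠ 1 * θ + algebraMap Ω R ρ := by
    intro θ hθ h
    obtain ⟨a1, a2, q, hq⟩ : ∃ a1 a2 : K, ρ = ((0 : K) : Ω) + x * a1 + x ^ 2 * a2 ∧
        (a2 = 0 ∧ a1 ≠ 0 ∨ a1 = 0 ∧ a2 ≠ 0) := by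
      rcases hρ with rfl | ⟨q, hq, h0, rfl⟩
      · exact ⟨1, 0, by simp, by simp⟩
      · exact ⟨0, ⟨q, hq⟩, by simp [mul_comm], Or.inr ⟨rfl, by simpa [Subtype.ext_iff] using h0⟩⟩
    have h1 : θ * θ = algebraMap Ω R (1 : K) * θ +
        algebraMap Ω R ((0 : K) + x * a1 + x ^ 2 * a2) := by rw [h, q]; simp
    obtain ⟨e0, he0, e1, he1, -, -, -, -, k0, k1, k2, -⟩ :=
      hv.descend hd hx hK hθ hθ rfl 1 0 a1 a2 1 0 a1 a2 h1 h1
    have := hv.nontrivial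
    have hinj := (algebraMap Ω R).injective
    have he10 : e1 = 0 → a1 = 0 ∧ a2 = 0 := by
      rintro rfl
      simp only [mul_zero, zero_mul, add_zero, zero_add] at k1 k2
      constructor
      · have := k1.symm; rw [map_eq_zero_iff _ hinj] at this; exact_mod_cast this
      · have := k2.symm; rw [map_eq_zero_iff _ hinj] at this; exact_mod_cast this
    rcases hq with ⟨h2, h3⟩ | ⟨h2, h3⟩
    · have : e1 = 0 := by
        have := hd e1 he1 e1 he1 (by rw [k2, h2]; simp)
        tauto
      exact h3 (he10 this).1
    · have hc : e0 = 0 ∨ e0 + 1 = 0 := by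
        refine hd _ he0 _ (add_mem he0 hv.one) ?_
        rw [mul_add, k0]
        simp [CharTwo.add_self_eq_zero]
      have h4 : e1 = 0 := by
        rcases hc with hc | hc
        · rw [hc, h2] at k1; simpa using k1.symm
        · rw [eq_neg_of_add_eq_zero_left hc, h2] at k1
          simp only [CharTwo.neg_eq] at k1
          simpa [CharTwo.add_self_eq_zero] using k1.symm
      exact h3 (he10 h4).2
  have hw' := mul_comm_of (K := adj K x) hw
  refine ⟨hv'.extend hli (fun i => ⟨v i, Submodule.subset_span ⟨i, rfl⟩, hw i⟩)
    ⟨_, hv'.algebraMap_mem hρm, 1, hv'.one, by rw [hw2, one_mul, add_comm]⟩, ?_⟩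
  intro r hr s hs hrs
  obtain ⟨a, ha, b, hb, rfl⟩ := mem_form_extend.1 hr
  obtain ⟨c, hc, d, hd, rfl⟩ := mem_form_extend.1 hs
  exact no_zero_of_commuting (hv'.left_inv hd') (ε := 1) (δ := algebraMap Ω R ρ) hv'.one
    (hv'.algebraMap_mem hρm) (by simp) (fun s _ => (Algebra.commutes _ _).symm) hw'
    (by rw [one_mul, hw2]) hno ha hb hc hd hrs

/-- Conjugation by an element with invertible central square. -/
def sqConj (j : R) (q : Ω) (hq : q ≠ 0) (hj : j * j = algebraMap Ω R q) : R →+* R where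
  toFun s := algebraMap Ω R q⁻¹ * (j * s * j)
  map_one' := by rw [mul_one, hj, ← map_mul, inv_mul_cancel₀ hq, map_one]
  map_mul' s t := by
    have h : algebraMap Ω R q⁻¹ * (j * s * j) * (algebraMap Ω R q⁻¹ * (j * t * j)) =
        algebraMap Ω R q⁻¹ * (j * s * (algebraMap Ω R q⁻¹ * (j * j)) * t * j) := by
      rw [Algebra.commutes q⁻¹ (j * t * j), Algebra.commutes q⁻¹ (j * j)]
      simp only [mul_assoc]
      congr 5
      rw [← mul_assoc t, ← Algebra.commutes]
    rw [h, hj, ← map_mul, inv_mul_cancel₀ hq, map_one, mul_one, mul_assoc j s t]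
  map_zero' := by simp
  map_add' s t := by simp [mul_add, add_mul]

lemma sqConj_apply {j : R} {q : Ω} {hq : q ≠ 0} {hj : j * j = algebraMap Ω R q} (s : R) :
    sqConj j q hq hj s = algebraMap Ω R q⁻¹ * (j * s * j) := rfl

lemma sqConj_mul {j : R} {q : Ω} {hq : q ≠ 0} {hj : j * j = algebraMap Ω R q} (s : R) :
    j * s = sqConj j q hq hj s * j := by
  rw [sqConj_apply, mul_assoc, mul_assoc (j * s), hj, ← Algebra.commutes, ← mul_assoc, ← map_mul,
    inv_mul_cancel₀ hq, map_one, one_mul]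

lemma sqConj_eq {j : R} {q : Ω} {hq : q ≠ 0} {hj : j * j = algebraMap Ω R q} {s t : R}
    (h : j * s = t * j) : sqConj j q hq hj s = t := by
  rw [sqConj_apply, h, mul_assoc, hj, ← Algebra.commutes, ← mul_assoc, ← map_mul,
    inv_mul_cancel₀ hq, map_one, one_mul]

lemma sqConj_algebraMap {j : R} {q : Ω} {hq : q ≠ 0} {hj : j * j = algebraMap Ω R q} (z : Ω) :
    sqConj j q hq hj (algebraMap Ω R z) = algebraMap Ω R z :=
  sqConj_eq (Algebra.commutes _ _).symm

lemma sqConj_sqConj {j : R} {q : Ω} {hq : q ≠ 0} {hj : j * j = algebraMap Ω R q} (s : R) :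
    sqConj j q hq hj (sqConj j q hq hj s) = s := by
  apply sqConj_eq
  rw [sqConj_apply, ← mul_assoc, ← Algebra.commutes, mul_assoc, ← mul_assoc j, ← mul_assoc j, hj,
    ← mul_assoc, ← mul_assoc, ← map_mul, inv_mul_cancel₀ hq, map_one, one_mul]

/-- Twisted step. -/
lemma Dom.extend_twisted [CharP R 2] [Finite ι] [Nonempty ι] (hv : IsForm K v)
    (hd : Dom K v) {y : Ω} (hy : Transcendental K y) {j : R}
    (hj : ∀ i, ∃ s ∈ form K v, j * v i = s * j)
    (hj2 : j * j = algebraMap Ω R y) (hli : LinearIndependent Ω (extend v j)) :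
    IsForm (adj K y) (extend v j) ∧ Dom (adj K y) (extend v j) := by
  have hK := isSimpleExt_adj K y
  have hv' := hv.mono hK.le
  have hd' := hd.adjoin_transcendental hy hK hv
  have hy0 : y ≠ 0 := by rintro rfl; exact hy (isAlgebraic_zero)
  have hj' : ∀ i, ∃ s ∈ form (adj K y) v, j * v i = s * j := fun i => by
    obtain ⟨s, hs, h⟩ := hj i; exact ⟨s, form_mono hK.le v hs, h⟩
  set σ := sqConj j y hy0 hj2
  have hσ0 : ∀ s ∈ form K v, σ s ∈ form K v := fun s hs => by
    obtain ⟨t, ht, h⟩ := conj_mem hj hs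
    have : σ s = t := sqConj_eq h
    rwa [this]
  have hσ1 : ∀ s ∈ form (adj K y) v, σ s ∈ form (adj K y) v := fun s hs => by
    obtain ⟨t, ht, h⟩ := conj_mem hj' hs
    have : σ s = t := sqConj_eq h
    rwa [this]
  have hno : ∀ θ ∈ form (adj K y) v, θ * σ θ ≠ algebraMap Ω R y := by
    intro θ hθ h
    have := hv.noZeroDivisors hd
    have := hv.nontrivial
    have hinj := hv.ev_injective y hy
    obtain ⟨q, hq, ⟨P, hP⟩⟩ := hv.clear y hK hθ
    let σS : hv.alg →+* hv.alg := (σ.comp hv.alg.val.toRingHom).codRestrict hv.alg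
      (fun s => hσ0 s s.2)
    have hσS : ∀ s, ((σS s : hv.alg) : R) = σ s := fun s => rfl
    have hσSi : Function.Injective σS := by
      intro s t hst
      have := congrArg (fun z : hv.alg => σ (z : R)) hst
      simp only [hσS] at this
      rw [sqConj_sqConj, sqConj_sqConj] at this
      exact Subtype.ext this
    have hmap : ∀ P : hv.alg[X], hv.ev y (P.map σS) = σ (hv.ev y P) := by
      intro P
      induction P using Polynomial.induction_on' with
      | add p q hp hq => simp only [Polynomial.map_add, map_add, hp, hq]
      | monomial n a =>
        rw [map_monomial, ← C_mul_X_pow_eq_monomial, ← C_mul_X_pow_eq_monomial, map_mul, map_pow,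
          map_mul, map_pow, hv.ev_X, hv.ev_C, hv.ev_C, map_mul, map_pow, sqConj_algebraMap, hσS]
    have hprod : P * P.map σS = (q * q * X).map (algebraMap K hv.alg) := by
      apply hinj
      rw [map_mul, hmap, hP, hv.ev_map, map_mul σ, sqConj_algebraMap, mul_assoc, ← mul_assoc θ,
        ← Algebra.commutes _ θ, mul_assoc, h]
      simp only [map_mul, aeval_X, mul_assoc]
    have hq0 : q ≠ 0 := by rintro rfl; simp at hq
    have hP0 : P ≠ 0 := by
      rintro rfl
      rw [zero_mul] at hprod
      have := congrArg (hv.ev y) hprod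
      rw [hv.ev_map, map_zero] at this
      have := ((map_eq_zero_iff _ (algebraMap Ω R).injective).1 this.symm)
      simp [hq, hy0] at this
    have h1 : (P * P.map σS).natDegree = P.natDegree + P.natDegree := by
      rw [natDegree_mul hP0 ((Polynomial.map_ne_zero_iff hσSi).2 hP0),
        natDegree_map_eq_of_injective hσSi]
    have h2 : ((q * q * X).map (algebraMap K hv.alg)).natDegree = q.natDegree + q.natDegree + 1 := by
      have : Nontrivial hv.alg := inferInstance
      rw [natDegree_map_eq_of_injective (FaithfulSMul.algebraMap_injective K hv.alg),
        natDegree_mul_X (mul_ne_zero hq0 hq0), natDegree_mul hq0 hq0]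
    rw [hprod, h2] at h1
    omega
  refine ⟨hv'.extend hli hj' ⟨_, hv'.algebraMap_mem (mem_adj K y), 0, zero_mem _, by simp [hj2]⟩, ?_⟩
  intro r hr s hs hrs
  obtain ⟨a, ha, b, hb, rfl⟩ := mem_form_extend.1 hr
  obtain ⟨c, hc, d, hd, rfl⟩ := mem_form_extend.1 hs
  exact no_zero_of_twisted (hv'.left_inv hd') (σ := σ) (hv'.algebraMap_mem (mem_adj K y))
    (fun s => (Algebra.commutes _ _).symm) hσ1 sqConj_sqConj sqConj_mul hj2 hno ha hb hc hd hrs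

/-- A purely inseparable quadratic extension of the base. -/
lemma Dom.adjoin_sqrt [CharP R 2] [Finite ι] [Nonempty ι] (hv : IsForm K v)
    (hd : Dom K v) {w : Ω} (hw : w * w ∈ K)
    (hno : ∀ θ ∈ form K v, θ * θ ≠ algebraMap Ω R (w * w)) : Dom (adj K w) v := by
  have hmem : ∀ r ∈ form (adj K w) v, ∃ a ∈ form K v, ∃ b ∈ form K v,
      r = a + b * algebraMap Ω R w := by
    intro r hr
    induction hr using Submodule.span_induction with
    | mem x hx => exact ⟨x, Submodule.subset_span hx, 0, zero_mem _, by simp⟩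
    | zero => exact ⟨0, zero_mem _, 0, zero_mem _, by simp⟩
    | add x y _ _ hx hy =>
      obtain ⟨a, ha, b, hb, rfl⟩ := hx
      obtain ⟨c, hc, d, hd, rfl⟩ := hy
      exact ⟨a + c, add_mem ha hc, b + d, add_mem hb hd, by rw [add_mul]; abel⟩
    | smul z x _ hx =>
      obtain ⟨a, ha, b, hb, rfl⟩ := hx
      obtain ⟨p, hp, q, hq, hz⟩ := mem_adj_sqrt hw z.2
      have sm : ∀ (s : Ω) (_ : s ∈ K) (r : R), r ∈ form K v → algebraMap Ω R s * r ∈ form K v :=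
        fun s hs r hr => hv.alg.mul_mem (hv.algebraMap_mem hs) hr
      refine ⟨_, add_mem (sm p hp a ha) (sm (q * (w * w)) (mul_mem hq hw) b hb),
        _, add_mem (sm p hp b hb) (sm q hq a ha), ?_⟩
      have : z • (a + b * algebraMap Ω R w) = algebraMap Ω R z * (a + b * algebraMap Ω R w) := by
        rw [← Algebra.smul_def]; rfl
      rw [this, hz]
      have h1 : algebraMap Ω R q * algebraMap Ω R w * a = algebraMap Ω R q * a * algebraMap Ω R w := by
        rw [mul_assoc, mul_assoc, Algebra.commutes w a]
      have h2 : algebraMap Ω R q * algebraMap Ω R w * b * algebraMap Ω R w =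
          algebraMap Ω R q * algebraMap Ω R w * algebraMap Ω R w * b := by
        rw [mul_assoc _ b, ← Algebra.commutes w b]
        simp only [mul_assoc]
      simp only [map_add, map_mul, mul_add, add_mul, ← mul_assoc]
      rw [h1, h2]
      abel
  intro r hr s hs hrs
  obtain ⟨a, ha, b, hb, rfl⟩ := hmem r hr
  obtain ⟨c, hc, d, hd', rfl⟩ := hmem s hs
  exact no_zero_of_commuting (hv.left_inv hd) (ε := 0) (δ := algebraMap Ω R (w * w))
    (zero_mem _) (hv.algebraMap_mem hw) (by simp) (fun s _ => (Algebra.commutes _ _).symm)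
    (fun s _ => Algebra.commutes _ _) (by simp) (fun θ hθ => by simpa using hno θ hθ) ha hb hc hd' hrs

end FormsD

section FormsE
variable {Ω : Type*} [Field Ω] {R : Type*} [Ring R] [Algebra Ω R] {ι : Type*}
variable {K : Subfield Ω} {v : ι → R}

/-- The generic value which becomes a square in order to make a Pfister form isotropic. -/
def pfisterValue (a b c x y z : Ω) : Ω := a * (x ^ 2 + x + c) + b * (y ^ 2 + y + c) * z ^ 2

lemma Dom.no_sqrt_pfisterValue [CharP R 2] [Finite ι] [Nonempty ι] (hv : IsForm K v)
    (hd : Dom K v) {a b c x y z : Ω} (ha : a ∈ K) (hb : b ∈ K) (hc : c ∈ K) (ha0 : a ≠ 0)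
    (hb0 : b ≠ 0) (hx : Transcendental K x) (hy : Transcendental (adj K x) y)
    (hz : Transcendental (adj (adj K x) y) z) (θ : R)
    (hθ : θ ∈ form (adj (adj (adj K x) y) z) v) :
    θ * θ ≠ algebraMap Ω R (pfisterValue a b c x y z) := by
  intro h
  have := hv.nontrivial
  have hinj := (algebraMap Ω R).injective
  set K1 := adj K x
  set K2 := adj K1 y
  have e1 : IsSimpleExt K K1 x := isSimpleExt_adj K x
  have e2 : IsSimpleExt K1 K2 y := isSimpleExt_adj K1 y
  have e3 := isSimpleExt_adj K2 z
  have hv1 := hv.mono e1.le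
  have hv2 := hv1.mono e2.le
  have hd1 := hd.adjoin_transcendental hx e1 hv
  have hd2 := hd1.adjoin_transcendental hy e2 hv1
  have mx : x ∈ K1 := mem_adj K x
  have my : y ∈ K2 := mem_adj K1 y
  have ha1 := e1.le ha
  have hb1 := e1.le hb
  have hc1 := e1.le hc
  have hA : a * (x ^ 2 + x + c) ∈ K1 := mul_mem ha1 (add_mem (add_mem (pow_mem mx 2) mx) hc1)
  have hB : b * (y ^ 2 + y + c) ∈ K2 :=
    mul_mem (e2.le hb1) (add_mem (add_mem (pow_mem my 2) my) (e2.le hc1))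
  have h' : θ * θ = algebraMap Ω R (0 : K2) * θ + algebraMap Ω R
      (((⟨_, e2.le hA⟩ : K2) : Ω) + z * (0 : K2) + z ^ 2 * ((⟨_, hB⟩ : K2) : Ω)) := by
    rw [h]; simp [pfisterValue, mul_comm]
  obtain ⟨e, he, f, hf, -, -, -, -, i0, i1, i2, -⟩ :=
    hv2.descend hd2 hz e3 hθ hθ rfl 0 _ 0 _ 0 _ 0 _ h' h'
  simp only [ZeroMemClass.coe_zero, map_zero, zero_mul, zero_add] at i0 i1 i2
  have hef : e * f = f * e := by
    rw [eq_neg_of_add_eq_zero_left i1, CharTwo.neg_eq]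
  obtain ⟨e, he, e', he', f0, hf0, f1, hf1, j0, j1, j2, k0, k1, k2, l0, l1, l2⟩ :=
    hv1.descend hd1 hy e2 he hf hef 0 ⟨_, hA⟩ 0 0 0 ⟨b * c, mul_mem hb1 hc1⟩ ⟨b, hb1⟩ ⟨b, hb1⟩
      (by rw [i0]; simp) (by
        rw [i2]
        simp only [ZeroMemClass.coe_zero]
        simp only [map_zero, zero_mul, zero_add]
        congr 1
        ring)
  simp only [ZeroMemClass.coe_zero, map_zero, zero_mul, zero_add] at j0 j1 j2 k0 k1 k2
  have he'0 : e' = 0 := by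
    have := hd1 e' he' e' he' j2
    tauto
  subst he'0
  simp only [mul_zero, zero_mul, add_zero, zero_add] at l1
  have f1b : algebraMap Ω R b⁻¹ * algebraMap Ω R b = 1 := by
    rw [← map_mul, inv_mul_cancel₀ hb0, map_one]
  set B := algebraMap Ω R b⁻¹ with hBdef
  have hBc : ∀ r : R, r * B = B * r := fun r => (Algebra.commutes _ _).symm
  have hbc : ∀ r : R, r * algebraMap Ω R b = algebraMap Ω R b * r :=
    fun r => (Algebra.commutes _ _).symm
  set i := B * (f0 * f1) with hi
  have him : i ∈ form K1 v :=
    hv1.alg.mul_mem (hv1.algebraMap_mem (inv_mem hb1)) (hv1.alg.mul_mem hf0 hf1)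
  have f10 : f1 * f0 = algebraMap Ω R b + f0 * f1 := by
    have := eq_sub_of_add_eq' k1
    rw [this, CharTwo.sub_eq_add]
  have hii : i * i = i + algebraMap Ω R c := by
    have : i * i = B * B * (f0 * (f1 * f0) * f1) := by
      rw [hi]
      simp only [mul_assoc]
      congr 1
      rw [← mul_assoc f1 B, hBc f1, mul_assoc B f1, ← mul_assoc f0 B, hBc f0, mul_assoc B f0]
    rw [this, f10, mul_add, add_mul, ← mul_assoc f0 f0, k0, mul_assoc (algebraMap Ω R _) f1 f1, k2,
      hbc f0, mul_assoc _ f0 f1, mul_add, map_mul]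
    have e1 : B * B * (algebraMap Ω R b * (f0 * f1)) = B * (f0 * f1) := by
      rw [mul_assoc, ← mul_assoc B (algebraMap Ω R b), f1b, one_mul]
    have e2 : B * B * (algebraMap Ω R b * algebraMap Ω R c * algebraMap Ω R b) =
        algebraMap Ω R c := by
      rw [hbc (_ * _), mul_assoc B B, ← mul_assoc B (algebraMap Ω R b), f1b, one_mul, ← mul_assoc, f1b,
        one_mul]
    rw [e1, e2]
  have hei : e * i = i * e := by
    rw [hi, ← mul_assoc, hBc, mul_assoc B e, ← mul_assoc e, l0, mul_assoc f0 e, l1]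
    simp only [mul_assoc]
  obtain ⟨e0, he0, e1, he1, f, hf, f', hf', m0, m1, m2, n0, n1, n2, p0, p1, p2⟩ :=
    hv.descend hd hx e1 he him hei 0 ⟨a * c, mul_mem ha hc⟩ ⟨a, ha⟩ ⟨a, ha⟩ 1 ⟨c, hc⟩ 0 0
      (by
        rw [j0]
        simp only [ZeroMemClass.coe_zero]
        simp only [map_zero, zero_mul, zero_add]
        congr 1
        ring)
      (by rw [hii]; simp)
  simp only [ZeroMemClass.coe_zero, OneMemClass.coe_one, map_one, map_zero, zero_mul, one_mul,
    zero_add] at m0 m1 m2 n0 n1 n2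
  have hf'0 : f' = 0 := by
    have := hd f' hf' f' hf' n2
    tauto
  subst hf'0
  simp only [mul_zero, zero_mul, add_zero, zero_add] at p1
  have f1a : algebraMap Ω R a⁻¹ * algebraMap Ω R a = 1 := by
    rw [← map_mul, inv_mul_cancel₀ ha0, map_one]
  set A := algebraMap Ω R a⁻¹ with hAdef
  have hAc : ∀ r : R, r * A = A * r := fun r => (Algebra.commutes _ _).symm
  have hac : ∀ r : R, r * algebraMap Ω R a = algebraMap Ω R a * r :=
    fun r => (Algebra.commutes _ _).symm
  set j := A * (e0 * e1) with hj
  have hjm : j ∈ form K v :=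
    hv.alg.mul_mem (hv.algebraMap_mem (inv_mem ha)) (hv.alg.mul_mem he0 he1)
  have e10 : e1 * e0 = algebraMap Ω R a + e0 * e1 := by
    have := eq_sub_of_add_eq' m1
    rw [this, CharTwo.sub_eq_add]
  have hje : j * e1 = e0 := by
    rw [hj, mul_assoc, mul_assoc, m2, hac, ← mul_assoc, f1a, one_mul]
  have hej : e1 * j = e0 + e1 := by
    rw [hj, ← mul_assoc, hAc, mul_assoc, ← mul_assoc e1, e10, add_mul, mul_assoc e0, m2, hac,
      ← mul_add, ← mul_assoc, f1a, one_mul, add_comm]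
  have hjj : j * j = j + algebraMap Ω R c := by
    have : j * j = A * (e0 * (e1 * j)) := by
      conv_lhs => rw [hj, mul_assoc, mul_assoc]
    rw [this, hej, mul_add, m0, map_mul, mul_add, ← mul_assoc, f1a, one_mul, add_comm]
  have hfj : f * j = j * f := by
    rw [hj, ← mul_assoc, hAc, mul_assoc A f, ← mul_assoc f, ← p0, mul_assoc e0 f, ← p1]
    simp only [mul_assoc]
  have hprod : (j + f) * (j + f + 1) = 0 := by
    have : (j + f) * (j + f + 1) = (j * j + j) + (f * f + f) + (j * f + f * j) := by
      noncomm_ring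
    rw [this, hjj, n0, hfj]
    have c1 := CharTwo.add_self_eq_zero (j * f)
    have c2 := CharTwo.add_self_eq_zero j
    have c3 := CharTwo.add_self_eq_zero f
    have c4 := CharTwo.add_self_eq_zero (algebraMap Ω R c)
    have : j + algebraMap Ω R c + j + (f + algebraMap Ω R c + f) + (j * f + j * f) =
      (j + j) + (f + f) + (algebraMap Ω R c + algebraMap Ω R c) + (j * f + j * f) := by abel
    rw [this, c1, c2, c3, c4]; simp
  have hfin : e1 * j = j * e1 := by
    rcases hd _ (add_mem hjm hf) _ (add_mem (add_mem hjm hf) hv.one) hprod with hh | hh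
    · rw [eq_neg_of_add_eq_zero_left hh, CharTwo.neg_eq, p1]
    · rw [add_assoc] at hh
      rw [eq_neg_of_add_eq_zero_left hh, CharTwo.neg_eq, mul_add, add_mul, p1, mul_one, one_mul]
  rw [hej, hje] at hfin
  have e1z : e1 = 0 := by simpa using hfin
  rw [e1z, mul_zero] at m2
  exact ha0 ((map_eq_zero_iff _ hinj).1 m2.symm)

end FormsE

section FormsF
variable {Ω : Type} [Field Ω]

/-- `K'` preserves the absence of zero divisors in all finite-dimensional `K`-forms. -/
def DomStable (K K' : Subfield Ω) : Prop :=
  ∀ (R : Type) [Ring R] [Algebra Ω R] [CharP R 2] (ι : Type) [Finite ι] [Nonempty ι] (v : ι → R),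
    IsForm K v → Dom K v → Dom K' v

lemma DomStable.refl (K : Subfield Ω) : DomStable K K := fun _ _ _ _ _ _ _ _ _ h => h

lemma DomStable.trans {K K' K'' : Subfield Ω} (hle : K ≤ K') (h : DomStable K K')
    (h' : DomStable K' K'') : DomStable K K'' :=
  fun R _ _ _ ι _ _ v hv hd => h' R ι v (hv.mono hle) (h R ι v hv hd)

lemma DomStable.adj {K : Subfield Ω} {x : Ω} (hx : Transcendental K x) : DomStable K (adj K x) :=
  fun _ _ _ _ _ _ _ _ hv hd => hd.adjoin_transcendental hx (isSimpleExt_adj K x) hv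

lemma DomStable.iUnion {K : ℕ → Subfield Ω} (hK : Monotone K) (h : ∀ n, DomStable (K 0) (K n)) :
    DomStable (K 0) (⨆ n, K n) := by
  intro R _ _ _ ι _ _ v hv hd
  have key : ∀ r ∈ form (⨆ n, K n) v, ∃ n, r ∈ form (K n) v := by
    intro r hr
    induction hr using Submodule.span_induction with
    | mem x hx => exact ⟨0, Submodule.subset_span hx⟩
    | zero => exact ⟨0, zero_mem _⟩
    | add x y _ _ hx hy =>
      obtain ⟨m, hm⟩ := hx
      obtain ⟨n, hn⟩ := hy
      exact ⟨max m n, add_mem (form_mono (hK (le_max_left _ _)) v hm)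
        (form_mono (hK (le_max_right _ _)) v hn)⟩
    | smul a x _ hx =>
      obtain ⟨m, hm⟩ := hx
      obtain ⟨n, hn⟩ := (Subfield.mem_iSup_of_directed hK.directed_le).1 a.2
      exact ⟨max m n, (form (K (max m n)) v).smul_mem
        (⟨a.1, hK (le_max_right _ _) hn⟩ : K (max m n)) (form_mono (hK (le_max_left _ _)) v hm)⟩
  intro r hr s hs hrs
  obtain ⟨m, hm⟩ := key r hr
  obtain ⟨n, hn⟩ := key s hs
  exact h (max m n) R ι v hv hd r (form_mono (hK (le_max_left _ _)) v hm) s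
    (form_mono (hK (le_max_right _ _)) v hn) hrs

lemma adj_eq_toSubfield (K : Subfield Ω) (x : Ω) :
    adj K x = (IntermediateField.adjoin K {x}).toSubfield := by
  apply le_antisymm
  · refine adj_le (fun a ha => ?_) (IntermediateField.subset_adjoin K {x} rfl)
    exact (IntermediateField.adjoin K {x}).algebraMap_mem ⟨a, ha⟩
  · intro a ha
    let L : IntermediateField K Ω := (adj K x).toIntermediateField (fun y => le_adj K _ y.2)
    have : IntermediateField.adjoin K {x} ≤ L :=
      IntermediateField.adjoin_le_iff.2 (Set.singleton_subset_iff.2 (mem_adj K x))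
    exact this ha

/-- The elements `t m, t (m+1), …` are algebraically independent over `K`. -/
def Fresh (t : ℕ → Ω) (K : Subfield Ω) (m : ℕ) : Prop :=
  AlgebraicIndependent K (fun n => t (m + n))

lemma Fresh.transcendental {t : ℕ → Ω} {K : Subfield Ω} {m : ℕ} (h : Fresh t K m) :
    Transcendental K (t m) := AlgebraicIndependent.transcendental h 0

lemma Fresh.adj {t : ℕ → Ω} {K : Subfield Ω} {m : ℕ} (h : Fresh t K m) :
    Fresh t (adj K (t m)) (m + 1) := by
  have h1 : AlgebraicIndependent K
      (Sum.elim (fun n => t (m + 1 + n)) (fun _ : Unit => t m)) := by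
    have := AlgebraicIndependent.comp h (Sum.elim (fun n => n + 1) (fun _ : Unit => 0)) (by
      rintro (a | a) (b | b) <;> simp)
    convert this using 1
    ext (a | a)
    · simp [add_comm, add_left_comm]
    · simp
  have h2 := (AlgebraicIndependent.sumElim_iff.1 h1).2
  rw [Set.range_const] at h2
  rw [Fresh, adj_eq_toSubfield]
  exact IntermediateField.algebraicIndependent_adjoin_iff.2 h2

lemma Fresh.adj_algebraic {t : ℕ → Ω} {K : Subfield Ω} {m : ℕ} (h : Fresh t K m) {w : Ω}
    (hw : w * w ∈ K) : Fresh t (Triality.adj K w) m := by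
  have : Algebra.IsAlgebraic K (IntermediateField.adjoin K {w}) := by
    apply IntermediateField.isAlgebraic_adjoin
    rintro _ rfl
    refine ⟨Polynomial.X ^ 2 - Polynomial.C ⟨_, hw⟩, Polynomial.monic_X_pow_sub_C _ two_ne_zero, ?_⟩
    simp only [sq, Polynomial.eval₂_sub, Polynomial.eval₂_mul, Polynomial.eval₂_X, Polynomial.eval₂_C]
    exact sub_self _
  rw [Fresh, adj_eq_toSubfield]
  exact AlgebraicIndependent.extendScalars (hx := h) (IntermediateField.adjoin K {w})

lemma Fresh.exists_step [CharP Ω 2] [IsAlgClosed Ω] {t : ℕ → Ω} {K : Subfield Ω} {m : ℕ}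
    (h : Fresh t K m) {a b c : Ω} (ha : a ∈ K) (hb : b ∈ K) (hc : c ∈ K) (ha0 : a ≠ 0)
    (hb0 : b ≠ 0) : ∃ K' m', K ≤ K' ∧ Fresh t K' m' ∧ DomStable K K' ∧
      ∃ x ∈ K', ∃ y ∈ K', ∃ z ∈ K', ∃ w ∈ K', w ≠ 0 ∧ w * w = pfisterValue a b c x y z := by
  set K1 := Triality.adj K (t m)
  set K2 := Triality.adj K1 (t (m + 1))
  set K3 := Triality.adj K2 (t (m + 2))
  obtain ⟨w, hw⟩ := IsAlgClosed.exists_pow_nat_eq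
    (pfisterValue a b c (t m) (t (m + 1)) (t (m + 2))) two_pos
  rw [sq] at hw
  have l1 : K ≤ K1 := le_adj _ _
  have l2 : K1 ≤ K2 := le_adj _ _
  have l3 : K2 ≤ K3 := le_adj _ _
  have hx : t m ∈ K3 := l3 (l2 (mem_adj _ _))
  have hy : t (m + 1) ∈ K3 := l3 (mem_adj _ _)
  have hz : t (m + 2) ∈ K3 := mem_adj _ _
  have l : K ≤ K3 := l1.trans (l2.trans l3)
  have hwm : w * w ∈ K3 := by
    rw [hw, pfisterValue]
    exact add_mem (mul_mem (l ha) (add_mem (add_mem (pow_mem hx 2) hx) (l hc)))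
      (mul_mem (mul_mem (l hb) (add_mem (add_mem (pow_mem hy 2) hy) (l hc))) (pow_mem hz 2))
  have l4 : K3 ≤ Triality.adj K3 w := le_adj _ _
  have hno : ∀ (R : Type) [Ring R] [Algebra Ω R] [CharP R 2] (ι : Type) [Finite ι] [Nonempty ι]
      (v : ι → R), IsForm K v → Dom K v → ∀ θ ∈ form K3 v, θ * θ ≠ algebraMap Ω R (w * w) := by
    intro R _ _ _ ι _ _ v hv hd θ hθ
    rw [hw]
    exact hd.no_sqrt_pfisterValue hv ha hb hc ha0 hb0 h.transcendental h.adj.transcendental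
      h.adj.adj.transcendental θ hθ
  refine ⟨Triality.adj K3 w, m + 3, l.trans l4, h.adj.adj.adj.adj_algebraic hwm, ?_,
    t m, l4 hx, t (m + 1), l4 hy, t (m + 2), l4 hz, w, mem_adj _ _, ?_, hw⟩
  · intro R _ _ _ ι _ _ v hv hd
    have hd3 : Dom K3 v :=
      (((DomStable.adj h.transcendental).trans l1 (DomStable.adj h.adj.transcendental)).trans
        (l1.trans l2) (DomStable.adj h.adj.adj.transcendental)) R ι v hv hd
    exact hd3.adjoin_sqrt (hv.mono l) hwm (hno R ι v hv hd)
  · rintro rfl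
    have hv : IsForm K (fun _ : Unit => (1 : Ω)) :=
      ⟨LinearIndependent.of_subsingleton () one_ne_zero, Submodule.subset_span ⟨(), rfl⟩,
        fun _ _ => Submodule.subset_span ⟨(), (one_mul 1).symm⟩⟩
    have hd : Dom K (fun _ : Unit => (1 : Ω)) := fun r _ s _ h => mul_eq_zero.1 h
    exact hno Ω Unit _ hv hd 0 (zero_mem _) (by simp)

/-- The condition making all Pfister forms over `F` hyperbolic. -/
def PfisterSolvable (F : Subfield Ω) : Prop :=
  ∀ a ∈ F, ∀ b ∈ F, ∀ c ∈ F, a ≠ 0 → b ≠ 0 → ∃ x ∈ F, ∃ y ∈ F, ∃ z ∈ F, ∃ w ∈ F, w ≠ 0 ∧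
    w * w = pfisterValue a b c x y z

theorem exists_pfisterSolvable [CharP Ω 2] [IsAlgClosed Ω] [Countable Ω] {t : ℕ → Ω}
    {K : Subfield Ω} {m : ℕ} (h : Fresh t K m) :
    ∃ F : Subfield Ω, K ≤ F ∧ DomStable K F ∧ PfisterSolvable F := by
  classical
  obtain ⟨e, he⟩ := exists_surjective_nat (Ω × Ω × Ω)
  let S := {p : Subfield Ω × ℕ // Fresh t p.1 p.2}
  have step : ∀ (p : S) (n : ℕ), ∃ q : S, p.1.1 ≤ q.1.1 ∧ DomStable p.1.1 q.1.1 ∧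
      ((e n).1 ∈ p.1.1 → (e n).2.1 ∈ p.1.1 → (e n).2.2 ∈ p.1.1 → (e n).1 ≠ 0 → (e n).2.1 ≠ 0 →
        ∃ x ∈ q.1.1, ∃ y ∈ q.1.1, ∃ z ∈ q.1.1, ∃ w ∈ q.1.1, w ≠ 0 ∧
          w * w = pfisterValue (e n).1 (e n).2.1 (e n).2.2 x y z) := by
    rintro ⟨⟨L, k⟩, hL⟩ n
    by_cases hn : (e n).1 ∈ L ∧ (e n).2.1 ∈ L ∧ (e n).2.2 ∈ L ∧ (e n).1 ≠ 0 ∧ (e n).2.1 ≠ 0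
    · obtain ⟨ha, hb, hc, ha0, hb0⟩ := hn
      obtain ⟨L', k', hle, hf, hs, hex⟩ := Fresh.exists_step hL ha hb hc ha0 hb0
      exact ⟨⟨⟨L', k'⟩, hf⟩, hle, hs, fun _ _ _ _ _ => hex⟩
    · exact ⟨⟨⟨L, k⟩, hL⟩, le_rfl, DomStable.refl _, fun a b c d f => absurd ⟨a, b, c, d, f⟩ hn⟩
  choose next hle hst hex using step
  let P : ℕ → S := fun n => Nat.rec ⟨(K, m), h⟩ (fun n p => next p n.unpair.1) n
  have hP : ∀ n, P (n + 1) = next (P n) n.unpair.1 := fun n => rfl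
  have hmono : Monotone (fun n => (P n).1.1) := monotone_nat_of_le_succ fun n => hle _ _
  have hdom : ∀ n, DomStable K (P n).1.1 := by
    intro n
    induction n with
    | zero => exact DomStable.refl _
    | succ n ih => exact ih.trans (hmono (Nat.zero_le n)) (hst _ _)
  have hmem : ∀ {a}, a ∈ ⨆ n, (P n).1.1 → ∃ n, a ∈ (P n).1.1 := fun ha =>
    (Subfield.mem_iSup_of_directed hmono.directed_le).1 ha
  have hin : ∀ n, (P n).1.1 ≤ ⨆ n, (P n).1.1 := fun n => le_iSup (fun n => (P n).1.1) n
  refine ⟨⨆ n, (P n).1.1, hin 0, DomStable.iUnion hmono hdom, ?_⟩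
  intro a ha b hb c hc ha0 hb0
  obtain ⟨n1, h1⟩ := hmem ha
  obtain ⟨n2, h2⟩ := hmem hb
  obtain ⟨n3, h3⟩ := hmem hc
  obtain ⟨i, hi⟩ := he (a, b, c)
  set N := max n1 (max n2 n3)
  set M := Nat.pair i N
  have hM : N ≤ M := Nat.right_le_pair _ _
  have hMi : M.unpair.1 = i := by simp [M]
  have := hex (P M) M.unpair.1
  rw [hMi, hi, ← hMi, ← hP] at this
  obtain ⟨x, hx, y, hy, z, hz, w, hw, h0, hh⟩ := this
    (hmono ((le_max_left _ _).trans hM) h1)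
    (hmono ((le_max_left _ _).trans ((le_max_right _ _).trans hM)) h2)
    (hmono ((le_max_right _ _).trans ((le_max_right _ _).trans hM)) h3) ha0 hb0
  exact ⟨x, hin (M + 1) hx, y, hin (M + 1) hy, z, hin (M + 1) hz, w, hin (M + 1) hw, h0, hh⟩

end FormsF

section FormsG
variable {Ω : Type*} [Field Ω] {R : Type*} [Ring R] [Algebra Ω R] {ι : Type*}
variable {K : Subfield Ω} {v : ι → R}

lemma Dom.extend_quaternion [CharP R 2] [Finite ι] [Nonempty ι] (hv : IsForm K v)
    (hd : Dom K v) {x y ρ : Ω} (hx : Transcendental K x) (hy : Transcendental (adj K x) y)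
    (hρ : ρ = x ∨ ∃ q ∈ K, q ≠ 0 ∧ ρ = q * x ^ 2) {i j : R} (hi : ∀ n, i * v n = v n * i)
    (hj : ∀ n, j * v n = v n * j) (hii : i * i = i + algebraMap Ω R ρ)
    (hjj : j * j = algebraMap Ω R y) (hji : j * i = j - i * j)
    (hli : LinearIndependent Ω (extend (extend v i) j)) :
    IsForm (adj (adj K x) y) (extend (extend v i) j) ∧
      Dom (adj (adj K x) y) (extend (extend v i) j) := by
  have hli' : LinearIndependent Ω (extend v i) := hli.comp Sum.inl Sum.inl_injective
  obtain ⟨hv', hd'⟩ := hd.extend_artinSchreier hv hx hρ hi hii hli'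
  refine hd'.extend_twisted hv' hy ?_ hjj hli
  have hm : ∀ n, v n ∈ form (adj K x) v := fun n => Submodule.subset_span ⟨n, rfl⟩
  rintro (n | n)
  · exact ⟨v n, form_le_extend (hm n), hj n⟩
  · refine ⟨v n - v n * i, ?_, ?_⟩
    · rw [sub_eq_add_neg, ← neg_mul]
      exact mem_form_extend.2 ⟨_, hm n, _, neg_mem (hm n), rfl⟩
    · simp only [extend, Sum.elim_inr]
      rw [← mul_assoc, hj, mul_assoc, hji, mul_sub, sub_mul, mul_assoc]

lemma isForm_one [Nontrivial R] (K : Subfield Ω) : IsForm K (fun _ : Unit => (1 : R)) :=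
  ⟨LinearIndependent.of_subsingleton () one_ne_zero, Submodule.subset_span ⟨(), rfl⟩,
    fun _ _ => Submodule.subset_span ⟨(), (one_mul 1).symm⟩⟩

lemma dom_one [Nontrivial R] (K : Subfield Ω) : Dom K (fun _ : Unit => (1 : R)) := by
  have key : ∀ r ∈ form K (fun _ : Unit => (1 : R)), ∃ a : Ω, r = algebraMap Ω R a := by
    intro r hr
    rw [form, Set.range_const, Submodule.mem_span_singleton] at hr
    obtain ⟨a, rfl⟩ := hr
    exact ⟨a, Algebra.algebraMap_eq_smul_one _ |>.symm⟩
  intro r hr s hs h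
  obtain ⟨a, rfl⟩ := key r hr
  obtain ⟨b, rfl⟩ := key s hs
  rw [← map_mul, map_eq_zero] at h
  simpa using h

/-- The domain property is inherited by any algebra over `K` with a basis mapping to `v`. -/
lemma Dom.noZeroDivisors_of_hom {S : Type*} [Ring S] [Algebra K S] (hd : Dom K v)
    (hv : LinearIndependent Ω v) (b : Basis ι K S) (φ : S →+* R)
    (hφ : ∀ (a : K) s, φ (a • s) = a • φ s) (hb : ∀ n, φ (b n) = v n) : NoZeroDivisors S := by
  let f : S →ₗ[K] R := { toFun := φ, map_add' := map_add φ, map_smul' := hφ }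
  have hvK : LinearIndependent K v := hv.restrict_scalars (R := K) (by
    intro a b hab
    ext
    simpa [Algebra.smul_def] using hab)
  have hf : Function.Injective f := by
    rw [← LinearMap.ker_eq_bot]
    refine LinearMap.ker_eq_bot'.2 fun s hs => ?_
    have h0 : Finsupp.linearCombination K v (b.repr s) = 0 := by
      rw [← hs]
      conv_rhs => rw [← b.linearCombination_repr s, Finsupp.apply_linearCombination]
      congr 1
      congr 1
      exact (funext hb).symm
    have := linearIndependent_iff.1 hvK _ h0
    simpa using this
  have hm : ∀ s, φ s ∈ form K v := by
    intro s
    have : f s ∈ Submodule.map f ⊤ := ⟨s, trivial, rfl⟩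
    rw [← b.span_eq, Submodule.map_span, ← Set.range_comp] at this
    have h2 : f ∘ b = v := funext hb
    rwa [h2] at this
  refine ⟨fun {s t} h => ?_⟩
  rcases hd _ (hm s) _ (hm t) (by rw [← map_mul, h, map_zero]) with h | h
  · exact Or.inl (hf (by rw [map_zero]; exact h))
  · exact Or.inr (hf (by rw [map_zero]; exact h))

end FormsG

section I3

/-- Coordinates of the generic vector of the totally isotropic subspace. -/
def isotropicVec {F : Type} [Field F] (a b c x y z w : F) : (Fin 4 → F) →ₗ[F] (Fin 8 → F) :=
  Matrix.mulVecLin !![w, 0, 0, 0; 0, w, 0, 0;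
    x, -c, -(b * z * (y + 1)), -(b * z * c); 1, x + 1, b * z, -(b * z * y);
    z * y, -(z * c), a * (x + 1), a * c; z, z * (y + 1), -a, a * x; 0, 0, w, 0; 0, 0, 0, w]

lemma exists_isotropic_subspace {F : Type} [Field F] [CharP F 2] {a b c x y z w : F} (hw : w ≠ 0)
    (h : w * w = a * (x ^ 2 + x + c) + b * (y ^ 2 + y + c) * z ^ 2) :
    ∃ W : Submodule F (Fin 8 → F), Module.finrank F W = 4 ∧
      ∀ v ∈ W, pfister3Form F a b c v = 0 := by
  have h2 : (2 : F) = 0 := CharTwo.two_eq_zero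
  have e : ∀ u n, isotropicVec a b c x y z w u n = ![u 0 * w, u 1 * w,
        u 0 * x - c * u 1 - b * z * (u 2 * (y + 1) + c * u 3),
        u 0 + u 1 * x + u 1 - b * z * (-u 2 + u 3 * y),
        z * (u 0 * y - c * u 1) + a * (u 2 * (x + 1) + c * u 3),
        z * (u 0 + u 1 * y + u 1) + a * (-u 2 + u 3 * x),
        u 2 * w, u 3 * w] n := by
    intro u n
    rw [isotropicVec, Matrix.mulVecLin_apply, Matrix.mulVec, dotProduct, Fin.sum_univ_four]
    fin_cases n <;> simp <;> ring
  have hf : Function.Injective (isotropicVec a b c x y z w) := by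
    rw [← LinearMap.ker_eq_bot, LinearMap.ker_eq_bot']
    intro u hu
    have hc := fun n => (e u n).symm.trans (congrFun hu n)
    have h0 := hc 0
    have h1 := hc 1
    have h6 := hc 6
    have h7 := hc 7
    simp [hw] at h0 h1 h6 h7
    ext n
    fin_cases n <;> simp [*]
  refine ⟨LinearMap.range (isotropicVec a b c x y z w),
    by rw [LinearMap.finrank_range_of_inj hf]; simp, ?_⟩
  rintro _ ⟨u, rfl⟩
  simp only [pfister3Form, e]
  simp only [Matrix.cons_val]
  linear_combination ((u 0 ^ 2 + u 0 * u 1 + c * u 1 ^ 2) +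
    a * b * (u 2 ^ 2 + u 2 * u 3 + c * u 3 ^ 2)) * h +
    ((u 0 ^ 2 + u 0 * u 1 + c * u 1 ^ 2) + a * b * (u 2 ^ 2 + u 2 * u 3 + c * u 3 ^ 2)) *
    (a * (x ^ 2 + x + c) + b * (y ^ 2 + y + c) * z ^ 2) * h2

lemma PfisterSolvable.i3Trivial {Ω : Type} [Field Ω] [CharP Ω 2] {F : Subfield Ω}
    (h : PfisterSolvable F) : I3Trivial F := by
  intro a b c ha hb _
  have : CharP F 2 := inferInstance
  obtain ⟨x, hx, y, hy, z, hz, w, hw, h0, hh⟩ := h a a.2 b b.2 c c.2 (by simpa using ha)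
    (by simpa using hb)
  exact exists_isotropic_subspace (x := ⟨x, hx⟩) (y := ⟨y, hy⟩) (z := ⟨z, hz⟩) (w := ⟨w, hw⟩)
    (by simpa [Subtype.ext_iff] using h0) (Subtype.ext hh)

end I3

section Quat
variable (k : Type*) [Field k]

/-- The generator `i` of the quaternion algebra `[a, b)`. -/
def quatI (a b : k) : ℍ[k, a, 1, b] := ⟨0, 1, 0, 0⟩
/-- The generator `j` of the quaternion algebra `[a, b)`. -/
def quatJ (a b : k) : ℍ[k, a, 1, b] := ⟨0, 0, 1, 0⟩

/-- The index type of the standard basis of a quaternion algebra. -/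
abbrev QuatIdx : Type := (Unit ⊕ Unit) ⊕ (Unit ⊕ Unit)

/-- The standard basis of a quaternion algebra. -/
noncomputable def quatBasis (a b : k) : Basis QuatIdx k ℍ[k, a, 1, b] :=
  (QuaternionAlgebra.basisOneIJK a 1 b).reindex
    (Equiv.ofBijective ![Sum.inl (Sum.inl ()), Sum.inl (Sum.inr ()), Sum.inr (Sum.inl ()),
      Sum.inr (Sum.inr ())] (by decide))

lemma quatI_mul_self (a b : k) : quatI k a b * quatI k a b =
    quatI k a b + algebraMap k _ a := by
  ext <;> simp [quatI]

lemma quatJ_mul_self (a b : k) : quatJ k a b * quatJ k a b = algebraMap k _ b := by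
  ext <;> simp [quatJ]

lemma quatJ_mul_quatI (a b : k) : quatJ k a b * quatI k a b =
    quatJ k a b - quatI k a b * quatJ k a b := by
  ext <;> simp [quatI, quatJ]

lemma coe_quatBasis (a b : k) : (quatBasis k a b : QuatIdx → ℍ[k, a, 1, b]) =
    extend (extend (fun _ => 1) (quatI k a b)) (quatJ k a b) := by
  have : ∀ n : Fin 4, QuaternionAlgebra.basisOneIJK a 1 b n =
      extend (extend (fun _ => 1) (quatI k a b)) (quatJ k a b)
        (![Sum.inl (Sum.inl ()), Sum.inl (Sum.inr ()), Sum.inr (Sum.inl ()),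
          Sum.inr (Sum.inr ())] n : QuatIdx) := by
    intro n
    fin_cases n <;> ext <;> simp [quatI, quatJ, extend, QuaternionAlgebra.basisOneIJK]
  funext n
  obtain ⟨m, rfl⟩ := (Equiv.ofBijective (![Sum.inl (Sum.inl ()), Sum.inl (Sum.inr ()),
    Sum.inr (Sum.inl ()), Sum.inr (Sum.inr ())] : Fin 4 → QuatIdx) (by decide)).surjective n
  rw [quatBasis, Basis.reindex_apply, Equiv.symm_apply_apply, this]
  rfl

/-- The index type of the standard basis of a biquaternion algebra. -/
abbrev BiquatIdx : Type := (QuatIdx ⊕ QuatIdx) ⊕ (QuatIdx ⊕ QuatIdx)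

/-- A biquaternion algebra. -/
abbrev Biquat (a b c d : k) : Type _ := ℍ[k, a, 1, b] ⊗[k] ℍ[k, c, 1, d]

/-- The splitting of the basis of a biquaternion algebra as a product. -/
def biquatIdxFun : BiquatIdx → QuatIdx × QuatIdx :=
  Sum.elim (Sum.elim (fun n => (n, Sum.inl (Sum.inl ()))) (fun n => (n, Sum.inl (Sum.inr ()))))
    (Sum.elim (fun n => (n, Sum.inr (Sum.inl ()))) (fun n => (n, Sum.inr (Sum.inr ()))))

/-- The standard basis of a biquaternion algebra. -/
noncomputable def biquatBasis (a b c d : k) : Basis BiquatIdx k (Biquat k a b c d) :=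
  ((quatBasis k a b).tensorProduct (quatBasis k c d)).reindex
    (Equiv.ofBijective biquatIdxFun (by decide)).symm

lemma coe_biquatBasis (a b c d : k) : (biquatBasis k a b c d : BiquatIdx → Biquat k a b c d) =
    extend (extend (extend (extend (fun _ => 1) (quatI k a b ⊗ₜ 1)) (quatJ k a b ⊗ₜ 1))
      (1 ⊗ₜ quatI k c d)) (1 ⊗ₜ quatJ k c d) := by
  funext n
  rw [biquatBasis, Basis.reindex_apply, Equiv.symm_symm, Equiv.ofBijective_apply,
    Basis.tensorProduct_apply', coe_quatBasis, coe_quatBasis]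
  obtain ((((_ | _) | (_ | _)) | ((_ | _) | (_ | _))) | (((_ | _) | (_ | _)) | ((_ | _) | (_ | _)))) := n <;>
    simp [biquatIdxFun, extend, Algebra.TensorProduct.one_def]

end Quat

section Dom
variable {Ω : Type} [Field Ω] [CharP Ω 2] {K : Subfield Ω}

lemma dom_quat {x y ρ : Ω} (hx : Transcendental K x) (hy : Transcendental (adj K x) y)
    (hρ : ρ = x ∨ ∃ q ∈ K, q ≠ 0 ∧ ρ = q * x ^ 2) :
    IsForm (adj (adj K x) y) (quatBasis Ω ρ y) ∧ Dom (adj (adj K x) y) (quatBasis Ω ρ y) := by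
  have : CharP ℍ[Ω, ρ, 1, y] 2 := charP_of_injective_algebraMap (algebraMap Ω _).injective 2
  rw [coe_quatBasis]
  refine (dom_one K).extend_quaternion (isForm_one K) hx hy hρ (by simp) (by simp)
    (quatI_mul_self _ _ _) (quatJ_mul_self _ _ _) (quatJ_mul_quatI _ _ _) ?_
  rw [← coe_quatBasis]
  exact (quatBasis Ω ρ y).linearIndependent

lemma dom_biquat {x y ρ x' y' ρ' : Ω} (hx : Transcendental K x) (hy : Transcendental (adj K x) y)
    (hρ : ρ = x ∨ ∃ q ∈ K, q ≠ 0 ∧ ρ = q * x ^ 2)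
    (hx' : Transcendental (adj (adj K x) y) x')
    (hy' : Transcendental (adj (adj (adj K x) y) x') y')
    (hρ' : ρ' = x' ∨ ∃ q ∈ adj (adj K x) y, q ≠ 0 ∧ ρ' = q * x' ^ 2) :
    IsForm (adj (adj (adj (adj K x) y) x') y') (biquatBasis Ω ρ y ρ' y') ∧
      Dom (adj (adj (adj (adj K x) y) x') y') (biquatBasis Ω ρ y ρ' y') := by
  have : CharP (Biquat Ω ρ y ρ' y') 2 :=
    charP_of_injective_algebraMap (algebraMap Ω _).injective 2
  have hli := (biquatBasis Ω ρ y ρ' y').linearIndependent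
  rw [coe_biquatBasis] at hli ⊢
  have a1 : (1 : ℍ[Ω, ρ, 1, y]) ⊗ₜ[Ω] (1 : ℍ[Ω, ρ', 1, y']) = 1 := rfl
  obtain ⟨h1, h2⟩ := (dom_one (R := Biquat Ω ρ y ρ' y') K).extend_quaternion (isForm_one K) hx hy hρ
    (i := quatI Ω ρ y ⊗ₜ 1) (j := quatJ Ω ρ y ⊗ₜ 1) (by simp) (by simp)
    (by rw [Algebra.TensorProduct.tmul_mul_tmul, quatI_mul_self, TensorProduct.add_tmul, one_mul]; rfl)
    (by rw [Algebra.TensorProduct.tmul_mul_tmul, quatJ_mul_self, one_mul]; rfl)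
    (by simp only [Algebra.TensorProduct.tmul_mul_tmul, quatJ_mul_quatI, TensorProduct.sub_tmul, one_mul])
    (hli.comp (Sum.inl ∘ Sum.inl) (Sum.inl_injective.comp Sum.inl_injective))
  refine h2.extend_quaternion h1 hx' hy' hρ' ?_ ?_ ?_ ?_ ?_ hli
  · rintro ((_ | _) | (_ | _)) <;> simp [extend]
  · rintro ((_ | _) | (_ | _)) <;> simp [extend]
  · rw [Algebra.TensorProduct.tmul_mul_tmul, quatI_mul_self, TensorProduct.tmul_add, one_mul]
    congr 1
    rw [Algebra.TensorProduct.algebraMap_apply, Algebra.algebraMap_eq_smul_one,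
      Algebra.algebraMap_eq_smul_one, TensorProduct.tmul_smul,
      TensorProduct.smul_tmul']
  · rw [Algebra.TensorProduct.tmul_mul_tmul, quatJ_mul_self, one_mul]
    rw [Algebra.TensorProduct.algebraMap_apply, Algebra.algebraMap_eq_smul_one,
      Algebra.algebraMap_eq_smul_one, TensorProduct.tmul_smul,
      TensorProduct.smul_tmul']
  · simp only [Algebra.TensorProduct.tmul_mul_tmul, quatJ_mul_quatI, TensorProduct.tmul_sub, one_mul]

end Dom

section
variable {Ω : Type} [Field Ω] {F : Subfield Ω}

/-- Scalar extension of a quaternion algebra. -/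
def quatMap (a b : F) : ℍ[F, a, 1, b] →+* ℍ[Ω, a, 1, b] where
  toFun q := ⟨q.re, q.imI, q.imJ, q.imK⟩
  map_one' := by ext <;> simp
  map_zero' := by ext <;> simp
  map_add' p q := by ext <;> simp
  map_mul' p q := by ext <;> simp

lemma quatMap_smul (a b r : F) (q : ℍ[F, a, 1, b]) :
    quatMap a b (r • q) = algebraMap Ω _ (r : Ω) * quatMap a b q := by
  ext <;> simp [quatMap]

lemma quatMap_basis (a b : F) (n : QuatIdx) :
    quatMap a b (quatBasis F a b n) = quatBasis Ω (a : Ω) b n := by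
  rw [coe_quatBasis, coe_quatBasis]
  obtain ((_ | _) | (_ | _)) := n <;> ext <;> simp [extend, quatMap, quatI, quatJ]

lemma quat_noZeroDivisors (a b : F) (h : Dom F (quatBasis Ω (a : Ω) b)) :
    NoZeroDivisors ℍ[F, a, 1, b] :=
  h.noZeroDivisors_of_hom (quatBasis Ω (a : Ω) b).linearIndependent (quatBasis F a b) (quatMap a b)
    (fun r s => by
      rw [quatMap_smul, ← Algebra.smul_def]; rfl) (quatMap_basis a b)

lemma exists_tensor_ringHom {R A B : Type*} [Ring R] [Algebra Ω R] [Ring A] [Algebra F A] [Ring B]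
    [Algebra F B] (f : A →+* R) (g : B →+* R)
    (hf : ∀ (r : F) x, f (r • x) = algebraMap Ω R r * f x)
    (hg : ∀ (r : F) x, g (r • x) = algebraMap Ω R r * g x) (h : ∀ x y, Commute (f x) (g y)) :
    ∃ φ : A ⊗[F] B →+* R, (∀ x y, φ (x ⊗ₜ y) = f x * g y) ∧
      ∀ (r : F) s, φ (r • s) = algebraMap Ω R r * φ s := by
  let f' : A →ₐ[F] R := AlgHom.mk' f (fun r x => by rw [hf, Algebra.smul_def]; rfl)
  let g' : B →ₐ[F] R := AlgHom.mk' g (fun r x => by rw [hg, Algebra.smul_def]; rfl)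
  let φ : A ⊗[F] B →ₐ[F] R := Algebra.TensorProduct.lift f' g' h
  refine ⟨φ.toRingHom, fun x y => ?_, fun r s => ?_⟩
  · show φ _ = _
    simp only [φ]
    rfl
  · show φ _ = _ * φ _
    rw [map_smul, Algebra.smul_def]
    rfl

lemma biquat_noZeroDivisors (a b c d : F) (h : Dom F (biquatBasis Ω (a : Ω) b c d)) :
    NoZeroDivisors (Biquat F a b c d) := by
  obtain ⟨φ, hφ, hs⟩ := exists_tensor_ringHom (R := Biquat Ω (a : Ω) b c d)
    ((Algebra.TensorProduct.includeLeftRingHom).comp (quatMap a b))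
    ((Algebra.TensorProduct.includeRight : ℍ[Ω, c, 1, d] →ₐ[Ω] Biquat Ω (a : Ω) b c d
      ).toRingHom.comp (quatMap c d))
    (fun r x => by rw [RingHom.comp_apply, quatMap_smul, map_mul]; rfl)
    (fun r x => by
      rw [RingHom.comp_apply, quatMap_smul, map_mul]
      congr 1
      exact AlgHom.commutes _ _)
    (fun x y => by
      show _ * _ = _ * _
      simp)
  refine h.noZeroDivisors_of_hom (biquatBasis Ω (a : Ω) b c d).linearIndependent
    (biquatBasis F a b c d) φ (fun r s => ?_) (fun n => ?_)
  · rw [hs, ← Algebra.smul_def]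
    rfl
  · simp only [biquatBasis, Basis.reindex_apply, Basis.tensorProduct_apply', hφ,
      ← quatMap_basis a b, ← quatMap_basis c d]
    simp

end

section
variable {Ω : Type} [Field Ω]

lemma Transcendental.add_mem {K : Subfield Ω} {x c : Ω} (h : Transcendental K x) (hc : c ∈ K) :
    Transcendental K (x + c) := by
  intro hx
  apply h
  have := hx.sub (isAlgebraic_algebraMap (A := Ω) (⟨c, hc⟩ : K))
  rwa [show algebraMap K Ω ⟨c, hc⟩ = c from rfl, add_sub_cancel_right] at this

lemma Transcendental.mem_mul {K : Subfield Ω} {x c : Ω} (h : Transcendental K x) (hc : c ∈ K)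
    (h0 : c ≠ 0) : Transcendental K (c * x) := by
  intro hx
  apply h
  have := (isAlgebraic_algebraMap (A := Ω) (⟨c⁻¹, inv_mem hc⟩ : K)).mul hx
  rwa [show algebraMap K Ω ⟨c⁻¹, inv_mem hc⟩ = c⁻¹ from rfl, inv_mul_cancel_left₀ h0] at this

lemma Transcendental.ne_zero' {K : Subfield Ω} {x : Ω} (h : Transcendental K x) : x ≠ 0 := by
  rintro rfl
  exact h isAlgebraic_zero

lemma exists_fresh : ∃ (Ω : Type) (_ : Field Ω) (_ : CharP Ω 2) (_ : IsAlgClosed Ω)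
    (_ : Countable Ω) (t : ℕ → Ω) (K : Subfield Ω), ∀ π : Equiv.Perm ℕ, Fresh (t ∘ π) K 0 := by
  let P := MvPolynomial ℕ (ZMod 2)
  let Ω := AlgebraicClosure (FractionRing P)
  have hinj : Function.Injective (algebraMap P Ω) := by
    rw [IsScalarTower.algebraMap_eq P (FractionRing P) Ω]
    exact (algebraMap (FractionRing P) Ω).injective.comp (IsFractionRing.injective P _)
  have : Countable P := by
    rw [← Cardinal.mk_le_aleph0_iff]
    exact MvPolynomial.cardinalMk_le_max.trans (by simp)
  have : Countable (FractionRing P) :=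
    (IsLocalization.mk'_surjective (nonZeroDivisors P) (S := FractionRing P)).countable
  have hc : Countable Ω := by
    have := Algebra.IsAlgebraic.cardinalMk_le_max (FractionRing P) Ω
    rw [← Cardinal.mk_le_aleph0_iff]
    refine this.trans (max_le ?_ le_rfl)
    rwa [Cardinal.mk_le_aleph0_iff]
  have hch : CharP Ω 2 := charP_of_injective_algebraMap (algebraMap (ZMod 2) Ω).injective 2
  let t : ℕ → Ω := fun n => algebraMap P Ω (MvPolynomial.X n)
  have ht : AlgebraicIndependent (ZMod 2) t :=
    (MvPolynomial.algebraicIndependent_X ℕ (ZMod 2)).map' (f := IsScalarTower.toAlgHom (ZMod 2) P Ω) hinj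
  have ht' : AlgebraicIndependent (⊥ : IntermediateField (ZMod 2) Ω) t :=
    AlgebraicIndependent.extendScalars (hx := ht) _
  refine ⟨Ω, inferInstance, hch, inferInstance, hc, t, (⊥ : IntermediateField (ZMod 2) Ω).toSubfield,
    fun π => ?_⟩
  have := ht'.comp π π.injective
  rw [Fresh]
  simp only [zero_add]
  exact this

theorem exists_field_generic : ∃ (F : Type) (_ : Field F) (_ : CharP F 2), I3Trivial F ∧
    ∃ x₁ y₁ x₂ y₂ : F, y₁ ≠ 0 ∧ y₂ ≠ 0 ∧ NoZeroDivisors ℍ[F, x₁ + x₂, 1, y₁ * y₂] ∧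
      NoZeroDivisors (Biquat F x₂ y₁ x₁ y₂) ∧ NoZeroDivisors (Biquat F x₁ y₁ x₂ y₂) := by
  obtain ⟨Ω, _, _, _, _, t, K, hf⟩ := exists_fresh
  set L := adj (adj (adj (adj K (t 0)) (t 1)) (t 2)) (t 3) with hL
  have f1 : Fresh t K 0 := hf 1
  have f2 := hf (Equiv.swap 0 2)
  have f3 := hf (Equiv.swap 0 2 * Equiv.swap 1 3 : Equiv.Perm ℕ)
  obtain ⟨F, hLF, hdom, hps⟩ := exists_pfisterSolvable f1.adj.adj.adj.adj
  change L ≤ F at hLF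
  change DomStable L F at hdom
  have hx1 : t 0 ∈ F := hLF (le_adj _ _ (le_adj _ _ (le_adj _ _ (mem_adj _ _))))
  have hy1 : t 1 ∈ F := hLF (le_adj _ _ (le_adj _ _ (mem_adj _ _)))
  have hx2 : t 2 ∈ F := hLF (le_adj _ _ (mem_adj _ _))
  have hy2 : t 3 ∈ F := hLF (mem_adj _ _)
  have n1 : t 1 ≠ 0 := Transcendental.ne_zero' f1.adj.transcendental
  have n3 : t 3 ≠ 0 := Transcendental.ne_zero' f1.adj.adj.adj.transcendental
  refine ⟨F, inferInstance, inferInstance, hps.i3Trivial, ⟨t 0, hx1⟩, ⟨t 1, hy1⟩, ⟨t 2, hx2⟩, ⟨t 3, hy2⟩,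
    by simpa [Subtype.ext_iff] using n1, by simpa [Subtype.ext_iff] using n3,
    quat_noZeroDivisors _ _ ?_, biquat_noZeroDivisors _ _ _ _ ?_, biquat_noZeroDivisors _ _ _ _ ?_⟩
  · have e0 : (t ∘ ⇑(Equiv.swap 0 2 * Equiv.swap 1 3 : Equiv.Perm ℕ)) 0 = t 2 := by
      simp [Equiv.swap_apply_def]
    have e1 : (t ∘ ⇑(Equiv.swap 0 2 * Equiv.swap 1 3 : Equiv.Perm ℕ)) 1 = t 3 := by
      simp [Equiv.swap_apply_def]
    have e2 : (t ∘ ⇑(Equiv.swap 0 2 * Equiv.swap 1 3 : Equiv.Perm ℕ)) 2 = t 0 := by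
      simp [Equiv.swap_apply_def]
    have e3 : (t ∘ ⇑(Equiv.swap 0 2 * Equiv.swap 1 3 : Equiv.Perm ℕ)) 3 = t 1 := by
      simp [Equiv.swap_apply_def]
    have g2 := f3.adj.adj.transcendental
    have g3 := f3.adj.adj.adj.transcendental
    simp only [zero_add, Nat.reduceAdd, e2, e3] at g2 g3
    rw [e0, e1] at g2
    rw [e0, e1, e2] at g3
    set K' := adj (adj K (t 2)) (t 3)
    have m2 : t 2 ∈ K' := le_adj _ _ (mem_adj _ _)
    have m3 : t 3 ∈ K' := mem_adj _ _
    have hd := dom_quat (Transcendental.add_mem g2 m2)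
      (by rw [adj_add _ m2]; exact Transcendental.mem_mul g3 (le_adj _ _ m3) n3) (Or.inl rfl)
    have hK : adj (adj K' (t 0 + t 2)) (t 3 * t 1) = L := by
      rw [adj_add _ m2, adj_mul _ (le_adj _ _ m3) n3, hL]
      simp only [adj, K']
      ac_rfl
    rw [hK] at hd
    rw [mul_comm (t 3)] at hd
    have : CharP ℍ[Ω, t 0 + t 2, 1, t 1 * t 3] 2 :=
      charP_of_injective_algebraMap (algebraMap Ω _).injective 2
    exact hdom _ _ _ hd.1 hd.2
  · have e0 : (t ∘ Equiv.swap 0 2) 0 = t 2 := by simp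
    have e1 : (t ∘ Equiv.swap 0 2) 1 = t 1 := by simp [Equiv.swap_apply_def]
    have e2 : (t ∘ Equiv.swap 0 2) 2 = t 0 := by simp
    have e3 : (t ∘ Equiv.swap 0 2) 3 = t 3 := by simp [Equiv.swap_apply_def]
    have g0 := f2.transcendental
    have g1 := f2.adj.transcendental
    have g2 := f2.adj.adj.transcendental
    have g3 := f2.adj.adj.adj.transcendental
    simp only [zero_add, Nat.reduceAdd, e0, e1, e2, e3] at g0 g1 g2 g3
    rw [e0] at g1
    rw [e0, e1] at g2
    rw [e0, e1, e2] at g3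
    have hd := dom_biquat g0 g1 (Or.inl rfl) g2 g3 (Or.inl rfl)
    have hK : adj (adj (adj (adj K (t 2)) (t 1)) (t 0)) (t 3) = L := by
      rw [hL]
      simp only [adj]
      ac_rfl
    rw [hK] at hd
    have : CharP (Biquat Ω (t 2) (t 1) (t 0) (t 3)) 2 :=
      charP_of_injective_algebraMap (algebraMap Ω _).injective 2
    exact hdom _ _ _ hd.1 hd.2
  · have hd := dom_biquat f1.transcendental f1.adj.transcendental (Or.inl rfl)
      f1.adj.adj.transcendental f1.adj.adj.adj.transcendental (Or.inl rfl)
    have : CharP (Biquat Ω (t 0) (t 1) (t 2) (t 3)) 2 :=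
      charP_of_injective_algebraMap (algebraMap Ω _).injective 2
    exact hdom _ _ _ hd.1 hd.2

theorem exists_field_special : ∃ (F : Type) (_ : Field F) (_ : CharP F 2), I3Trivial F ∧
    ∃ x₁ y₁ m y₂ : F, y₁ ≠ 0 ∧ m ≠ 0 ∧ y₂ ≠ 0 ∧
      NoZeroDivisors ℍ[F, x₁ + y₁ * m ^ 2, 1, y₁ * y₂] ∧
      NoZeroDivisors ℍ[F, x₁, 1, y₂] ∧ NoZeroDivisors (Biquat F x₁ y₁ (y₁ * m ^ 2) y₂) := by
  obtain ⟨Ω, _, _, _, _, t, K, hf⟩ := exists_fresh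
  set L := adj (adj (adj (adj K (t 0)) (t 1)) (t 2)) (t 3) with hL
  have f1 : Fresh t K 0 := hf 1
  have f2 := hf (Equiv.swap 0 1 * Equiv.swap 1 2 : Equiv.Perm ℕ)
  obtain ⟨F, hLF, hdom, hps⟩ := exists_pfisterSolvable f1.adj.adj.adj.adj
  change L ≤ F at hLF
  change DomStable L F at hdom
  have hx1 : t 0 ∈ F := hLF (le_adj _ _ (le_adj _ _ (le_adj _ _ (mem_adj _ _))))
  have hy1 : t 1 ∈ F := hLF (le_adj _ _ (le_adj _ _ (mem_adj _ _)))
  have hx2 : t 2 ∈ F := hLF (le_adj _ _ (mem_adj _ _))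
  have hy2 : t 3 ∈ F := hLF (mem_adj _ _)
  have n1 : t 1 ≠ 0 := Transcendental.ne_zero' f1.adj.transcendental
  have n2 : t 2 ≠ 0 := Transcendental.ne_zero' f1.adj.adj.transcendental
  have n3 : t 3 ≠ 0 := Transcendental.ne_zero' f1.adj.adj.adj.transcendental
  have e0 : (t ∘ ⇑(Equiv.swap 0 1 * Equiv.swap 1 2 : Equiv.Perm ℕ)) 0 = t 1 := by
    simp [Equiv.swap_apply_def]
  have e1 : (t ∘ ⇑(Equiv.swap 0 1 * Equiv.swap 1 2 : Equiv.Perm ℕ)) 1 = t 2 := by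
    simp [Equiv.swap_apply_def]
  have e2 : (t ∘ ⇑(Equiv.swap 0 1 * Equiv.swap 1 2 : Equiv.Perm ℕ)) 2 = t 0 := by
    simp [Equiv.swap_apply_def]
  have e3 : (t ∘ ⇑(Equiv.swap 0 1 * Equiv.swap 1 2 : Equiv.Perm ℕ)) 3 = t 3 := by
    simp [Equiv.swap_apply_def]
  have g2 := f2.adj.adj.transcendental
  have g3 := f2.adj.adj.adj.transcendental
  simp only [zero_add, Nat.reduceAdd, e2, e3] at g2 g3
  rw [e0, e1] at g2
  rw [e0, e1, e2] at g3
  set K' := adj (adj K (t 1)) (t 2) with hK'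
  have m1 : t 1 ∈ K' := le_adj _ _ (mem_adj _ _)
  have m2 : t 2 ∈ K' := mem_adj _ _
  have hKL : adj (adj K' (t 0)) (t 3) = L := by
    rw [hL]
    simp only [adj, K']
    ac_rfl
  refine ⟨F, inferInstance, inferInstance, hps.i3Trivial, ⟨t 0, hx1⟩, ⟨t 1, hy1⟩, ⟨t 2, hx2⟩, ⟨t 3, hy2⟩,
    by simpa [Subtype.ext_iff] using n1, by simpa [Subtype.ext_iff] using n2,
    by simpa [Subtype.ext_iff] using n3,
    quat_noZeroDivisors _ _ ?_, quat_noZeroDivisors _ _ ?_, biquat_noZeroDivisors _ _ _ _ ?_⟩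
  · have mm : t 1 * t 2 ^ 2 ∈ K' := mul_mem m1 (pow_mem m2 2)
    have hd := dom_quat (Transcendental.add_mem g2 mm)
      (by rw [adj_add _ mm]; exact Transcendental.mem_mul g3 (le_adj _ _ m1) n1) (Or.inl rfl)
    rw [adj_add _ mm, adj_mul _ (le_adj _ _ m1) n1, hKL] at hd
    have : CharP ℍ[Ω, t 0 + t 1 * t 2 ^ 2, 1, t 1 * t 3] 2 :=
      charP_of_injective_algebraMap (algebraMap Ω _).injective 2
    exact hdom _ _ _ hd.1 hd.2
  · have hd := dom_quat g2 g3 (Or.inl rfl)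
    rw [hKL] at hd
    have : CharP ℍ[Ω, t 0, 1, t 3] 2 :=
      charP_of_injective_algebraMap (algebraMap Ω _).injective 2
    exact hdom _ _ _ hd.1 hd.2
  · have hd := dom_biquat f1.transcendental f1.adj.transcendental (Or.inl rfl)
      f1.adj.adj.transcendental f1.adj.adj.adj.transcendental
      (Or.inr ⟨t 1, mem_adj _ _, n1, rfl⟩)
    have : CharP (Biquat Ω (t 0) (t 1) (t 1 * t 2 ^ 2) (t 3)) 2 :=
      charP_of_injective_algebraMap (algebraMap Ω _).injective 2
    exact hdom _ _ _ hd.1 hd.2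

end

section

variable {F : Type} [Field F]

lemma exists_idempotent_matrix {D : Type} [DivisionRing D] [Algebra F D] [Module.Finite F D] {k : ℕ}
    (I : Submodule F (Matrix (Fin k) (Fin k) D)) (hI : IsRightIdeal F _ I) (h0 : I ≠ ⊥) :
    ∃ ε ∈ I, ε * ε = ε ∧ finrank F (LinearMap.range (LinearMap.mulLeft F ε)) = k * finrank F D := by
  obtain ⟨x, hx, hx0⟩ := Submodule.exists_mem_ne_zero_of_ne_bot h0
  obtain ⟨a, b, hab⟩ : ∃ a b, x a b ≠ 0 := by
    by_contra! h
    exact hx0 (Matrix.ext h)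
  set ε := x * Matrix.single b a (x a b)⁻¹ with hε
  have hcol : ∀ i j, j ≠ a → ε i j = 0 := fun i j hj => by
    rw [hε, Matrix.mul_single_apply_of_ne _ _ _ _ _ hj]
  have haa : ε a a = 1 := by
    rw [hε, Matrix.mul_single_apply_same, mul_inv_cancel₀ hab]
  have hmul : ∀ (M : Matrix (Fin k) (Fin k) D) i j, (ε * M) i j = ε i a * M a j := fun M i j => by
    rw [Matrix.mul_apply, Finset.sum_eq_single a (fun c _ hc => by rw [hcol i c hc, zero_mul])]
    simp
  refine ⟨ε, hI x hx _, ?_, ?_⟩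
  · ext i j
    rw [hmul]
    by_cases hj : j = a
    · rw [hj, haa, mul_one]
    · rw [hcol _ _ hj, hcol _ _ hj, mul_zero]
  · let f : LinearMap.range (LinearMap.mulLeft F ε) →ₗ[F] (Fin k → D) :=
      (LinearMap.proj (R := F) (φ := fun _ : Fin k => Fin k → D) a).comp (Submodule.subtype _)
    have hf : ∀ (y : LinearMap.range (LinearMap.mulLeft F ε)) j, f y j = y.1 a j := fun _ _ => rfl
    have hbij : Function.Bijective f := by
      constructor
      · rintro ⟨_, M, rfl⟩ ⟨_, N, rfl⟩ h
        ext i j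
        have := congrFun h j
        simp only [hf, LinearMap.mulLeft_apply, hmul, haa, one_mul] at this ⊢
        rw [this]
      · intro v
        refine ⟨⟨ε * Matrix.of fun _ => v, _, rfl⟩, ?_⟩
        ext j
        simp [hf, hmul, haa]
    rw [(LinearEquiv.ofBijective f hbij).finrank_eq, Module.finrank_pi_fintype]
    simp

variable {A : Type} [Ring A] [Algebra F A]

lemma finrank_range_mulLeft {B : Type} [Ring B] [Algebra F B] (e : A ≃ₐ[F] B) (x : A) :
    finrank F (LinearMap.range (LinearMap.mulLeft F x)) =
      finrank F (LinearMap.range (LinearMap.mulLeft F (e x))) := by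
  have : LinearMap.range (LinearMap.mulLeft F (e x)) =
      (LinearMap.range (LinearMap.mulLeft F x)).map e.toLinearMap := by
    ext y
    constructor
    · rintro ⟨z, rfl⟩
      exact ⟨_, ⟨e.symm z, rfl⟩, by simp⟩
    · rintro ⟨_, ⟨z, rfl⟩, rfl⟩
      exact ⟨e z, by simp⟩
  rw [this]
  exact (LinearEquiv.finrank_map_eq e.toLinearEquiv _).symm

lemma exists_idempotent {D : Type} [DivisionRing D] [Algebra F D] [Module.Finite F D] {k : ℕ}
    (e : A ≃ₐ[F] Matrix (Fin k) (Fin k) D) (I : Submodule F A) (hI : IsRightIdeal F A I)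
    (h0 : I ≠ ⊥) : ∃ ε ∈ I, ε * ε = ε ∧
      finrank F (LinearMap.range (LinearMap.mulLeft F ε)) = k * finrank F D := by
  obtain ⟨ε, ⟨ε', hε', rfl⟩, hεε, hf⟩ := exists_idempotent_matrix (F := F) (I.map e.toLinearMap) (by
    rintro _ ⟨x, hx, rfl⟩ a
    exact ⟨x * e.symm a, hI x hx _, by simp⟩)
    (by
      obtain ⟨x, hx, hx0⟩ := Submodule.exists_mem_ne_zero_of_ne_bot h0
      exact Submodule.ne_bot_iff _ |>.mpr ⟨e x, ⟨x, hx, rfl⟩, by simpa using hx0⟩)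
  refine ⟨ε', hε', e.injective (by simpa using hεε), ?_⟩
  rw [finrank_range_mulLeft e]
  exact hf

lemma le_finrank_of_isRightIdeal {D : Type} [DivisionRing D] [Algebra F D] [Module.Finite F D]
    {k : ℕ} (e : A ≃ₐ[F] Matrix (Fin k) (Fin k) D) (I : Submodule F A) (hI : IsRightIdeal F A I)
    (h0 : I ≠ ⊥) : k * finrank F D ≤ finrank F I := by
  obtain ⟨ε, hε, -, hf⟩ := exists_idempotent e I hI h0
  have : Module.Finite F A := Module.Finite.equiv e.symm.toLinearEquiv
  rw [← hf]
  apply Submodule.finrank_mono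
  rintro _ ⟨a, rfl⟩
  exact hI ε hε a

lemma nonempty_matrix_fin_one_algEquiv : Nonempty (Matrix (Fin 1) (Fin 1) A ≃ₐ[F] A) := by
  refine ⟨AlgEquiv.ofBijective (AlgHom.ofLinearMap
    (Matrix.entryLinearMap F A (0 : Fin 1) (0 : Fin 1)) ?_ ?_) ⟨?_, ?_⟩⟩
  · simp
  · intro x y
    simp [Matrix.mul_apply]
  · intro x y h
    ext i j
    rw [Subsingleton.elim i 0, Subsingleton.elim j 0]
    exact h
  · intro a
    exact ⟨Matrix.of fun _ _ => a, rfl⟩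

lemma schurIndex_eq {D : Type} [DivisionRing D] [Algebra F D] (hD : IsCSA F D) {d k : ℕ}
    (hd : finrank F D = d * d) (hd0 : 0 < d) (hk : 0 < k)
    (e : A ≃ₐ[F] Matrix (Fin k) (Fin k) D) : schurIndex F A = d := by
  have : Module.Finite F D := hD.2.2
  obtain ⟨u⟩ := nonempty_matrix_fin_one_algEquiv (F := F) (A := A)
  apply le_antisymm
  · exact Nat.sInf_le ⟨hd0, D, inferInstance, inferInstance, hD, hd, 1, k, one_pos, hk,
      ⟨u.trans e⟩⟩
  · apply le_csInf
    · exact ⟨d, hd0, D, inferInstance, inferInstance, hD, hd, 1, k, one_pos, hk,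
        ⟨u.trans e⟩⟩
    rintro d' ⟨hd'0, D', _, _, hD', hd', n, m, hn, hm, ⟨g⟩⟩
    have : Module.Finite F D' := hD'.2.2
    let h : Matrix (Fin (n * k)) (Fin (n * k)) D ≃ₐ[F] Matrix (Fin m) (Fin m) D' :=
      (((Matrix.reindexAlgEquiv F D finProdFinEquiv.symm).trans
        (Matrix.compAlgEquiv (Fin n) (Fin k) D F).symm).trans e.symm.mapMatrix).trans g
    have hdim := h.toLinearEquiv.finrank_eq
    simp only [Module.finrank_matrix, Fintype.card_fin, hd, hd'] at hdim
    let p : Matrix (Fin m) (Fin m) D' := Matrix.single ⟨0, hm⟩ ⟨0, hm⟩ 1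
    have hp0 : p ≠ 0 := by
      intro h
      have := congrFun (congrFun h ⟨0, hm⟩) ⟨0, hm⟩
      have hn : Nontrivial D' := by
        apply Module.nontrivial_of_finrank_pos (R := F)
        rw [hd']
        positivity
      simp [p] at this
    have h1 := le_finrank_of_isRightIdeal h.symm (LinearMap.range (LinearMap.mulLeft F p))
      (by rintro _ ⟨x, rfl⟩ a; exact ⟨x * a, by simp [mul_assoc]⟩)
      (by
        intro hb
        apply hp0
        rw [← Submodule.mem_bot F, ← hb]
        exact ⟨1, by simp⟩)
    have h2 : finrank F (LinearMap.range (LinearMap.mulLeft F p)) ≤ m * (d' * d') := by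
      let f : LinearMap.range (LinearMap.mulLeft F p) →ₗ[F] (Fin m → D') :=
        (LinearMap.proj (R := F) (φ := fun _ : Fin m => Fin m → D') ⟨0, hm⟩).comp (Submodule.subtype _)
      have hinj : Function.Injective f := by
        rintro ⟨_, M, rfl⟩ ⟨_, N, rfl⟩ h
        ext i j
        have h' := congrFun h j
        change (p * M) _ j = (p * N) _ j at h'
        change (p * M) i j = (p * N) i j
        by_cases hi : i = ⟨0, hm⟩
        · rw [hi, h']
        · rw [Matrix.single_mul_apply_of_ne _ _ _ _ _ hi, Matrix.single_mul_apply_of_ne _ _ _ _ _ hi]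
      have := LinearMap.finrank_le_finrank_of_injective hinj
      rwa [Module.finrank_pi_fintype, Finset.sum_const, Finset.card_univ, Fintype.card_fin, hd',
        smul_eq_mul] at this
    rw [hd] at h1
    have h3 : n * k * (d * d) ≤ m * (d' * d') := h1.trans h2
    have h4 : n * k * d = m * d' := by
      have : (n * k * d) * (n * k * d) = (m * d') * (m * d') := by linarith
      exact Nat.mul_self_inj.mp this
    have h5 : n * k * d * d ≤ n * k * d * d' := by
      rw [h4]
      rw [← h4]
      calc n * k * d * d = n * k * (d * d) := by ring
        _ ≤ m * (d' * d') := h3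
        _ = n * k * d * d' := by rw [h4]; ring
    exact Nat.le_of_mul_le_mul_left h5 (by positivity)

lemma exists_algEquiv_matrix {B W : Type} [DivisionRing B] [Algebra F B] [Module.Finite F B]
    [AddCommGroup W] [Module F W] [Module B W] [IsScalarTower F B W] [Module.Finite F W]
    [Module.Finite F A]
    (ρ : A →ₐ[F] Module.End B W) (hρ : Function.Injective ρ)
    (hdim : finrank F A * finrank F B = finrank F W * finrank F W) :
    ∃ k : ℕ, finrank F B * k = finrank F W ∧
      Nonempty (A ≃ₐ[F] Matrix (Fin k) (Fin k) Bᵐᵒᵖ) := by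
  have : Module.Finite B W := Module.Finite.of_restrictScalars_finite F B W
  have hk := Module.finrank_mul_finrank F B W
  refine ⟨finrank B W, hk, ?_⟩
  let e : Module.End B W ≃ₐ[F] Matrix (Fin (finrank B W)) (Fin (finrank B W)) Bᵐᵒᵖ :=
    ((Module.finBasis B W).equivFun.conjAlgEquiv F).trans
      ((endVecAlgEquivMatrixEnd (Fin (finrank B W)) F B B).trans
        (AlgEquiv.moduleEndSelf F).symm.mapMatrix)
  have hB : 0 < finrank F B := Module.finrank_pos
  have hop : finrank F Bᵐᵒᵖ = finrank F B := (MulOpposite.opLinearEquiv F).symm.finrank_eq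
  have hfin : Module.Finite F Bᵐᵒᵖ := Module.Finite.equiv (MulOpposite.opLinearEquiv F)
  have hd : finrank F A = finrank F (Matrix (Fin (finrank B W)) (Fin (finrank B W)) Bᵐᵒᵖ) := by
    rw [Module.finrank_matrix, Fintype.card_fin, hop]
    apply Nat.eq_of_mul_eq_mul_right hB
    rw [hdim, ← hk]
    ring
  let f : A →ₐ[F] Matrix (Fin (finrank B W)) (Fin (finrank B W)) Bᵐᵒᵖ :=
    e.toAlgHom.comp ρ
  have hf : Function.Injective f := e.injective.comp hρ
  have hs : Function.Surjective f.toLinearMap :=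
    (LinearMap.injective_iff_surjective_of_finrank_eq_finrank hd).mp hf
  exact ⟨AlgEquiv.ofBijective f ⟨hf, hs⟩⟩

end

section

/-- A biquadratic separable extension `E = F(θ₀, θ₁)` in characteristic two, with
`θₐ² = θₐ + xₐ`, together with its Galois group. -/
structure BiquadExt (F E : Type) [Field F] [Field E] [Algebra F E] where
  x : Fin 2 → F
  θ : Fin 2 → E
  s : Fin 2 → E →ₐ[F] E
  sq : ∀ a, θ a * θ a = θ a + algebraMap F E (x a)
  s_self : ∀ a, s a (θ a) = θ a + 1
  s_other : ∀ a b, a ≠ b → s a (θ b) = θ b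
  s_s : ∀ a c, s a (s a c) = c
  s_comm : ∀ a b c, s a (s b c) = s b (s a c)
  fixed : ∀ c, (∀ a, s a c = c) → ∃ f, algebraMap F E f = c

variable {F E : Type} [Field F] [Field E] [Algebra F E]

/-- A descent datum on an `E`-module: commuting semilinear involutions. -/
structure BiquadExt.Descent (B : BiquadExt F E) (V : Type) [AddCommGroup V] [Module E V] where
  τ : Fin 2 → V →+ V
  semi : ∀ a c v, τ a (c • v) = B.s a c • τ a v
  inv : ∀ a v, τ a (τ a v) = v
  comm : ∀ a b v, τ a (τ b v) = τ b (τ a v)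

namespace BiquadExt

variable (B : BiquadExt F E)

/-- The standard `F`-basis of `E`. -/
def e : Fin 4 → E := ![1, B.θ 0, B.θ 1, B.θ 0 * B.θ 1]

variable {B} {V : Type} [AddCommGroup V] [Module E V] (D : B.Descent V) [CharP E 2]

lemma Descent.add_self (_D : B.Descent V) (v : V) : v + v = 0 := by
  rw [← two_smul E, CharTwo.two_eq_zero, zero_smul]

lemma Descent.τ_τ_add (a : Fin 2) (v : V) : D.τ a (v + D.τ a v) = v + D.τ a v := by
  rw [map_add, D.inv, add_comm]

lemma Descent.τ_proj (a : Fin 2) (v : V) :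
    D.τ a (v + B.θ a • (v + D.τ a v)) = v + B.θ a • (v + D.τ a v) := by
  rw [map_add, D.semi, D.τ_τ_add, B.s_self, add_smul, one_smul]
  have h := D.add_self (D.τ a v)
  rw [show D.τ a v + (B.θ a • (v + D.τ a v) + (v + D.τ a v)) =
    v + B.θ a • (v + D.τ a v) + (D.τ a v + D.τ a v) by abel, h, add_zero]

lemma Descent.eq_proj (a : Fin 2) (v : V) :
    v = (v + B.θ a • (v + D.τ a v)) + B.θ a • (v + D.τ a v) := by
  rw [add_assoc, D.add_self, add_zero]

/-- Every vector is a combination of fixed vectors. -/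
lemma Descent.exists_decomp (U : Submodule E V) (hU : ∀ a, ∀ v ∈ U, D.τ a v ∈ U) (v : V)
    (hv : v ∈ U) : ∃ u : Fin 4 → V, (∀ k a, D.τ a (u k) = u k) ∧ (∀ k, u k ∈ U) ∧
      v = ∑ k, B.e k • u k := by
  have hB : ∀ a, ∀ w ∈ U, w + D.τ a w ∈ U := fun a w hw => U.add_mem hw (hU a w hw)
  have hP : ∀ a, ∀ w ∈ U, w + B.θ a • (w + D.τ a w) ∈ U := fun a w hw =>
    U.add_mem hw (U.smul_mem _ (hB a w hw))
  have cB : ∀ w, D.τ 0 w = w → D.τ 0 (w + D.τ 1 w) = w + D.τ 1 w := fun w hw => by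
    rw [map_add, D.comm, hw]
  have cP : ∀ w, D.τ 0 w = w →
      D.τ 0 (w + B.θ 1 • (w + D.τ 1 w)) = w + B.θ 1 • (w + D.τ 1 w) := fun w hw => by
    rw [map_add, D.semi, B.s_other 0 1 (by decide), cB w hw, hw]
  set p := v + B.θ 0 • (v + D.τ 0 v) with hp
  set b := v + D.τ 0 v with hb
  have hp0 := D.τ_proj 0 v
  have hb0 := D.τ_τ_add 0 v
  refine ⟨![p + B.θ 1 • (p + D.τ 1 p), b + B.θ 1 • (b + D.τ 1 b), p + D.τ 1 p, b + D.τ 1 b],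
    ?_, ?_, ?_⟩
  · intro k a
    fin_cases k <;> fin_cases a
    · exact cP p hp0
    · exact D.τ_proj 1 p
    · exact cP b hb0
    · exact D.τ_proj 1 b
    · exact cB p hp0
    · exact D.τ_τ_add 1 p
    · exact cB b hb0
    · exact D.τ_τ_add 1 b
  · intro k
    have h1 := hP 0 v hv
    have h2 := hB 0 v hv
    fin_cases k
    · exact hP 1 _ h1
    · exact hP 1 _ h2
    · exact hB 1 _ h1
    · exact hB 1 _ h2
  · have h1 := D.eq_proj 1 p
    have h2 := D.eq_proj 1 b
    rw [Fin.sum_univ_four]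
    simp only [e, Matrix.cons_val_zero, Matrix.cons_val_one, Matrix.cons_val, one_smul]
    calc v = p + B.θ 0 • b := D.eq_proj 0 v
      _ = _ := by
        have h3 := congrArg (B.θ 0 • ·) h2
        simp only [smul_add (B.θ 0) (b + _)] at h3
        rw [mul_smul, h3]
        conv_lhs => rw [h1]
        abel

/-- The coefficients of a combination of fixed vectors are unique. -/
lemma Descent.eq_zero_of_sum (u : Fin 4 → V) (hu : ∀ k a, D.τ a (u k) = u k)
    (h : ∑ k, B.e k • u k = 0) : ∀ k, u k = 0 := by
  have key : ∀ a (p q : V), D.τ a p = p → D.τ a q = q → p + B.θ a • q = 0 → p = 0 ∧ q = 0 := by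
    intro a p q hp hq h
    have h' := congrArg (D.τ a) h
    rw [map_add, D.semi, hp, hq, map_zero, B.s_self, add_smul, one_smul, ← add_assoc, h,
      zero_add] at h'
    subst h'
    simpa using h
  rw [Fin.sum_univ_four] at h
  simp only [e, Matrix.cons_val_zero, Matrix.cons_val_one, Matrix.cons_val, one_smul] at h
  have c : ∀ i j, D.τ 0 (u i + B.θ 1 • u j) = u i + B.θ 1 • u j := fun i j => by
    rw [map_add, D.semi, B.s_other 0 1 (by decide), hu, hu]
  obtain ⟨h1, h2⟩ := key 0 (u 0 + B.θ 1 • u 2) (u 1 + B.θ 1 • u 3) (c _ _) (c _ _) (by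
    rw [← h, smul_add, mul_smul]
    abel)
  obtain ⟨h3, h4⟩ := key 1 _ _ (hu _ _) (hu _ _) h1
  obtain ⟨h5, h6⟩ := key 1 _ _ (hu _ _) (hu _ _) h2
  intro k
  fin_cases k <;> assumption

variable [Module F V] [IsScalarTower F E V]

lemma Descent.finrank_restrictScalars (U : Submodule E V) (hU : ∀ a, ∀ v ∈ U, D.τ a v ∈ U)
    (W : Submodule F V) [Module.Finite F W] (hW : ∀ v, v ∈ W ↔ v ∈ U ∧ ∀ a, D.τ a v = v) :
    finrank F (U.restrictScalars F) = 4 * finrank F W := by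
  let f : (Fin 4 → W) →ₗ[F] V :=
    { toFun := fun u => ∑ k, B.e k • (u k : V)
      map_add' := fun u v => by simp [smul_add, Finset.sum_add_distrib]
      map_smul' := fun c u => by
        simp only [Pi.smul_apply, Submodule.coe_smul, RingHom.id_apply, Finset.smul_sum]
        exact Finset.sum_congr rfl fun k _ => smul_comm _ _ _ }
  have hinj : Function.Injective f := by
    rw [← LinearMap.ker_eq_bot, LinearMap.ker_eq_bot']
    intro u hu
    have := D.eq_zero_of_sum (fun k => (u k : V)) (fun k a => ((hW _).1 (u k).2).2 a) hu
    ext k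
    exact this k
  have hr : LinearMap.range f = U.restrictScalars F := by
    ext v
    constructor
    · rintro ⟨u, rfl⟩
      change ∑ k, B.e k • (u k : V) ∈ U
      exact U.sum_mem fun k _ => U.smul_mem _ ((hW _).1 (u k).2).1
    · intro hv
      obtain ⟨u, hu, huU, rfl⟩ := D.exists_decomp U hU v hv
      exact ⟨fun k => ⟨u k, (hW _).2 ⟨huU k, hu k⟩⟩, rfl⟩
  rw [← hr, LinearMap.finrank_range_of_inj hinj, Module.finrank_pi_fintype]
  simp

/-- The tautological descent datum on `E`. -/
def selfDescent (B : BiquadExt F E) : B.Descent E where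
  τ a := (B.s a).toRingHom.toAddMonoidHom
  semi a c v := map_mul (B.s a) c v
  inv a v := B.s_s a v
  comm a b v := B.s_comm a b v

lemma finrank_eq_four (B : BiquadExt F E) : finrank F E = 4 := by
  have h := B.selfDescent.finrank_restrictScalars ⊤ (fun _ _ _ => trivial)
    (LinearMap.range (Algebra.linearMap F E)) (fun v => by
      constructor
      · rintro ⟨f, rfl⟩
        exact ⟨trivial, fun a => (B.s a).commutes f⟩
      · rintro ⟨-, h⟩
        exact B.fixed v h)
  rw [LinearMap.finrank_range_of_inj (FaithfulSMul.algebraMap_injective F E), finrank_self] at h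
  rw [← finrank_top F E]
  exact h

lemma moduleFinite (B : BiquadExt F E) : Module.Finite F E :=
  Module.finite_of_finrank_pos (by rw [B.finrank_eq_four]; norm_num)

lemma Descent.finrank_eq (U : Submodule E V) (hU : ∀ a, ∀ v ∈ U, D.τ a v ∈ U)
    (W : Submodule F V) [Module.Finite F W] (hW : ∀ v, v ∈ W ↔ v ∈ U ∧ ∀ a, D.τ a v = v) :
    finrank F W = finrank E U := by
  have h1 := D.finrank_restrictScalars U hU W hW
  have h2 := Module.finrank_mul_finrank F E U
  rw [B.finrank_eq_four] at h2
  have h3 : finrank F (U.restrictScalars F) = finrank F U := rfl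
  omega

lemma exists_coeff (B : BiquadExt F E) (c : E) : ∃ f : Fin 4 → F,
    c = ∑ k, f k • B.e k := by
  obtain ⟨u, hu, -, hc⟩ := B.selfDescent.exists_decomp ⊤ (fun _ _ _ => trivial) c trivial
  choose f hf using fun k => B.fixed (u k) (hu k)
  refine ⟨f, hc.trans (Finset.sum_congr rfl fun k _ => ?_)⟩
  rw [← hf k, smul_eq_mul, mul_comm, Algebra.smul_def]

end BiquadExt
end

section
open QuadraticAlgebra

variable {F : Type} [Field F] [CharP F 2]

/-- The nontrivial automorphism of `R[ω]`, where `ω² = ω + a`. -/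
def quadConj {R : Type} [CommRing R] [CharP R 2] (a : R) :
    QuadraticAlgebra R a 1 →ₐ[R] QuadraticAlgebra R a 1 :=
  QuadraticAlgebra.lift ⟨ω + 1, by
    have h2 : (2 : R) = 0 := CharTwo.two_eq_zero
    ext
    · simp
      ring
    · simp
      linear_combination h2⟩

lemma quadConj_mk {R : Type} [CommRing R] [CharP R 2] (a p q : R) :
    quadConj a ⟨p, q⟩ = ⟨p + q, q⟩ := by
  ext <;> simp [quadConj, QuadraticAlgebra.lift]

/-- Coefficientwise application of a ring automorphism. -/
def quadMap {R S : Type} [CommRing R] [CommRing S] [Algebra R S] (a : R) (f : S →ₐ[R] S) :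
    QuadraticAlgebra S (algebraMap R S a) 1 →ₐ[R] QuadraticAlgebra S (algebraMap R S a) 1 where
  toFun z := ⟨f z.re, f z.im⟩
  map_one' := by ext <;> simp
  map_mul' x y := by ext <;> simp
  map_zero' := by ext <;> simp
  map_add' x y := by ext <;> simp
  commutes' r := by
    change (⟨f (algebraMap R S r), f 0⟩ : QuadraticAlgebra S _ 1) = ⟨algebraMap R S r, 0⟩
    rw [map_zero, f.commutes]

lemma exists_biquadExt (x : Fin 2 → F) (h0 : ∀ r : F, r * r ≠ r + x 0)
    (h1 : ∀ r : F, r * r ≠ r + x 1) (h01 : ∀ r : F, r * r ≠ r + (x 0 + x 1)) :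
    ∃ (E : Type) (_ : Field E) (_ : Algebra F E) (B : BiquadExt F E), B.x = x := by
  have i0 : Fact (∀ r : F, r ^ 2 ≠ x 0 + 1 * r) := ⟨fun r h => h0 r (by linear_combination h)⟩
  have h2 : (2 : F) = 0 := CharTwo.two_eq_zero
  let K := QuadraticAlgebra F (x 0) 1
  have cK : CharP K 2 := charP_of_injective_algebraMap (FaithfulSMul.algebraMap_injective F K) 2
  have i1 : Fact (∀ r : K, r ^ 2 ≠ algebraMap F K (x 1) + 1 * r) := by
    refine ⟨?_⟩
    rintro ⟨a, b⟩ h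
    have e1 := congrArg QuadraticAlgebra.re h
    have e2 := congrArg QuadraticAlgebra.im h
    simp [K, sq] at e1 e2
    have hb : b * (b + 1) = 0 := by linear_combination e2 + (b - a * b) * h2
    rcases mul_eq_zero.1 hb with hb | hb
    · subst hb
      exact h1 a (by linear_combination e1)
    · have hb : b = 1 := by linear_combination hb - h2
      subst hb
      exact h01 a (by linear_combination e1 - x 0 * h2)
  let E := QuadraticAlgebra K (algebraMap F K (x 1)) 1
  have c2 : (2 : K) = 0 := CharTwo.two_eq_zero
  let s0 : E →ₐ[F] E := quadMap (x 1) (quadConj (x 0))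
  let s1 : E →ₐ[F] E := (quadConj (algebraMap F K (x 1))).restrictScalars F
  have hs0 : ∀ p q r t : F, s0 ⟨⟨p, q⟩, ⟨r, t⟩⟩ = ⟨⟨p + q, q⟩, ⟨r + t, t⟩⟩ := fun p q r t => by
    exact congrArg₂ QuadraticAlgebra.mk (quadConj_mk _ _ _) (quadConj_mk _ _ _)
  have hs1 : ∀ p q : K, s1 ⟨p, q⟩ = ⟨p + q, q⟩ := fun p q => quadConj_mk _ _ _
  have hs1' : ∀ p q r t : F, s1 ⟨⟨p, q⟩, ⟨r, t⟩⟩ = ⟨⟨p + r, q + t⟩, ⟨r, t⟩⟩ := fun p q r t =>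
    hs1 _ _
  refine ⟨E, inferInstance, inferInstance,
    { x := x
      θ := ![algebraMap K E ω, ω]
      s := ![s0, s1]
      sq := ?_
      s_self := ?_
      s_other := ?_
      s_s := ?_
      s_comm := ?_
      fixed := ?_ }, rfl⟩
  · intro a
    fin_cases a
    · simp only [Fin.zero_eta, Matrix.cons_val_zero]
      rw [IsScalarTower.algebraMap_apply F K E, ← map_mul, ← map_add]
      congr 1
      ext <;> simp [K]
    · simp only [Fin.mk_one, Matrix.cons_val_one, Matrix.cons_val_zero]
      rw [IsScalarTower.algebraMap_apply F K E]
      ext <;> simp [E]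
  · intro a
    fin_cases a
    · exact (hs0 0 1 0 0).trans (by ext <;> simp [E, K])
    · exact (hs1 0 1).trans (by ext <;> simp [E])
  · intro a b hab
    fin_cases a <;> fin_cases b
    · exact absurd rfl hab
    · exact (hs0 0 0 1 0).trans (by ext <;> simp [E, K])
    · exact (hs1 ω 0).trans (by ext <;> simp [E, K])
    · exact absurd rfl hab
  · rintro a ⟨⟨p, q⟩, ⟨r, t⟩⟩
    fin_cases a
    · change s0 (s0 _) = _
      rw [hs0, hs0]
      ext
      · simp only [add_assoc, CharTwo.add_self_eq_zero, add_zero]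
      · rfl
      · simp only [add_assoc, CharTwo.add_self_eq_zero, add_zero]
      · rfl
    · change s1 (s1 _) = _
      rw [hs1, hs1, add_assoc, CharTwo.add_self_eq_zero, add_zero]
  · have hc : ∀ c, s0 (s1 c) = s1 (s0 c) := by
      rintro ⟨⟨p, q⟩, ⟨r, t⟩⟩
      rw [hs0, hs1', hs1', hs0]
      ext
      · ring
      · rfl
      · rfl
      · rfl
    intro a b c
    fin_cases a <;> fin_cases b
    · rfl
    · exact hc c
    · exact (hc c).symm
    · rfl
  · rintro ⟨⟨p, q⟩, ⟨r, t⟩⟩ h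
    have e0 : s0 _ = _ := h 0
    have e1 : s1 _ = _ := h 1
    rw [hs0] at e0
    rw [hs1'] at e1
    have f1 : p + q = p := congrArg (fun z : E => z.re.re) e0
    have f2 : p + r = p := congrArg (fun z : E => z.re.re) e1
    have f3 : q + t = q := congrArg (fun z : E => z.re.im) e1
    have f1' : q = 0 := by simpa using f1
    have f2' : r = 0 := by simpa using f2
    have f3' : t = 0 := by simpa using f3
    subst f1' f2' f3'
    exact ⟨p, rfl⟩

lemma quat_root {x y : F} [NoZeroDivisors ℍ[F, x, 1, y]] (r : F) : r * r ≠ r + x := by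
  intro h
  have h2 : (2 : F) = 0 := CharTwo.two_eq_zero
  have : (quatI F x y - algebraMap F _ r) * (quatI F x y - algebraMap F _ (r + 1)) = 0 := by
    ext <;> simp [quatI]
    · linear_combination h + (r + x) * h2
    · linear_combination - r * h2
  rcases mul_eq_zero.1 this with h | h
  · have := congrArg QuaternionAlgebra.imI h
    simp [quatI] at this
  · have := congrArg QuaternionAlgebra.imI h
    simp [quatI] at this

lemma noZeroDivisors_left {a b c d : F} [h : NoZeroDivisors (Biquat F a b c d)] :
    NoZeroDivisors ℍ[F, a, 1, b] :=
  (Algebra.TensorProduct.includeLeft_injective (S := F)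
    (FaithfulSMul.algebraMap_injective F ℍ[F, c, 1, d])).noZeroDivisors
    (Algebra.TensorProduct.includeLeft : _ →ₐ[F] Biquat F a b c d) (map_zero _) (map_mul _)

lemma noZeroDivisors_right {a b c d : F} [h : NoZeroDivisors (Biquat F a b c d)] :
    NoZeroDivisors ℍ[F, c, 1, d] :=
  (Algebra.TensorProduct.includeRight_injective
    (FaithfulSMul.algebraMap_injective F ℍ[F, a, 1, b])).noZeroDivisors
    (Algebra.TensorProduct.includeRight : _ →ₐ[F] Biquat F a b c d) (map_zero _) (map_mul _)

end

noncomputable section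

/-- The pairing of the standard basis vectors of the hyperbolic space of dimension 8. -/
def par : Fin 8 → Fin 8 := ![1, 0, 5, 6, 7, 2, 3, 4]

lemma par_par : ∀ i, par (par i) = i := by decide

lemma par_ne : ∀ i, par i ≠ i := by decide

lemma par_inj : ∀ {i j}, par i = par j ↔ i = j := by decide

/-- Square matrices of size 8. -/
abbrev Mat8 (E : Type) : Type := Matrix (Fin 8) (Fin 8) E

section adj

variable {E : Type} [CommRing E]

/-- The adjoint involution of the hyperbolic form. -/
def adj8 : Mat8 E →ₗ[E] Mat8 E where
  toFun M := Matrix.of fun i j => M (par j) (par i)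
  map_add' _ _ := rfl
  map_smul' _ _ := rfl

@[simp] lemma adj8_apply (M : Mat8 E) (i j : Fin 8) : adj8 M i j = M (par j) (par i) := rfl

@[simp] lemma adj8_adj8 (M : Mat8 E) : adj8 (adj8 M) = M := by
  ext i j
  simp [par_par]

lemma sum_par {V : Type} [AddCommMonoid V] (f : Fin 8 → V) : ∑ i, f (par i) = ∑ i, f i :=
  Equiv.sum_comp (Function.Involutive.toPerm par par_par) f

lemma adj8_mul (M N : Mat8 E) : adj8 (M * N) = adj8 N * adj8 M := by
  ext i j
  simp only [adj8_apply, Matrix.mul_apply]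
  rw [← sum_par]
  exact Finset.sum_congr rfl fun k _ => mul_comm _ _

@[simp] lemma adj8_one : adj8 (1 : Mat8 E) = 1 := by
  ext i j
  simp [Matrix.one_apply, par_inj, eq_comm]

lemma adj8_single (i j : Fin 8) (c : E) :
    adj8 (Matrix.single i j c) = Matrix.single (par j) (par i) c := by
  ext a b
  have h : (i = par b ∧ j = par a) ↔ (par j = a ∧ par i = b) :=
    ⟨fun ⟨h1, h2⟩ => ⟨by rw [h2, par_par], by rw [h1, par_par]⟩,
      fun ⟨h1, h2⟩ => ⟨by rw [← h2, par_par], by rw [← h1, par_par]⟩⟩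
  simp only [adj8_apply, Matrix.single_apply, h]

end adj

/-- Monomial descent data on the hyperbolic space of dimension 8. -/
structure Twist (F : Type) [Field F] where
  π : Fin 2 → Fin 8 → Fin 8
  l : Fin 2 → Fin 8 → F
  l_ne : ∀ a i, l a i ≠ 0
  π_π : ∀ a i, π a (π a i) = i
  π_comm : ∀ a b i, π a (π b i) = π b (π a i)
  π_par : ∀ a i, π a (par i) = par (π a i)
  l_inv : ∀ a i j, l a i * l a (π a i) = l a j * l a (π a j)
  l_par : ∀ a i j, l a i * l a (par i) = l a j * l a (par j)
  l_comm : ∀ a b i, l a i * l b (π a i) = l b i * l a (π b i)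

variable {F E : Type} [Field F] [Field E] [Algebra F E] (B : BiquadExt F E) (t : Twist F)

namespace Twist

/-- The ratio of two multipliers. -/
def r (a : Fin 2) (i j : Fin 8) : F := t.l a j / t.l a i

lemma r_mul (a i j k) : t.r a i j * t.r a j k = t.r a i k := by
  have := t.l_ne a i
  have := t.l_ne a j
  simp only [r]
  field_simp

lemma r_self (a i) : t.r a i i = 1 := div_self (t.l_ne a i)

lemma r_inv (a i j) : t.r a i j * t.r a (t.π a i) (t.π a j) = 1 := by
  have := t.l_ne a i
  have := t.l_ne a (t.π a i)
  simp only [r]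
  rw [div_mul_div_comm, div_eq_one_iff_eq (by positivity)]
  exact t.l_inv a j i

lemma r_par (a i j) : t.r a (par j) (par i) = t.r a i j := by
  have := t.l_ne a i
  have := t.l_ne a (par j)
  simp only [r]
  rw [div_eq_div_iff (t.l_ne _ _) (t.l_ne _ _), mul_comm, t.l_par a i j]

lemma r_comm (a b i j) : t.r a i j * t.r b (t.π a i) (t.π a j) =
    t.r b i j * t.r a (t.π b i) (t.π b j) := by
  simp only [r]
  rw [div_mul_div_comm, div_mul_div_comm, t.l_comm a b i, t.l_comm a b j]

lemma sum_π {V : Type} [AddCommMonoid V] (a : Fin 2) (f : Fin 8 → V) :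
    ∑ i, f (t.π a i) = ∑ i, f i :=
  Equiv.sum_comp (Function.Involutive.toPerm _ (t.π_π a)) f

lemma π_inj {a : Fin 2} {i j : Fin 8} : t.π a i = t.π a j ↔ i = j :=
  (Function.Involutive.injective (t.π_π a)).eq_iff

/-- The twisted Galois action on matrices. -/
def descent : B.Descent (Mat8 E) where
  τ a :=
    { toFun M := Matrix.of fun i j => algebraMap F E (t.r a i j) * B.s a (M (t.π a i) (t.π a j))
      map_zero' := by
        ext i j
        simp
      map_add' M N := by
        ext i j
        simp [mul_add] }
  semi a c M := by
    ext i j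
    simp only [AddMonoidHom.coe_mk, ZeroHom.coe_mk, Matrix.of_apply, Matrix.smul_apply,
      smul_eq_mul, map_mul]
    ring
  inv a M := by
    ext i j
    simp only [AddMonoidHom.coe_mk, ZeroHom.coe_mk, Matrix.of_apply, map_mul, AlgHom.commutes,
      B.s_s, t.π_π]
    rw [← mul_assoc, ← map_mul, t.r_inv, map_one, one_mul]
  comm a b M := by
    ext i j
    simp only [AddMonoidHom.coe_mk, ZeroHom.coe_mk, Matrix.of_apply, map_mul, AlgHom.commutes]
    rw [← mul_assoc, ← mul_assoc, ← map_mul, ← map_mul, t.r_comm a b, B.s_comm a b,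
      t.π_comm a b, t.π_comm a b]

lemma τ_apply (a : Fin 2) (M : Mat8 E) (i j : Fin 8) : (t.descent B).τ a M i j =
    algebraMap F E (t.r a i j) * B.s a (M (t.π a i) (t.π a j)) := rfl

lemma τ_mul (a : Fin 2) (M N : Mat8 E) :
    (t.descent B).τ a (M * N) = (t.descent B).τ a M * (t.descent B).τ a N := by
  ext i j
  simp only [τ_apply, Matrix.mul_apply, map_sum, map_mul, Finset.mul_sum]
  rw [← t.sum_π a]
  refine Finset.sum_congr rfl fun k _ => ?_
  rw [← t.r_mul a i k j, map_mul]
  ring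

lemma τ_algebraMap (a : Fin 2) (c : F) :
    (t.descent B).τ a (algebraMap F (Mat8 E) c) = algebraMap F (Mat8 E) c := by
  ext i j
  simp only [τ_apply, Matrix.algebraMap_matrix_apply, t.π_inj]
  split_ifs with h
  · subst h
    rw [t.r_self, map_one, one_mul, AlgHom.commutes]
  · simp

lemma τ_adj8 (a : Fin 2) (M : Mat8 E) :
    (t.descent B).τ a (adj8 M) = adj8 ((t.descent B).τ a M) := by
  ext i j
  simp only [τ_apply, adj8_apply, t.r_par, t.π_par]

lemma trace_τ (a : Fin 2) (M : Mat8 E) :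
    ((t.descent B).τ a M).trace = B.s a M.trace := by
  simp only [Matrix.trace, Matrix.diag_apply, τ_apply, t.r_self, map_one, one_mul, map_sum]
  exact t.sum_π a fun i => B.s a (M i i)

/-- The algebra of matrices fixed under the twisted Galois action. -/
def form : Subalgebra F (Mat8 E) where
  carrier := {M | ∀ a, (t.descent B).τ a M = M}
  mul_mem' {M N} hM hN a := by rw [t.τ_mul, hM a, hN a]
  add_mem' {M N} hM hN a := by rw [map_add, hM a, hN a]
  algebraMap_mem' c a := t.τ_algebraMap B a c

lemma adj8_mem {M : Mat8 E} (hM : M ∈ t.form B) : adj8 M ∈ t.form B := fun a => by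
  rw [t.τ_adj8, hM a]

/-- The involution on the twisted algebra. -/
def σ : t.form B →ₗ[F] t.form B :=
  ((adj8.restrictScalars F).comp (t.form B).val.toLinearMap).codRestrict
    (Subalgebra.toSubmodule (t.form B)) fun M => t.adj8_mem B M.2

@[simp] lemma coe_σ (M : t.form B) : (t.σ B M : Mat8 E) = adj8 (M : Mat8 E) := rfl

lemma exists_trace (M : t.form B) : ∃ f, algebraMap F E f = (M : Mat8 E).trace :=
  B.fixed _ fun a => by rw [← t.trace_τ, M.2 a]

/-- The reduced trace of the twisted algebra. -/
def T : t.form B →ₗ[F] F where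
  toFun M := (t.exists_trace B M).choose
  map_add' M N := by
    apply FaithfulSMul.algebraMap_injective F E
    rw [map_add, (t.exists_trace B M).choose_spec, (t.exists_trace B N).choose_spec,
      (t.exists_trace B (M + N)).choose_spec]
    exact Matrix.trace_add _ _
  map_smul' c M := by
    apply FaithfulSMul.algebraMap_injective F E
    rw [RingHom.id_apply, smul_eq_mul, map_mul, (t.exists_trace B M).choose_spec,
      (t.exists_trace B (c • M)).choose_spec, ← Algebra.smul_def]
    exact Matrix.trace_smul _ _

@[simp] lemma algebraMap_T (M : t.form B) : algebraMap F E (t.T B M) = (M : Mat8 E).trace :=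
  (t.exists_trace B M).choose_spec

variable [CharP E 2] [Module.Finite F E]

lemma finrank_fixed (U : Submodule E (Mat8 E)) (hU : ∀ a, ∀ M ∈ U, (t.descent B).τ a M ∈ U)
    (W : Submodule F (t.form B)) (hW : ∀ M, M ∈ W ↔ (M : Mat8 E) ∈ U) :
    finrank F W = finrank E U := by
  rw [← (t.descent B).finrank_eq U hU (W.map (t.form B).val.toLinearMap)]
  · exact (LinearEquiv.finrank_eq (Submodule.equivMapOfInjective _ Subtype.val_injective W))
  · intro M
    constructor
    · rintro ⟨N, hN, rfl⟩
      exact ⟨(hW N).1 hN, N.2⟩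
    · rintro ⟨h1, h2⟩
      exact ⟨⟨M, h2⟩, (hW _).2 h1, rfl⟩

lemma finrank_form : finrank F (t.form B) = 64 := by
  rw [← finrank_top, t.finrank_fixed B ⊤ (fun _ _ _ => trivial) ⊤ (by simp), finrank_top,
    Module.finrank_matrix]
  simp

lemma deg_form : deg F (t.form B) = 8 := by
  rw [deg, t.finrank_form]
  exact Nat.sqrt_eq 8

/-- The twisted algebra becomes the matrix algebra over `E`. -/
def toMat : E ⊗[F] t.form B →ₐ[E] Mat8 E :=
  Algebra.TensorProduct.lift (Algebra.ofId E (Mat8 E)) (t.form B).val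
    fun c M => Algebra.commutes c (M : Mat8 E)

lemma toMat_tmul (c : E) (M : t.form B) : t.toMat B (c ⊗ₜ M) = c • (M : Mat8 E) := by
  refine (Algebra.TensorProduct.lift_tmul _ _ _ _ _).trans ?_
  rw [Algebra.smul_def]
  rfl

lemma toMat_bijective : Function.Bijective (t.toMat B) := by
  have hs : Function.Surjective (t.toMat B).toLinearMap := by
    intro M
    obtain ⟨u, hu, -, hM⟩ := (t.descent B).exists_decomp ⊤ (fun _ _ _ => trivial) M trivial
    refine ⟨∑ k, B.e k ⊗ₜ ⟨u k, hu k⟩, ?_⟩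
    rw [hM, map_sum]
    exact Finset.sum_congr rfl fun k _ => t.toMat_tmul B _ _
  have hd : finrank E (E ⊗[F] t.form B) = finrank E (Mat8 E) := by
    rw [Module.finrank_baseChange, t.finrank_form, Module.finrank_matrix]
    simp
  exact ⟨(LinearMap.injective_iff_surjective_of_finrank_eq_finrank hd).2 hs, hs⟩

/-- The splitting isomorphism. -/
def splitting : E ⊗[F] t.form B ≃ₐ[E] Mat8 E := AlgEquiv.ofBijective _ (t.toMat_bijective B)

lemma splitting_tmul (c : E) (M : t.form B) : t.splitting B (c ⊗ₜ M) = c • (M : Mat8 E) :=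
  t.toMat_tmul B c M

lemma isReducedTrace : IsReducedTrace F (t.form B) (t.T B) := by
  refine ⟨E, inferInstance, inferInstance, 8, t.splitting B, fun M => ?_⟩
  rw [t.splitting_tmul, one_smul, algebraMap_T]

lemma isInvolution : IsInvolution F (t.σ B) := by
  constructor
  · intro x y
    exact Subtype.ext (adj8_mul _ _)
  · intro x
    exact Subtype.ext (adj8_adj8 _)

/-- Two linear maps agreeing on the twisted algebra agree on all matrices. -/
lemma form_ext {V : Type} [AddCommGroup V] [Module E V] {f g : Mat8 E →ₗ[E] V}
    (h : ∀ M : t.form B, f M = g M) : f = g := by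
  ext1 M
  obtain ⟨u, hu, -, rfl⟩ := (t.descent B).exists_decomp ⊤ (fun _ _ _ => trivial) M trivial
  simp only [map_sum, map_smul]
  exact Finset.sum_congr rfl fun k _ => congrArg _ (h ⟨u k, hu k⟩)

lemma isCentral : Algebra.IsCentral F (t.form B) := by
  refine ⟨fun M hM => ?_⟩
  rw [Subalgebra.mem_center_iff] at hM
  have h : LinearMap.mulRight E (M : Mat8 E) = LinearMap.mulLeft E (M : Mat8 E) :=
    t.form_ext B fun N => congrArg Subtype.val (hM N)
  have hc : ∀ N : Mat8 E, N * M = M * N := fun N => LinearMap.congr_fun h N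
  obtain ⟨c, hc⟩ : ∃ c : E, algebraMap E (Mat8 E) c = M := by
    have : (M : Mat8 E) ∈ Subalgebra.center E (Mat8 E) := Subalgebra.mem_center_iff.2 hc
    rw [Algebra.IsCentral.center_eq_bot] at this
    exact this
  obtain ⟨f, hf⟩ := B.fixed c fun a => by
    have h0 : (t.descent B).τ a M 0 0 = (M : Mat8 E) 0 0 := by rw [M.2 a]
    rw [← hc, τ_apply, t.r_self, Matrix.algebraMap_matrix_apply, Matrix.algebraMap_matrix_apply] at h0
    simpa using h0
  refine ⟨f, Subtype.ext ?_⟩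
  rw [← hc, ← hf]
  rfl

end Twist
end

noncomputable section

/-- A choice of one index pair from each orbit of `(i, j) ↦ (par j, par i)`. -/
def low (i j : Fin 8) : Bool := decide ((i : ℕ) * 8 + j ≤ (par j : ℕ) * 8 + par i)

lemma low_or : ∀ i j, low i j = false → low (par j) (par i) = true := by decide

lemma low_and : ∀ i j, low i j = true → low (par j) (par i) = true → j = par i := by decide

section
variable {E : Type} [Field E] [CharP E 2]

lemma finrank_symm : finrank E (LinearMap.ker (adj8 - LinearMap.id : Mat8 E →ₗ[E] Mat8 E)) = 36 := by
  have hmem : ∀ M : Mat8 E, M ∈ LinearMap.ker (adj8 - LinearMap.id : Mat8 E →ₗ[E] Mat8 E) ↔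
      ∀ i j, M (par j) (par i) = M i j := fun M => by
    rw [LinearMap.mem_ker, LinearMap.sub_apply, sub_eq_zero]
    exact ⟨fun h i j => congrFun (congrFun h i) j, fun h => Matrix.ext h⟩
  let f : LinearMap.ker (adj8 - LinearMap.id : Mat8 E →ₗ[E] Mat8 E) →ₗ[E]
      ({p : Fin 8 × Fin 8 // low p.1 p.2 = true} → E) :=
    { toFun M p := M.1 p.1.1 p.1.2
      map_add' _ _ := rfl
      map_smul' _ _ := rfl }
  have hbij : Function.Bijective f := by
    constructor
    · intro M N h
      have h' : ∀ i j, low i j = true → M.1 i j = N.1 i j := fun i j hij =>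
        congrFun h ⟨(i, j), hij⟩
      ext i j
      cases hij : low i j
      · rw [← (hmem _).1 M.2, ← (hmem _).1 N.2]
        exact h' _ _ (low_or i j hij)
      · exact h' i j hij
    · intro v
      refine ⟨⟨Matrix.of fun i j => if h : low i j = true then v ⟨(i, j), h⟩ else
        if h : low (par j) (par i) = true then v ⟨(par j, par i), h⟩ else 0, ?_⟩, ?_⟩
      · rw [hmem]
        intro i j
        simp only [Matrix.of_apply]
        by_cases h1 : low i j = true <;> by_cases h2 : low (par j) (par i) = true
        · have := low_and i j h1 h2
          subst this
          simp [par_par]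
        · simp [h1, h2, par_par]
        · simp [h1, h2]
        · exact absurd (low_or i j (by simpa using h1)) h2
      · ext p
        exact dif_pos (c := low p.1.1 p.1.2 = true) p.2
  rw [(LinearEquiv.ofBijective f hbij).finrank_eq, Module.finrank_fintype_fun_eq_card]
  decide

/-- Symmetric matrices are spanned by the obvious ones. -/
lemma symm_ext {V : Type} [AddCommGroup V] [Module E V] {f g : Mat8 E →ₗ[E] V}
    (h1 : ∀ i j, j ≠ par i → f (Matrix.single i j 1 + Matrix.single (par j) (par i) 1) =
      g (Matrix.single i j 1 + Matrix.single (par j) (par i) 1))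
    (h2 : ∀ i, f (Matrix.single i (par i) 1) = g (Matrix.single i (par i) 1))
    {N : Mat8 E} (hN : adj8 N = N) : f N = g N := by
  set k := f - g with hk
  have k1 : ∀ i j, j ≠ par i → k (Matrix.single (par j) (par i) 1) = k (Matrix.single i j 1) :=
    fun i j hij => by
      have := h1 i j hij
      rw [← sub_eq_zero, ← LinearMap.sub_apply, ← hk, map_add] at this
      have h2 : k (Matrix.single i j 1) + k (Matrix.single i j 1) = 0 := by
        rw [← two_smul E, CharTwo.two_eq_zero, zero_smul]
      exact add_left_cancel (this.trans h2.symm)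
  have k2 : ∀ i, k (Matrix.single i (par i) 1) = 0 := fun i => by
    rw [hk, LinearMap.sub_apply, h2, sub_self]
  have hn : ∀ i j, N (par j) (par i) = N i j := fun i j => congrFun (congrFun hN i) j
  suffices k N = 0 by rwa [hk, LinearMap.sub_apply, sub_eq_zero] at this
  have hsum : k N = ∑ p : Fin 8 × Fin 8, N p.1 p.2 • k (Matrix.single p.1 p.2 1) := by
    conv_lhs => rw [Matrix.matrix_eq_sum_single N]
    rw [Fintype.sum_prod_type, map_sum]
    refine Finset.sum_congr rfl fun i _ => ?_
    rw [map_sum]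
    refine Finset.sum_congr rfl fun j _ => ?_
    rw [← map_smul, Matrix.smul_single, smul_eq_mul, mul_one]
  rw [hsum]
  refine Finset.sum_involution (fun p _ => (par p.2, par p.1)) ?_ ?_ ?_ ?_
  · rintro ⟨i, j⟩ -
    by_cases hij : j = par i
    · subst hij
      simp [k2, par_par]
    · simp only [hn, k1 i j hij]
      rw [← two_smul E, CharTwo.two_eq_zero, zero_smul]
  · rintro ⟨i, j⟩ - h0 he
    have : j = par i := by
      simp only [Prod.mk.injEq] at he
      exact he.2.symm
    subst this
    simp [k2] at h0
  · simp
  · rintro ⟨i, j⟩ -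
    simp [par_par]

lemma trace_eq_zero_of_symm {N : Mat8 E} (hN : adj8 N = N) : N.trace = 0 := by
  have := symm_ext (f := Matrix.traceLinearMap (Fin 8) E E) (g := 0) ?_ ?_ hN
  · simpa using this
  · intro i j hij
    simp only [map_add, Matrix.traceLinearMap_apply, LinearMap.zero_apply]
    by_cases h : i = j
    · subst h
      simp [CharTwo.add_self_eq_zero]
    · rw [Matrix.trace_single_eq_of_ne _ _ _ h, Matrix.trace_single_eq_of_ne, add_zero]
      exact fun h' => h (par_inj.1 h').symm
  · intro i
    rw [Matrix.traceLinearMap_apply, Matrix.trace_single_eq_of_ne]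
    · rfl
    · exact (par_ne i).symm

end

variable {F E : Type} [Field F] [Field E] [Algebra F E] (B : BiquadExt F E) (t : Twist F)
  [CharP F 2] [CharP E 2] [Module.Finite F E]

lemma Twist.finrank_symSet : finrank F (symSet F (t.σ B)) = 36 := by
  rw [← finrank_symm (E := E)]
  refine t.finrank_fixed B _ ?_ _ ?_
  · intro a M hM
    rw [LinearMap.mem_ker, LinearMap.sub_apply, LinearMap.id_apply, sub_eq_zero] at hM ⊢
    rw [← t.τ_adj8, hM]
  · intro M
    simp only [symSet, LinearMap.mem_ker, LinearMap.sub_apply, LinearMap.id_apply, sub_eq_zero]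
    exact Subtype.ext_iff

lemma Twist.isQuadraticPair {ℓ : t.form B} (hℓ : ℓ + t.σ B ℓ = 1) :
    IsQuadraticPair F (t.form B) (t.T B) (t.σ B) ℓ := by
  refine ⟨t.isInvolution B, ?_, fun x hx => ?_, hℓ⟩
  · rw [t.finrank_symSet, t.deg_form]
  · apply FaithfulSMul.algebraMap_injective F E
    rw [t.algebraMap_T, map_zero]
    apply trace_eq_zero_of_symm
    have := congrArg Subtype.val hx
    rw [t.coe_σ] at this
    rw [this, Subalgebra.coe_neg]
    ext i j
    exact CharTwo.neg_eq _

end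

noncomputable section

/-- The entries of the matrices of left (`s = false`) and right (`s = true`) multiplications
of the split octonions, in a hyperbolic basis. -/
def tp (s : Bool) (i a c : Fin 8) : Bool :=
  Nat.testBit (match s with
    | false => 104748499845946668330025961963719179198412301660723712121230476112568860175842588170916951494273769651574015349908347546578093808930223001224450056126720
    | true => 52374250119605432907808710059587587882278889215517762296150655395759551507990756296185866738941622005202642108829403610527967273698907657330752445743360)
    (64 * i + 8 * a + c)

lemma tp_not : ∀ s i a c, tp (!s) i a c = tp s i (par c) (par a) := by decide +kernel

/-- The permutations in the descent data for the three hyperbolic spaces. -/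
def pm : Fin 3 → Fin 2 → Fin 8 → Fin 8 :=
  ![![![1, 0, 5, 4, 3, 2, 7, 6], ![1, 0, 5, 7, 6, 2, 4, 3]],
    ![![2, 5, 0, 6, 7, 1, 3, 4], ![1, 0, 5, 7, 6, 2, 4, 3]],
    ![![5, 2, 1, 6, 7, 0, 3, 4], ![1, 0, 5, 7, 6, 2, 4, 3]]]

/-- The exponents of the multipliers in the descent data for the three hyperbolic spaces. -/
def ex : Fin 2 → Fin 3 → Fin 2 → Fin 8 → ℕ :=
  ![![![![0, 1, 1, 0, 1, 0, 1, 0], ![0, 1, 1, 0, 0, 0, 1, 1]],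
      ![![1, 1, 1, 0, 1, 1, 2, 1], ![1, 0, 1, 0, 0, 0, 1, 1]],
      ![![1, 0, 1, 0, 1, 0, 1, 0], ![1, 1, 2, 1, 1, 0, 1, 1]]],
    ![![![0, 1, 0, 0, 1, 1, 1, 0], ![0, 1, 0, 0, 0, 1, 1, 1]],
      ![![1, 0, 0, 0, 1, 1, 1, 0], ![2, 0, 1, 1, 1, 1, 1, 1]],
      ![![1, 1, 1, 1, 2, 1, 1, 0], ![0, 1, 1, 1, 1, 0, 0, 0]]]]

lemma pm_pm : ∀ n a i, pm n a (pm n a i) = i := by decide +kernel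
lemma pm_comm : ∀ n a b i, pm n a (pm n b i) = pm n b (pm n a i) := by decide +kernel
lemma pm_par : ∀ n a i, pm n a (par i) = par (pm n a i) := by decide +kernel

lemma ex_inv : ∀ v n a i j,
    ex v n a i + ex v n a (pm n a i) = ex v n a j + ex v n a (pm n a j) := by decide +kernel
lemma ex_par : ∀ v n a i j,
    ex v n a i + ex v n a (par i) = ex v n a j + ex v n a (par j) := by decide +kernel
lemma ex_comm : ∀ v n a b i,
    ex v n a i + ex v n b (pm n a i) = ex v n b i + ex v n a (pm n b i) := by decide +kernel

/-- The index of the target of the half-spin map `κ s` from the `n`-th space. -/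
def tgt (s : Bool) (n : Fin 3) : Fin 3 := if s then n + 1 else n + 2

lemma tp_pm : ∀ s n a i p c,
    tp s (pm n a i) (pm (tgt s n) a p) (pm (tgt (!s) n) a c) = tp s i p c := by decide +kernel

lemma ex_tp : ∀ s i p c, tp s i p c = true → ∀ j q, tp (!s) (par j) c q = true → ∀ v n a,
    ex v n a j + ex v (tgt s n) a p = ex v n a i + ex v (tgt s n) a q := by decide +kernel

/-- The support of the entry `(a, b)` in the product of two multiplication matrices. -/
def kz (s : Bool) (i j a b : Fin 8) : Bool :=
  decide (∃ c, tp s i a c = true ∧ tp (!s) j c b = true)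

lemma tp_unique : ∀ s i a c, tp s i a c = true → ∀ c', tp s i a c' = true → c = c' := by
  decide +kernel

lemma kz_anti : ∀ s i j a b, (kz s i j a b ^^ kz s j i a b) =
    decide (j = par i ∧ a = b) := by decide +kernel

lemma kz_self : ∀ s i a b, kz s i i a b = false := by decide +kernel

lemma tp_par : ∀ s i a c, tp s i (par a) c = tp (!s) a (par i) c := by decide +kernel

lemma kz_dual (s : Bool) (i j a b : Fin 8) : kz (!s) (par a) b (par i) j = kz s i j a b := by
  simp only [kz, Bool.not_not]
  congr 1
  refine propext (exists_congr fun c => and_congr ?_ ?_)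
  · rw [tp_par, Bool.not_not, par_par]
  · have h := tp_not (!s) b c j
    rw [Bool.not_not] at h
    rw [h, tp_not s j c b, tp_par s j]

lemma exists_kz_and : ∀ s a b, b ≠ a → b ≠ par a → ∃ i j, kz s i j a b = true ∧ ∀ p q,
    kz s i j p q = decide ((p = a ∧ q = b) ∨ (p = par b ∧ q = par a)) := by decide +kernel

lemma kz_diag : ∀ s a b, (∑ i ∈ {1, 5, 6, 7}, if kz s i (par i) a b then 1 else 0 : ZMod 2) =
    if a = b ∧ s = false then 1 else 0 := by decide +kernel

end

noncomputable section

section kappa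

variable {E : Type} [CommRing E]

/-- The matrix of left or right multiplication by a basis vector. -/
def gen (E : Type) [CommRing E] (s : Bool) (i : Fin 8) : Mat8 E :=
  Matrix.of fun a c => if tp s i a c = true then 1 else 0

lemma gen_apply (s : Bool) (i a c : Fin 8) :
    gen E s i a c = if tp s i a c = true then 1 else 0 := rfl

lemma gen_mul_apply (s : Bool) (i j a b : Fin 8) :
    (gen E s i * gen E (!s) j) a b = if kz s i j a b = true then 1 else 0 := by
  simp only [Matrix.mul_apply, gen_apply, mul_ite, mul_one, mul_zero, ← ite_and]
  by_cases h : ∃ c, tp s i a c = true ∧ tp (!s) j c b = true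
  · obtain ⟨c, h1, h2⟩ := h
    rw [if_pos (show kz s i j a b = true from decide_eq_true ⟨c, h1, h2⟩), Finset.sum_eq_single c]
    · rw [if_pos ⟨h2, h1⟩]
    · exact fun c' _ hc => if_neg fun h => hc (tp_unique s i a c h1 c' h.2).symm
    · exact fun h => absurd (Finset.mem_univ _) h
  · rw [if_neg (by simpa [kz] using h)]
    exact Finset.sum_eq_zero fun c _ => if_neg fun h' => h ⟨c, h'.2, h'.1⟩

lemma adj8_gen (s : Bool) (i : Fin 8) : adj8 (gen E s i) = gen E (!s) i := by
  ext a b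
  rw [adj8_apply, gen_apply, gen_apply, tp_not]

lemma gen_self (s : Bool) (i : Fin 8) : gen E s i * gen E (!s) i = 0 := by
  ext a b
  rw [gen_mul_apply, kz_self]
  simp

lemma gen_anti [CharP E 2] (s : Bool) (i j : Fin 8) :
    gen E s i * gen E (!s) j + gen E s j * gen E (!s) i = if j = par i then 1 else 0 := by
  ext a b
  have h := kz_anti s i j a b
  have h2 : (1 : E) + 1 = 0 := CharTwo.add_self_eq_zero 1
  rw [Matrix.add_apply, gen_mul_apply, gen_mul_apply]
  by_cases hj : j = par i
  · rw [if_pos hj, Matrix.one_apply]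
    by_cases hab : a = b
    · cases h3 : kz s i j a b <;> cases h4 : kz s j i a b <;> simp_all
    · cases h3 : kz s i j a b <;> cases h4 : kz s j i a b <;> simp_all
  · rw [if_neg hj, Matrix.zero_apply]
    cases h3 : kz s i j a b <;> cases h4 : kz s j i a b <;> simp_all

/-- The matrix of left or right multiplication. -/
def vec (s : Bool) : (Fin 8 → E) →ₗ[E] Mat8 E := Fintype.linearCombination E (gen E s)

lemma vec_apply (s : Bool) (u : Fin 8 → E) : vec s u = ∑ i, u i • gen E s i := rfl

lemma vec_single (s : Bool) (i : Fin 8) (c : E) : vec s (Pi.single i c) = c • gen E s i :=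
  Fintype.linearCombination_apply_single ..

/-- The polar form of the hyperbolic form. -/
def bil (u v : Fin 8 → E) : E := ∑ i, u i * v (par i)

/-- The hyperbolic quadratic form. -/
def quad (v : Fin 8 → E) : E := v 0 * v 1 + v 2 * v 5 + v 3 * v 6 + v 4 * v 7

lemma quad_add (u v : Fin 8 → E) : quad (u + v) = quad u + quad v + bil u v := by
  have h : par 0 = 1 ∧ par 1 = 0 ∧ par 2 = 5 ∧ par 3 = 6 ∧ par 4 = 7 ∧ par 5 = 2 ∧ par 6 = 3 ∧
    par 7 = 4 := by decide
  obtain ⟨h0, h1, h2, h3, h4, h5, h6, h7⟩ := h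
  simp only [quad, bil, Fin.sum_univ_eight, Pi.add_apply, h0, h1, h2, h3, h4, h5, h6, h7]
  ring

lemma quad_single (i : Fin 8) (c : E) : quad (Pi.single i c) = 0 := by
  fin_cases i <;> simp [quad]

lemma vec_mul_vec (s s' : Bool) (u v : Fin 8 → E) :
    vec s u * vec s' v = ∑ i, ∑ j, (u i * v j) • (gen E s i * gen E s' j) := by
  simp only [vec_apply, Finset.sum_mul_sum, smul_mul_smul_comm]

lemma vec_anti [CharP E 2] (s : Bool) (u v : Fin 8 → E) :
    vec s u * vec (!s) v + vec s v * vec (!s) u = bil u v • 1 := by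
  have h : vec s v * vec (!s) u = ∑ i, ∑ j, (v j * u i) • (gen E s j * gen E (!s) i) := by
    rw [vec_mul_vec, Finset.sum_comm]
  rw [vec_mul_vec, h, bil, Finset.sum_smul, ← Finset.sum_add_distrib]
  refine Finset.sum_congr rfl fun i _ => ?_
  rw [← Finset.sum_add_distrib, Finset.sum_eq_single (par i)]
  · rw [mul_comm (v _), ← smul_add, gen_anti, if_pos rfl]
  · intro j _ hj
    rw [mul_comm (v _), ← smul_add, gen_anti, if_neg hj, smul_zero]
  · exact fun h => absurd (Finset.mem_univ _) h

lemma vec_self [CharP E 2] (s : Bool) (v : Fin 8 → E) : vec s v * vec (!s) v = quad v • 1 := by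
  rw [← Finset.univ_sum_single v]
  refine Finset.sum_induction _ (fun v => vec s v * vec (!s) v = quad v • 1) ?_ ?_ ?_
  · intro u v hu hv
    rw [map_add, map_add, quad_add, add_smul, add_smul, ← hu, ← hv, ← vec_anti]
    noncomm_ring
  · simp [quad]
  · intro i _
    rw [vec_single, vec_single, smul_mul_smul_comm, gen_self, quad_single, smul_zero, zero_smul]

lemma adj8_vec (s : Bool) (u : Fin 8 → E) : adj8 (vec s u) = vec (!s) u := by
  simp only [vec_apply, map_sum, map_smul, adj8_gen]

/-- The half-spin map of the hyperbolic space of dimension 8 (of octonions). -/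
def κ (s : Bool) : Mat8 E →ₗ[E] Mat8 E where
  toFun M := ∑ i, ∑ j, M i j • (gen E s i * gen E (!s) (par j))
  map_add' M N := by simp [add_smul, Finset.sum_add_distrib]
  map_smul' c M := by simp [mul_smul, Finset.smul_sum]

lemma κ_def (s : Bool) (M : Mat8 E) :
    κ s M = ∑ i, ∑ j, M i j • (gen E s i * gen E (!s) (par j)) := rfl

lemma κ_apply (s : Bool) (M : Mat8 E) (a b : Fin 8) :
    κ s M a b = ∑ i, ∑ j, if kz s i (par j) a b = true then M i j else 0 := by
  simp only [κ_def, Matrix.sum_apply, Matrix.smul_apply, gen_mul_apply, smul_eq_mul, mul_ite,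
    mul_one, mul_zero]

lemma κ_single (s : Bool) (i j : Fin 8) (c : E) :
    κ s (Matrix.single i j c) = c • (gen E s i * gen E (!s) (par j)) := by
  rw [κ_def, Finset.sum_eq_single i, Finset.sum_eq_single j]
  · simp
  · intro k _ hk
    rw [Matrix.single_apply_of_col_ne _ _ hk.symm, zero_smul]
  · exact fun h => absurd (Finset.mem_univ _) h
  · intro k _ hk
    refine Finset.sum_eq_zero fun l _ => ?_
    rw [Matrix.single_apply_of_row_ne hk.symm, zero_smul]
  · exact fun h => absurd (Finset.mem_univ _) h

lemma κ_vecMulVec (s : Bool) (u v : Fin 8 → E) :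
    κ s (Matrix.vecMulVec u (v ∘ par)) = vec s u * vec (!s) v := by
  rw [κ_def, vec_mul_vec]
  refine Finset.sum_congr rfl fun i _ => ?_
  rw [← sum_par]
  exact Finset.sum_congr rfl fun j _ => by rw [Matrix.vecMulVec_apply, Function.comp, par_par]

lemma κ_adj8 (s : Bool) (M : Mat8 E) : κ s (adj8 M) = adj8 (κ s M) := by
  rw [κ_def, κ_def]
  simp only [map_sum, map_smul, adj8_mul, adj8_gen, Bool.not_not, adj8_apply]
  rw [Finset.sum_comm, ← sum_par]
  refine Finset.sum_congr rfl fun i _ => ?_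
  rw [← sum_par]
  exact Finset.sum_congr rfl fun j _ => by rw [par_par, par_par]

end kappa

section symm

variable {E : Type} [Field E]

lemma diagonal_mul_single (d : Fin 8 → E) (i j : Fin 8) (c : E) :
    Matrix.diagonal d * Matrix.single i j c = Matrix.single i j (d i * c) := by
  ext a b
  rw [Matrix.diagonal_mul, Matrix.single_apply, Matrix.single_apply, mul_ite, mul_zero]
  exact ite_congr rfl (fun h => by rw [h.1]) fun _ => rfl

/-- The half-spin map sends symmetric matrices to scalars. -/
lemma κ_symm [CharP E 2] (s : Bool) {d : Fin 8 → E} (hd : ∀ i, d i + d (par i) = 1) {N : Mat8 E}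
    (hN : adj8 N = N) : κ s N = (Matrix.diagonal d * N).trace • 1 := by
  refine symm_ext (f := κ s) (g := LinearMap.toSpanSingleton E _ 1 ∘ₗ
    Matrix.traceLinearMap (Fin 8) E E ∘ₗ LinearMap.mulLeft E (Matrix.diagonal d)) ?_ ?_ hN
  · intro i j hij
    simp only [LinearMap.comp_apply, LinearMap.mulLeft_apply, Matrix.traceLinearMap_apply,
      LinearMap.toSpanSingleton_apply]
    rw [map_add, κ_single, κ_single, one_smul, one_smul, par_par, gen_anti, mul_add,
      Matrix.trace_add, diagonal_mul_single, diagonal_mul_single]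
    by_cases h : i = j
    · subst h
      rw [if_pos rfl, Matrix.trace_single_eq_same, Matrix.trace_single_eq_same, mul_one, mul_one, hd, one_smul]
    · rw [if_neg fun h' => h (par_inj.1 h').symm, Matrix.trace_single_eq_of_ne _ _ _ h,
        Matrix.trace_single_eq_of_ne _ _ _ fun h' => h (par_inj.1 h').symm, add_zero, zero_smul]
  · intro i
    simp only [LinearMap.comp_apply, LinearMap.mulLeft_apply, Matrix.traceLinearMap_apply,
      LinearMap.toSpanSingleton_apply]
    rw [κ_single, par_par, gen_self, smul_zero, diagonal_mul_single,
      Matrix.trace_single_eq_of_ne _ _ _ (par_ne i).symm, zero_smul]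

/-- The degree two relations of the Clifford algebra, in coordinates. -/
lemma sum_gen_mul_gen [CharP E 2] (s : Bool) {d : Fin 8 → E} (hd : ∀ i, d i + d (par i) = 1)
    {n : Mat8 E} (hn : adj8 n = n) :
    ∑ j, ∑ k, n j k • (gen E (!s) (par j) * gen E s k) = (∑ j, d j * n j j) • 1 := by
  have h := κ_symm (!s) hd (N := n.transpose) (by
    ext i j
    have := congrFun (congrFun hn j) i
    simpa using this)
  rw [κ_def, Bool.not_not] at h
  have h1 : ∑ j, ∑ k, n j k • (gen E (!s) (par j) * gen E s k) =
      ∑ i, ∑ j, n.transpose i j • (gen E (!s) i * gen E s (par j)) := by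
    rw [← sum_par]
    refine Finset.sum_congr rfl fun i _ => ?_
    rw [← sum_par]
    refine Finset.sum_congr rfl fun j _ => ?_
    rw [par_par, Matrix.transpose_apply, ← congrFun (congrFun hn (par i)) (par j), adj8_apply,
      par_par, par_par]
  rw [h1, h, Matrix.trace]
  congr 1
  exact Finset.sum_congr rfl fun j _ => by
    rw [Matrix.diag_apply, Matrix.diagonal_mul, Matrix.transpose_apply]

/-- The image of the half-spin map contains enough alternating elements. -/
lemma exists_κ_single (s : Bool) {a b : Fin 8} (h1 : b ≠ a) (h2 : b ≠ par a) :
    ∃ i j, κ s (Matrix.single i j (1 : E)) =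
      Matrix.single a b 1 + Matrix.single (par b) (par a) 1 := by
  obtain ⟨i, j, -, h⟩ := exists_kz_and s a b h1 h2
  refine ⟨i, par j, ?_⟩
  ext p q
  have hne : ¬ (a = par b ∧ b = par a) := fun h => h2 h.2
  rw [κ_single, one_smul, par_par, gen_mul_apply, h, Matrix.add_apply,
    Matrix.single_apply, Matrix.single_apply]
  simp only [decide_eq_true_eq]
  by_cases hp : p = a ∧ q = b
  · rw [if_pos (Or.inl hp), if_pos ⟨hp.1.symm, hp.2.symm⟩, if_neg, add_zero]
    rintro ⟨h3, h4⟩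
    exact h2 (by rw [h4, hp.2])
  · rw [if_neg (c := a = p ∧ b = q) fun h => hp ⟨h.1.symm, h.2.symm⟩, zero_add]
    refine ite_congr (propext ?_) (fun _ => rfl) fun _ => rfl
    rw [or_iff_right hp, eq_comm, eq_comm (a := q)]

/-- The half-spin map is injective modulo symmetric matrices. -/
lemma add_adj8_apply_of_κ_eq_zero [CharP E 2] (s : Bool) {M : Mat8 E} (hM : κ s M = 0)
    {i j : Fin 8} (hij : i ≠ j) : M i j + adj8 M i j = 0 := by
  by_cases hj : j = par i
  · subst hj
    rw [adj8_apply, par_par, CharTwo.add_self_eq_zero]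
  obtain ⟨p, q, -, h⟩ := exists_kz_and (!s) (par i) (par j) (fun h => hij (par_inj.1 h).symm)
    (fun h => hj (by rw [← par_par j, h, par_par]))
  have h1 : ∀ k l, kz s k (par l) (par p) q = decide ((k = i ∧ l = j) ∨ (k = par j ∧ l = par i)) := by
    intro k l
    have := kz_dual (!s) p q (par k) (par l)
    rw [Bool.not_not, par_par] at this
    rw [this, h, decide_eq_decide, par_inj, par_inj, par_inj, par_inj]
  have h2 := congrFun (congrFun hM (par p)) q
  rw [κ_apply, Matrix.zero_apply] at h2
  rw [adj8_apply, ← h2]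
  have h3 : ∀ k l, (if kz s k (par l) (par p) q = true then M k l else 0) =
      (if k = i ∧ l = j then M k l else 0) + (if k = par j ∧ l = par i then M k l else 0) := by
    intro k l
    rw [h1]
    simp only [decide_eq_true_eq]
    by_cases h4 : k = i ∧ l = j
    · rw [if_pos (Or.inl h4), if_pos h4, if_neg, add_zero]
      rintro ⟨h5, h6⟩
      exact hj (by rw [← h4.2, h6])
    · rw [if_neg (c := k = i ∧ l = j) h4, zero_add]
      exact ite_congr (propext (or_iff_right h4)) (fun _ => rfl) fun _ => rfl
  simp only [h3, Finset.sum_add_distrib, ite_and, Finset.sum_ite_irrel, Finset.sum_const_zero,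
    Finset.sum_ite_eq', Finset.mem_univ, if_true]

lemma κ_sum_single [CharP E 2] (s : Bool) :
    κ s (∑ i ∈ {1, 5, 6, 7}, Matrix.single i i (1 : E)) = if s = false then 1 else 0 := by
  ext a b
  have h := congrArg (ZMod.castHom (dvd_refl 2) E) (kz_diag s a b)
  rw [map_sum] at h
  rw [map_sum, Matrix.sum_apply]
  simp only [κ_single, one_smul, gen_mul_apply]
  have h2 : ∀ p : Prop, ∀ [Decidable p], ZMod.castHom (dvd_refl 2) E (if p then 1 else 0) =
      if p then 1 else 0 := by
    intro p _
    split_ifs <;> simp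
  simp only [h2] at h
  rw [h]
  cases s <;> simp [Matrix.one_apply]

end symm

end

noncomputable section

variable {F E : Type} [Field F] [Field E] [Algebra F E] (B : BiquadExt F E)
variable (y : Fin 2 → F) (hy : ∀ v, y v ≠ 0)

/-- The multipliers of the three triality-related descent data. -/
def mlt (n : Fin 3) (a : Fin 2) (i : Fin 8) : F := y 0 ^ ex 0 n a i * y 1 ^ ex 1 n a i

lemma mlt_mul_mlt {n n' m m' : Fin 3} {a a' b b' : Fin 2} {i i' j j' : Fin 8}
    (h : ∀ v, ex v n a i + ex v n' a' i' = ex v m b j + ex v m' b' j') :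
    mlt y n a i * mlt y n' a' i' = mlt y m b j * mlt y m' b' j' := by
  simp only [mlt]
  rw [mul_mul_mul_comm, ← pow_add, ← pow_add, h, h, pow_add, pow_add, mul_mul_mul_comm]

/-- The three triality-related descent data. -/
def tw (n : Fin 3) : Twist F where
  π := pm n
  l := mlt y n
  l_ne _ _ := mul_ne_zero (pow_ne_zero _ (hy 0)) (pow_ne_zero _ (hy 1))
  π_π := pm_pm n
  π_comm := pm_comm n
  π_par := pm_par n
  l_inv a i j := mlt_mul_mlt y fun v => ex_inv v n a i j
  l_par a i j := mlt_mul_mlt y fun v => ex_par v n a i j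
  l_comm a b i := mlt_mul_mlt y fun v => ex_comm v n a b i

lemma kz_pm (s : Bool) (n : Fin 3) (a : Fin 2) (i j p q : Fin 8) :
    kz s (pm n a i) (pm n a j) (pm (tgt s n) a p) (pm (tgt s n) a q) = kz s i j p q := by
  have h1 : ∀ c, tp (!s) (pm n a j) (pm (tgt (!s) n) a c) (pm (tgt s n) a q) =
      tp (!s) j c q := fun c => by
    have := tp_pm (!s) n a j c q
    rwa [Bool.not_not] at this
  rw [kz, kz, decide_eq_decide]
  constructor
  · rintro ⟨c, hc⟩
    refine ⟨pm (tgt (!s) n) a c, ?_⟩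
    rwa [← tp_pm s n a i, ← h1, pm_pm]
  · rintro ⟨c, hc⟩
    refine ⟨pm (tgt (!s) n) a c, ?_⟩
    rwa [tp_pm s n a i, h1]

lemma r_eq_of_kz {s : Bool} {n : Fin 3} {a : Fin 2} {i j p q : Fin 8}
    (h : kz s i (par j) p q = true) :
    (tw y hy n).r a i j = (tw y hy (tgt s n)).r a p q := by
  obtain ⟨c, h1, h2⟩ := of_decide_eq_true h
  have h3 := mlt_mul_mlt y fun v => ex_tp s i p c h1 j q h2 v n a
  rw [Twist.r, Twist.r, div_eq_div_iff ((tw y hy n).l_ne a i) ((tw y hy (tgt s n)).l_ne a p)]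
  exact h3.trans (mul_comm _ _)

/-- The half-spin map is equivariant. -/
lemma κ_τ (s : Bool) (n : Fin 3) (a : Fin 2) (M : Mat8 E) :
    κ s (((tw y hy n).descent B).τ a M) = ((tw y hy (tgt s n)).descent B).τ a (κ s M) := by
  ext p q
  rw [Twist.τ_apply, κ_apply, κ_apply, ← (tw y hy n).sum_π a]
  simp only [map_sum, Finset.mul_sum]
  refine Finset.sum_congr rfl fun i _ => ?_
  rw [← (tw y hy n).sum_π a]
  refine Finset.sum_congr rfl fun j _ => ?_
  rw [Twist.τ_apply, Twist.π_π, Twist.π_π, ← Twist.π_par]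
  have h := kz_pm s n a i (par j) ((tw y hy (tgt s n)).π a p) ((tw y hy (tgt s n)).π a q)
  have h' : kz s ((tw y hy n).π a i) ((tw y hy n).π a (par j)) p q =
      kz s i (par j) ((tw y hy (tgt s n)).π a p) ((tw y hy (tgt s n)).π a q) := by
    rw [← h]
    change _ = kz s _ _ (pm (tgt s n) a (pm (tgt s n) a p)) (pm (tgt s n) a (pm (tgt s n) a q))
    rw [pm_pm, pm_pm]
    rfl
  rw [h']
  by_cases hk : kz s i (par j) ((tw y hy (tgt s n)).π a p) ((tw y hy (tgt s n)).π a q) = true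
  · rw [if_pos hk, if_pos hk]
    have h2 : (tw y hy n).r a ((tw y hy n).π a i) ((tw y hy n).π a j) =
        (tw y hy (tgt s n)).r a p q := by
      apply r_eq_of_kz
      rw [← Twist.π_par, h', hk]
    rw [h2]
  · rw [if_neg hk, if_neg hk, map_zero, mul_zero]

/-- The half-spin map on the twisted algebras. -/
def spin (s : Bool) (n : Fin 3) :
    (tw y hy n).form B →ₗ[F] (tw y hy (tgt s n)).form B :=
  (((κ s).restrictScalars F).comp ((tw y hy n).form B).val.toLinearMap).codRestrict
    (Subalgebra.toSubmodule ((tw y hy (tgt s n)).form B)) fun M a =>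
      (κ_τ B y hy s n a M).symm.trans (congrArg _ (M.2 a))

@[simp] lemma coe_spin (s : Bool) (n : Fin 3) (M : (tw y hy n).form B) :
    (spin B y hy s n M : Mat8 E) = κ s (M : Mat8 E) := rfl

lemma spin_σ (s : Bool) (n : Fin 3) (M : (tw y hy n).form B) :
    spin B y hy s n ((tw y hy n).σ B M) = (tw y hy (tgt s n)).σ B (spin B y hy s n M) :=
  Subtype.ext (κ_adj8 s _)

/-- The diagonal entries of an element of trace one for the involution. -/
def dg (n : Fin 3) : Fin 8 → E :=
  ![![B.θ 0 + B.θ 1, B.θ 0 + B.θ 1 + 1, B.θ 0 + B.θ 1, B.θ 0, B.θ 0 + 1, B.θ 0 + B.θ 1 + 1,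
      B.θ 0 + 1, B.θ 0],
    ![B.θ 1, B.θ 1 + 1, B.θ 1, B.θ 0, B.θ 0 + 1, B.θ 1 + 1, B.θ 0 + 1, B.θ 0],
    ![B.θ 1, B.θ 1 + 1, B.θ 1 + 1, B.θ 0, B.θ 0 + 1, B.θ 1, B.θ 0 + 1, B.θ 0]] n

variable [CharP E 2]

lemma dg_par (n : Fin 3) (i : Fin 8) : dg B n i + dg B n (par i) = 1 := by
  have h : ∀ c : E, c + (c + 1) = 1 := fun c => by rw [← add_assoc, CharTwo.add_self_eq_zero, zero_add]
  have h' : ∀ c : E, c + 1 + c = 1 := fun c => by rw [add_comm, h]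
  fin_cases n <;> fin_cases i <;> first | exact h _ | exact h' _

lemma s_dg (n : Fin 3) (a : Fin 2) (i : Fin 8) : B.s a (dg B n (pm n a i)) = dg B n i := by
  have h : (1 : E) + 1 = 0 := CharTwo.add_self_eq_zero 1
  have h0 := B.s_self 0
  have h1 := B.s_self 1
  have h01 := B.s_other 0 1 (by decide)
  have h10 := B.s_other 1 0 (by decide)
  have e1 : B.s 0 (B.θ 0 + 1) = B.θ 0 := by rw [map_add, map_one, h0, add_assoc, h, add_zero]
  have e2 : B.s 1 (B.θ 1 + 1) = B.θ 1 := by rw [map_add, map_one, h1, add_assoc, h, add_zero]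
  have e3 : B.s 0 (B.θ 1 + 1) = B.θ 1 + 1 := by rw [map_add, map_one, h01]
  have e4 : B.s 1 (B.θ 0 + 1) = B.θ 0 + 1 := by rw [map_add, map_one, h10]
  have e5 : B.s 0 (B.θ 0 + B.θ 1) = B.θ 0 + B.θ 1 + 1 := by rw [map_add, h0, h01]; ring
  have e6 : B.s 1 (B.θ 0 + B.θ 1) = B.θ 0 + B.θ 1 + 1 := by rw [map_add, h1, h10]; ring
  have e7 : ∀ a, B.s a (B.θ 0 + B.θ 1 + 1) = B.θ 0 + B.θ 1 := by
    intro a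
    rw [map_add, map_one]
    fin_cases a
    · exact (congrArg (· + 1) e5).trans (by rw [add_assoc, h, add_zero])
    · exact (congrArg (· + 1) e6).trans (by rw [add_assoc, h, add_zero])
  fin_cases n <;> fin_cases a <;> fin_cases i <;>
    first | exact h0 | exact h1 | exact h01 | exact h10 | exact e1 | exact e2 | exact e3 |
      exact e4 | exact e5 | exact e6 | exact e7 _

/-- The standard diagonal element defining the semi-trace. -/
def ell (n : Fin 3) : (tw y hy n).form B :=
  ⟨Matrix.diagonal (dg B n), fun a => by
    ext i j
    rw [Twist.τ_apply, Matrix.diagonal_apply, Matrix.diagonal_apply]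
    by_cases h : i = j
    · subst h
      rw [if_pos rfl, if_pos rfl, Twist.r_self, map_one, one_mul]
      exact s_dg B n a i
    · rw [if_neg h, if_neg fun h' => h ((tw y hy n).π_inj.1 h'), map_zero, mul_zero]⟩

lemma coe_ell (n : Fin 3) : (ell B y hy n : Mat8 E) = Matrix.diagonal (dg B n) := rfl

lemma ell_add (n : Fin 3) : ell B y hy n + (tw y hy n).σ B (ell B y hy n) = 1 := by
  refine Subtype.ext ?_
  change Matrix.diagonal (dg B n) + adj8 (Matrix.diagonal (dg B n)) = 1
  ext i j
  rw [Matrix.add_apply, adj8_apply, Matrix.diagonal_apply, Matrix.diagonal_apply, Matrix.one_apply]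
  by_cases h : i = j
  · subst h
    rw [if_pos rfl, if_pos rfl, if_pos rfl, dg_par]
  · rw [if_neg h, if_neg h, if_neg fun h' => h (par_inj.1 h').symm, add_zero]

end

noncomputable section

section span

variable {E R : Type} [Field E] [Ring R] [Algebra E R]

/-- The span of the ordered monomials in the first `k` generators. -/
def monoSpan (E : Type) {R : Type} [Field E] [Ring R] [Algebra E R] (h : ℕ → R) :
    ℕ → Submodule E R
  | 0 => E ∙ 1
  | k + 1 => monoSpan E h k ⊔ (monoSpan E h k).map (LinearMap.mulRight E (h k))

lemma one_mem_monoSpan (h : ℕ → R) : ∀ k, 1 ∈ monoSpan E h k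
  | 0 => Submodule.mem_span_singleton_self 1
  | k + 1 => le_sup_left (a := monoSpan E h k) (one_mem_monoSpan h k)

lemma finrank_monoSpan (h : ℕ → R) :
    ∀ k, Module.Finite E (monoSpan E h k) ∧ finrank E (monoSpan E h k) ≤ 2 ^ k
  | 0 => ⟨inferInstanceAs (Module.Finite E (E ∙ (1 : R))), (finrank_span_le_card {(1 : R)}).trans (by simp)⟩
  | k + 1 => by
    obtain ⟨h1, h2⟩ := finrank_monoSpan h k
    refine ⟨inferInstanceAs (Module.Finite E
      (monoSpan E h k ⊔ (monoSpan E h k).map (LinearMap.mulRight E (h k)) : Submodule E R)), ?_⟩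
    calc finrank E (monoSpan E h (k + 1))
        ≤ finrank E (monoSpan E h k) +
          finrank E ((monoSpan E h k).map (LinearMap.mulRight E (h k))) :=
          Submodule.finrank_add_le_finrank_add_finrank _ _
      _ ≤ 2 ^ k + 2 ^ k := add_le_add h2 ((Submodule.finrank_map_le _ _).trans h2)
      _ = 2 ^ (k + 1) := by ring

lemma mul_mem_monoSpan (h : ℕ → R)
    (hsq : ∀ i, ∃ a b : E, h i * h i = a • h i + b • 1)
    (hanti : ∀ i j, ∃ a b c : E, h i * h j + h j * h i = a • h i + b • h j + c • 1) :
    ∀ k j, j < k → ∀ x ∈ monoSpan E h k, x * h j ∈ monoSpan E h k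
  | 0, _, hj => absurd hj (Nat.not_lt_zero _)
  | k + 1, j, hj => by
    have ih := mul_mem_monoSpan h hsq hanti k
    have hl : ∀ x ∈ monoSpan E h k, x ∈ monoSpan E h (k + 1) := fun x hx =>
      le_sup_left (a := monoSpan E h k) hx
    have hr : ∀ x ∈ monoSpan E h k, x * h k ∈ monoSpan E h (k + 1) := fun x hx =>
      le_sup_right (a := monoSpan E h k) ⟨x, hx, rfl⟩
    intro x hx
    obtain ⟨p, hp, q, ⟨r, hr', rfl⟩, rfl⟩ := Submodule.mem_sup.1 hx
    rw [LinearMap.mulRight_apply, add_mul]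
    rcases Nat.lt_succ_iff_lt_or_eq.1 hj with hj | rfl
    · refine add_mem (hl _ (ih j hj p hp)) ?_
      obtain ⟨a, b, c, h1⟩ := hanti k j
      have h2 : r * h k * h j = a • (r * h k) + b • (r * h j) + c • r - r * h j * h k := by
        rw [mul_assoc, eq_sub_of_add_eq h1]
        simp only [mul_sub, mul_add, mul_smul_comm, mul_one, mul_assoc]
      rw [h2]
      exact sub_mem (add_mem (add_mem (Submodule.smul_mem _ _ (hr r hr'))
        (Submodule.smul_mem _ _ (hl _ (ih j hj r hr')))) (Submodule.smul_mem _ _ (hl r hr')))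
        (hr _ (ih j hj r hr'))
    · refine add_mem (hr p hp) ?_
      obtain ⟨a, b, h1⟩ := hsq j
      have h2 : r * h j * h j = a • (r * h j) + b • r := by
        rw [mul_assoc, h1, mul_add, mul_smul_comm, mul_smul_comm, mul_one]
      rw [h2]
      exact add_mem (Submodule.smul_mem _ _ (hr r hr')) (Submodule.smul_mem _ _ (hl r hr'))

/-- An algebra generated by `n` elements satisfying quadratic commutation relations has
dimension at most `2 ^ n`. -/
lemma finrank_le_of_quadratic (h : ℕ → R) (n : ℕ)
    (hsq : ∀ i, ∃ a b : E, h i * h i = a • h i + b • 1)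
    (hanti : ∀ i j, ∃ a b c : E, h i * h j + h j * h i = a • h i + b • h j + c • 1)
    (hgen : Algebra.adjoin E (h '' Set.Iio n) = ⊤) :
    Module.Finite E R ∧ finrank E R ≤ 2 ^ n := by
  have key : ∀ r ∈ Algebra.adjoin E (h '' Set.Iio n), ∀ x ∈ monoSpan E h n,
      x * r ∈ monoSpan E h n := by
    intro r hr
    induction hr using Algebra.adjoin_induction with
    | mem r hr =>
      obtain ⟨j, hj, rfl⟩ := hr
      exact fun x hx => mul_mem_monoSpan h hsq hanti n j hj x hx
    | algebraMap c =>
      intro x hx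
      rw [← Algebra.commutes, ← Algebra.smul_def]
      exact Submodule.smul_mem _ _ hx
    | add r s _ _ h1 h2 =>
      intro x hx
      rw [mul_add]
      exact add_mem (h1 x hx) (h2 x hx)
    | mul r s _ _ h1 h2 =>
      intro x hx
      rw [← mul_assoc]
      exact h2 _ (h1 x hx)
  have htop : monoSpan E h n = ⊤ := by
    refine eq_top_iff.2 fun r _ => ?_
    have := key r (hgen ▸ Algebra.mem_top) 1 (one_mem_monoSpan h n)
    rwa [one_mul] at this
  obtain ⟨h1, h2⟩ := finrank_monoSpan (E := E) h n
  rw [htop] at h1 h2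
  exact ⟨Module.Finite.equiv Submodule.topEquiv, finrank_top E R ▸ h2⟩

end span

section matrices

variable {E : Type} [Field E]

lemma exists_off : ∀ a b : Fin 8, ∃ c, (c ≠ a ∧ c ≠ par a) ∧ (b ≠ c ∧ b ≠ par c) := by
  decide +kernel

/-- The alternating matrices generate all matrices. -/
lemma eq_top_of_alternating {W : Submodule E (Mat8 E)} (hmul : ∀ x ∈ W, ∀ y ∈ W, x * y ∈ W)
    (h : ∀ a b, b ≠ a → b ≠ par a →
      Matrix.single a b (1 : E) + Matrix.single (par b) (par a) 1 ∈ W) : W = ⊤ := by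
  have sm : ∀ {i j k l : Fin 8}, j ≠ k →
      Matrix.single i j (1 : E) * Matrix.single k l 1 = 0 := fun {i j k l} h =>
    Matrix.single_mul_single_of_ne 1 i j k h 1
  have ss : ∀ {i j k : Fin 8},
      Matrix.single i j (1 : E) * Matrix.single j k 1 = Matrix.single i k 1 := by
    intro i j k
    rw [Matrix.single_mul_single_same, one_mul]
  have h1 : ∀ a c, c ≠ a → c ≠ par a → Matrix.single a c (1 : E) ∈ W := by
    intro a c hc1 hc2
    obtain ⟨b, ⟨hb1, hb2⟩, hb3, hb4⟩ := exists_off a c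
    have := hmul _ (h a b hb1 hb2) _ (h b c hb3 hb4)
    rw [add_mul, mul_add, mul_add, ss, sm, sm, sm] at this
    · simpa using this
    · exact fun h => hc1 (par_inj.1 h).symm
    · exact fun h => hb2 h.symm
    · exact fun h => hb4 (by rw [h, par_par])
  have h2 : ∀ a c, Matrix.single a c (1 : E) ∈ W := by
    intro a c
    obtain ⟨b, ⟨hb1, hb2⟩, hb3, hb4⟩ := exists_off a c
    rw [← ss (j := b)]
    exact hmul _ (h1 a b hb1 hb2) _ (h1 b c hb3 hb4)
  refine eq_top_iff.2 fun M _ => ?_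
  rw [Matrix.matrix_eq_sum_single M]
  refine sum_mem fun i _ => sum_mem fun j _ => ?_
  have : Matrix.single i j (M i j) = M i j • Matrix.single i j (1 : E) := by
    rw [Matrix.smul_single, smul_eq_mul, mul_one]
  rw [this]
  exact Submodule.smul_mem _ _ (h2 i j)

/-- The half-spin maps generate the product of two matrix algebras. -/
lemma eq_top_of_κ [CharP E 2] {S : Subalgebra E (Mat8 E × Mat8 E)}
    (h : ∀ M, (κ true M, κ false M) ∈ S) : S = ⊤ := by
  have h01 : ((0 : Mat8 E), (1 : Mat8 E)) ∈ S := by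
    have := h (∑ i ∈ {1, 5, 6, 7}, Matrix.single i i (1 : E))
    rwa [κ_sum_single, κ_sum_single, if_pos rfl, if_neg (by decide)] at this
  have h10 : ((1 : Mat8 E), (0 : Mat8 E)) ∈ S := by
    have := sub_mem S.one_mem h01
    rwa [Prod.one_eq_mk, Prod.mk_sub_mk, sub_zero, sub_self] at this
  have hr : S.toSubmodule.comap (LinearMap.inr E (Mat8 E) (Mat8 E)) = ⊤ := by
    apply eq_top_of_alternating
    · intro x hx y hy
      have := S.mul_mem hx hy
      rwa [LinearMap.inr_apply, LinearMap.inr_apply, Prod.mk_mul_mk, mul_zero] at this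
    · intro a b h1 h2
      obtain ⟨i, j, hij⟩ := exists_κ_single (E := E) false h1 h2
      have := S.mul_mem h01 (h (Matrix.single i j 1))
      rwa [hij, Prod.mk_mul_mk, zero_mul, one_mul] at this
  have hl : S.toSubmodule.comap (LinearMap.inl E (Mat8 E) (Mat8 E)) = ⊤ := by
    apply eq_top_of_alternating
    · intro x hx y hy
      have := S.mul_mem hx hy
      rwa [LinearMap.inl_apply, LinearMap.inl_apply, Prod.mk_mul_mk, mul_zero] at this
    · intro a b h1 h2
      obtain ⟨i, j, hij⟩ := exists_κ_single (E := E) true h1 h2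
      have := S.mul_mem h10 (h (Matrix.single i j 1))
      rwa [hij, Prod.mk_mul_mk, zero_mul, one_mul] at this
  refine eq_top_iff.2 fun x _ => ?_
  have h1 : x.1 ∈ S.toSubmodule.comap (LinearMap.inl E (Mat8 E) (Mat8 E)) := hl ▸ trivial
  have h2 : x.2 ∈ S.toSubmodule.comap (LinearMap.inr E (Mat8 E) (Mat8 E)) := hr ▸ trivial
  have := S.add_mem h1 h2
  rwa [LinearMap.inl_apply, LinearMap.inr_apply, Prod.mk_add_mk, add_zero, zero_add] at this

end matrices

end

noncomputable section

variable {F E : Type} [Field F] [Field E] [Algebra F E] (B : BiquadExt F E)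
variable (y : Fin 2 → F) (hy : ∀ v, y v ≠ 0)

section tensors

variable {S : Subalgebra F (Mat8 E)}

/-- The inner entries of a tensor of matrices. -/
def inner8 (S : Subalgebra F (Mat8 E)) (i l : Fin 8) : S ⊗[F] S →ₗ[F] Mat8 E :=
  TensorProduct.lift (LinearMap.mk₂ F
    (fun M N => Matrix.of fun j k => (M : Mat8 E) i j * (N : Mat8 E) k l)
    (fun M M' N => by
      ext j k
      simp [add_mul])
    (fun c M N => by
      ext j k
      simp)
    (fun M N N' => by
      ext j k
      simp [mul_add])
    (fun c M N => by
      ext j k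
      simp))

lemma inner8_tmul (i l : Fin 8) (M N : S) (j k : Fin 8) :
    inner8 S i l (M ⊗ₜ N) j k = (M : Mat8 E) i j * (N : Mat8 E) k l := rfl

lemma sand_apply (c : S ⊗[F] S) (x : S) (i l : Fin 8) :
    (sand F S c x : Mat8 E) i l = ∑ j, ∑ k, inner8 S i l c j k * (x : Mat8 E) j k := by
  induction c using TensorProduct.induction_on with
  | zero => simp
  | tmul M N =>
    change ((M : Mat8 E) * x * N) i l = _
    simp only [Matrix.mul_apply, inner8_tmul, Finset.sum_mul]
    rw [Finset.sum_comm]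
    refine Finset.sum_congr rfl fun j _ => Finset.sum_congr rfl fun k _ => ?_
    ring
  | add c d hc hd =>
    simp only [map_add, LinearMap.add_apply, Subalgebra.coe_add, Matrix.add_apply, hc, hd, add_mul,
      Finset.sum_add_distrib]

lemma lift_mu2 {S' : Subalgebra F (Mat8 E)} (s : Bool) (f : S →ₗ[F] S')
    (hf : ∀ M, (f M : Mat8 E) = κ s (M : Mat8 E)) (c : S ⊗[F] S) :
    (TensorAlgebra.lift F f (mu2 F S c) : Mat8 E) = ∑ i, ∑ l, gen E s i *
      (∑ j, ∑ k, inner8 S i l c j k • (gen E (!s) (par j) * gen E s k)) * gen E (!s) (par l) := by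
  induction c using TensorProduct.induction_on with
  | zero => simp
  | tmul M N =>
    change (TensorAlgebra.lift F f (TensorAlgebra.ι F M * TensorAlgebra.ι F N) : Mat8 E) = _
    rw [map_mul, TensorAlgebra.lift_ι_apply, TensorAlgebra.lift_ι_apply, Subalgebra.coe_mul, hf, hf]
    simp only [κ_def, Finset.sum_mul_sum]
    refine Finset.sum_congr rfl fun i _ => ?_
    refine (Finset.sum_congr rfl fun k _ => Finset.sum_comm).trans ?_
    rw [Finset.sum_comm]
    refine Finset.sum_congr rfl fun l _ => ?_
    rw [Finset.sum_comm]
    simp only [Finset.mul_sum, Finset.sum_mul]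
    refine Finset.sum_congr rfl fun j _ => Finset.sum_congr rfl fun k _ => ?_
    rw [inner8_tmul, smul_mul_smul_comm, mul_smul_comm, smul_mul_assoc]
    simp only [mul_assoc]
  | add c d hc hd =>
    simp only [map_add, Subalgebra.coe_add, Matrix.add_apply, hc, hd, add_smul, add_mul, mul_add,
      Finset.sum_add_distrib]

end tensors

variable [CharP E 2] [Module.Finite F E]

lemma adj8_inner8 {t : Twist F} {c : t.form B ⊗[F] t.form B}
    (hc : ∀ x, sand F (t.form B) c (t.σ B x) = sand F (t.form B) c x) (i l : Fin 8) :
    adj8 (inner8 (t.form B) i l c) = inner8 (t.form B) i l c := by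
  set n := inner8 (t.form B) i l c with hn
  let φ : Mat8 E → Mat8 E →ₗ[E] E := fun n =>
    { toFun := fun x => ∑ j, ∑ k, n j k * x j k
      map_add' := fun x z => by simp [mul_add, Finset.sum_add_distrib]
      map_smul' := fun c x => by
        simp only [Matrix.smul_apply, smul_eq_mul, Finset.mul_sum, RingHom.id_apply]
        exact Finset.sum_congr rfl fun _ _ => Finset.sum_congr rfl fun _ _ => by ring }
  have h : φ n ∘ₗ adj8 = φ n := t.form_ext B fun x => by
    have := sand_apply c (t.σ B x) i l
    rw [hc, sand_apply] at this
    exact this.symm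
  ext a b
  have h2 := LinearMap.congr_fun h (Matrix.single a b 1)
  have h3 : ∀ a b, φ n (Matrix.single a b 1) = n a b := by
    intro a b
    change ∑ j, ∑ k, n j k * Matrix.single a b 1 j k = n a b
    simp [Matrix.single_apply, ite_and]
  rw [LinearMap.comp_apply, adj8_single, h3, h3] at h2
  exact h2

lemma lift_spin_eq_of_rel (s : Bool) (n : Fin 3) {a b : TensorAlgebra F ((tw y hy n).form B)}
    (h : CliffordRel F ((tw y hy n).form B) ((tw y hy n).T B) ((tw y hy n).σ B) (ell B y hy n) a b) :
    TensorAlgebra.lift F (spin B y hy s n) a = TensorAlgebra.lift F (spin B y hy s n) b := by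
  cases h with
  | sym x hx =>
    refine Subtype.ext ?_
    rw [TensorAlgebra.lift_ι_apply, coe_spin, κ_symm s (dg_par B n) (congrArg Subtype.val hx),
      AlgHom.commutes]
    change _ = algebraMap F (Mat8 E) _
    rw [IsScalarTower.algebraMap_apply F E (Mat8 E), Twist.algebraMap_T, Subalgebra.coe_mul, coe_ell,
      Algebra.algebraMap_eq_smul_one]
  | deg2 c hc =>
    refine Subtype.ext ?_
    rw [TensorAlgebra.lift_ι_apply, coe_spin, lift_mu2 s _ (coe_spin B y hy s n), κ_def]
    refine Finset.sum_congr rfl fun i _ => Finset.sum_congr rfl fun l _ => ?_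
    rw [sum_gen_mul_gen s (dg_par B n) (adj8_inner8 B hc i l), sand_apply, mul_smul_comm, mul_one,
      smul_mul_assoc]
    congr 1
    refine Finset.sum_congr rfl fun j _ => ?_
    rw [coe_ell, Finset.sum_eq_single j]
    · rw [Matrix.diagonal_apply_eq, mul_comm]
    · intro k _ hk
      rw [Matrix.diagonal_apply_ne _ hk.symm, mul_zero]
    · exact fun h => absurd (Finset.mem_univ _) h

/-- The projections of the Clifford algebra to its components. -/
def proj (s : Bool) (n : Fin 3) :
    CliffordAlg F ((tw y hy n).form B) ((tw y hy n).T B) ((tw y hy n).σ B) (ell B y hy n) →ₐ[F]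
      (tw y hy (tgt s n)).form B :=
  RingQuot.liftAlgHom F ⟨TensorAlgebra.lift F (spin B y hy s n),
    fun _ _ h => lift_spin_eq_of_rel B y hy s n h⟩

lemma proj_cliffGen (s : Bool) (n : Fin 3) (a : (tw y hy n).form B) :
    proj B y hy s n (cliffGen F _ _ _ _ a) = spin B y hy s n a :=
  (RingQuot.liftAlgHom_mkAlgHom_apply _ _ _ _).trans (TensorAlgebra.lift_ι_apply _ _)

end

noncomputable section

section clifford

variable {F : Type} [CommRing F] (A : Type) [Ring A] [Algebra F A] (T : A →ₗ[F] F)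
  (σ : A →ₗ[F] A) (ℓ : A)

/-- The quotient map from the tensor algebra to the Clifford algebra. -/
def cliffMk : TensorAlgebra F A →ₐ[F] CliffordAlg F A T σ ℓ :=
  RingQuot.mkAlgHom F (CliffordRel F A T σ ℓ)

/-- The canonical linear map to the Clifford algebra. -/
def cliffLin : A →ₗ[F] CliffordAlg F A T σ ℓ :=
  (cliffMk A T σ ℓ).toLinearMap ∘ₗ TensorAlgebra.ι F

lemma cliffLin_apply (a : A) : cliffLin A T σ ℓ a = cliffGen F A T σ ℓ a := rfl

lemma cliffLin_symm {s : A} (hs : σ s = s) :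
    cliffLin A T σ ℓ s = algebraMap F _ (T (ℓ * s)) :=
  (RingQuot.mkAlgHom_rel F (CliffordRel.sym s hs)).trans (AlgHom.commutes _ _)

lemma cliffMk_mu2 {c : A ⊗[F] A} (hc : ∀ x, sand F A c (σ x) = sand F A c x) :
    cliffMk A T σ ℓ (mu2 F A c) = cliffLin A T σ ℓ (sand F A c ℓ) :=
  RingQuot.mkAlgHom_rel F (CliffordRel.deg2 c hc)

lemma adjoin_cliffLin :
    Algebra.adjoin F (Set.range (cliffLin A T σ ℓ)) = ⊤ := by
  have h : Set.range (cliffLin A T σ ℓ) = cliffMk A T σ ℓ '' Set.range (TensorAlgebra.ι F) :=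
    Set.range_comp (cliffMk A T σ ℓ) (TensorAlgebra.ι F)
  rw [h, ← AlgHom.map_adjoin, TensorAlgebra.adjoin_range_ι, Algebra.map_top]
  exact (AlgHom.range_eq_top _).2 (RingQuot.mkAlgHom_surjective _ _)

end clifford

variable {F E : Type} [Field F] [Field E] [Algebra F E] (B : BiquadExt F E)
variable [CharP E 2] [Module.Finite F E] (t : Twist F) (ℓ : t.form B)

/-- The Clifford algebra after scalar extension. -/
abbrev CliffE : Type := E ⊗[F] CliffordAlg F (t.form B) (t.T B) (t.σ B) ℓ

/-- The canonical linear map to the Clifford algebra after scalar extension. -/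
def cliffE : Mat8 E →ₗ[E] CliffE B t ℓ :=
  (cliffLin (t.form B) (t.T B) (t.σ B) ℓ).baseChange E ∘ₗ (t.splitting B).symm.toLinearMap

lemma cliffE_coe (M : t.form B) :
    cliffE B t ℓ M = 1 ⊗ₜ cliffLin (t.form B) (t.T B) (t.σ B) ℓ M := by
  have h : (t.splitting B).symm (M : Mat8 E) = 1 ⊗ₜ M := by
    rw [AlgEquiv.symm_apply_eq, t.splitting_tmul, one_smul]
  change (cliffLin (t.form B) (t.T B) (t.σ B) ℓ).baseChange E ((t.splitting B).symm (M : Mat8 E)) = _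
  rw [h, LinearMap.baseChange_tmul]

lemma exists_mat_decomp (M : Mat8 E) :
    ∃ u : Fin 4 → t.form B, M = ∑ k, B.e k • (u k : Mat8 E) := by
  obtain ⟨u, hu, -, h⟩ := (t.descent B).exists_decomp ⊤ (fun _ _ _ => trivial) M trivial
  exact ⟨fun k => ⟨u k, hu k⟩, h⟩

lemma cliffE_symm {N : Mat8 E} (hN : adj8 N = N) :
    cliffE B t ℓ N = ((ℓ : Mat8 E) * N).trace • 1 := by
  obtain ⟨u, hu, h1, h⟩ := (t.descent B).exists_decomp (LinearMap.ker (adj8 - LinearMap.id))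
    (fun a M hM => by
      rw [LinearMap.mem_ker, LinearMap.sub_apply, LinearMap.id_apply, sub_eq_zero] at hM ⊢
      rw [← t.τ_adj8, hM]) N (by
      rw [LinearMap.mem_ker, LinearMap.sub_apply, LinearMap.id_apply, sub_eq_zero, hN])
  rw [h, map_sum, Finset.mul_sum, Matrix.trace_sum, Finset.sum_smul]
  refine Finset.sum_congr rfl fun k _ => ?_
  have h2 : t.σ B ⟨u k, hu k⟩ = ⟨u k, hu k⟩ := by
    refine Subtype.ext ?_
    have := h1 k
    rwa [LinearMap.mem_ker, LinearMap.sub_apply, LinearMap.id_apply, sub_eq_zero] at this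
  rw [map_smul, cliffE_coe B t ℓ ⟨u k, hu k⟩, cliffLin_symm _ _ _ _ h2, mul_smul_comm, Matrix.trace_smul,
    smul_assoc]
  congr 1
  have h3 := t.algebraMap_T B (ℓ * ⟨u k, hu k⟩)
  rw [Subalgebra.coe_mul] at h3
  rw [← h3, Algebra.algebraMap_eq_smul_one, TensorProduct.tmul_smul, algebraMap_smul]
  rfl

lemma cliffE_mul {M N : Mat8 E} (h : ∀ x, M * adj8 x * N = M * x * N) :
    cliffE B t ℓ M * cliffE B t ℓ N = cliffE B t ℓ (M * ℓ * N) := by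
  obtain ⟨u, rfl⟩ := exists_mat_decomp B t M
  obtain ⟨v, rfl⟩ := exists_mat_decomp B t N
  choose m hm using fun a b => B.exists_coeff (B.e a * B.e b)
  let c : Fin 4 → t.form B ⊗[F] t.form B := fun r => ∑ a, ∑ b, m a b r • (u a ⊗ₜ v b)
  have key : ∀ {V : Type} [AddCommGroup V] [Module E V] [Module F V] [IsScalarTower F E V]
      (p : Fin 4 → Fin 4 → V), ∑ r, B.e r • ∑ a, ∑ b, m a b r • p a b =
        ∑ a, ∑ b, (B.e a * B.e b) • p a b := by
    intro V _ _ _ _ p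
    simp only [Finset.smul_sum]
    rw [Finset.sum_comm]
    refine Finset.sum_congr rfl fun a _ => ?_
    rw [Finset.sum_comm]
    refine Finset.sum_congr rfl fun b _ => ?_
    rw [hm a b, Finset.sum_smul]
    refine Finset.sum_congr rfl fun r _ => ?_
    rw [smul_assoc, smul_comm]
  have hs : ∀ r x, (sand F (t.form B) (c r) x : Mat8 E) =
      ∑ a, ∑ b, m a b r • ((u a : Mat8 E) * x * v b) := by
    intro r x
    simp only [c, map_sum, map_smul, LinearMap.sum_apply, LinearMap.smul_apply]
    rw [AddSubmonoidClass.coe_finsetSum]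
    refine Finset.sum_congr rfl fun a _ => ?_
    rw [AddSubmonoidClass.coe_finsetSum]
    rfl
  have hx : ∀ x, ∑ r, B.e r • (sand F (t.form B) (c r) x : Mat8 E) =
      (∑ k, B.e k • (u k : Mat8 E)) * x * ∑ k, B.e k • (v k : Mat8 E) := by
    intro x
    simp only [hs]
    rw [key, Finset.sum_mul, Finset.sum_mul_sum]
    refine Finset.sum_congr rfl fun a _ => Finset.sum_congr rfl fun b _ => ?_
    rw [smul_mul_assoc, smul_mul_smul_comm]
  have hc : ∀ r x, sand F (t.form B) (c r) (t.σ B x) = sand F (t.form B) (c r) x := by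
    intro r x
    rw [← sub_eq_zero]
    have h0 : ∑ k, B.e k • ((sand F (t.form B) (c k) (t.σ B x) - sand F (t.form B) (c k) x :
        t.form B) : Mat8 E) = 0 := by
      simp only [Subalgebra.coe_sub, smul_sub, Finset.sum_sub_distrib]
      rw [hx, hx, Twist.coe_σ, h, sub_self]
    exact Subtype.ext ((t.descent B).eq_zero_of_sum _ (fun k a => Subtype.property
      (sand F (t.form B) (c k) (t.σ B x) - sand F (t.form B) (c k) x) a) h0 r)
  rw [← hx, map_sum, map_sum, map_sum, Finset.sum_mul_sum]
  simp only [map_smul, cliffE_coe, smul_mul_smul_comm, Algebra.TensorProduct.tmul_mul_tmul, one_mul]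
  rw [← key]
  refine Finset.sum_congr rfl fun r _ => ?_
  rw [← cliffMk_mu2 _ _ _ _ (hc r)]
  congr 1
  rw [map_sum, map_sum, TensorProduct.tmul_sum]
  refine Finset.sum_congr rfl fun a _ => ?_
  rw [map_sum, map_sum, TensorProduct.tmul_sum]
  refine Finset.sum_congr rfl fun b _ => ?_
  rw [map_smul, map_smul, TensorProduct.tmul_smul]
  congr 2
  exact (map_mul (cliffMk (t.form B) (t.T B) (t.σ B) ℓ) (TensorAlgebra.ι F (u a))
    (TensorAlgebra.ι F (v b))).symm

lemma adjoin_cliffE : Algebra.adjoin E (Set.range (cliffE B t ℓ)) = ⊤ := by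
  have h : ∀ c : CliffordAlg F (t.form B) (t.T B) (t.σ B) ℓ,
      (1 : E) ⊗ₜ[F] c ∈ Algebra.adjoin E (Set.range (cliffE B t ℓ)) := by
    intro c
    have hc : c ∈ Algebra.adjoin F (Set.range (cliffLin (t.form B) (t.T B) (t.σ B) ℓ)) :=
      adjoin_cliffLin (t.form B) (t.T B) (t.σ B) ℓ ▸ Algebra.mem_top
    induction hc using Algebra.adjoin_induction with
    | mem c hc =>
      obtain ⟨M, rfl⟩ := hc
      rw [← cliffE_coe]
      exact Algebra.subset_adjoin ⟨_, rfl⟩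
    | algebraMap f =>
      rw [Algebra.algebraMap_eq_smul_one, ← TensorProduct.smul_tmul, ← mul_one (f • (1 : E)),
        ← smul_eq_mul (f • (1 : E)), ← TensorProduct.smul_tmul']
      exact Subalgebra.smul_mem _ (Subalgebra.one_mem _) _
    | add c d _ _ hc hd =>
      rw [TensorProduct.tmul_add]
      exact Subalgebra.add_mem _ hc hd
    | mul c d _ _ hc hd =>
      rw [← one_mul (1 : E), ← Algebra.TensorProduct.tmul_mul_tmul]
      exact Subalgebra.mul_mem _ hc hd
  refine eq_top_iff.2 fun x _ => ?_
  induction x using TensorProduct.induction_on with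
  | zero => exact Subalgebra.zero_mem _
  | tmul e c =>
    rw [← mul_one e, ← smul_eq_mul e, ← TensorProduct.smul_tmul']
    exact Subalgebra.smul_mem _ (h c) _
  | add c d hc hd => exact Subalgebra.add_mem _ (hc trivial) (hd trivial)

end

noncomputable section

section rank_one

variable {E : Type} [Field E]

/-- The rank one matrix attached to two vectors by the hyperbolic polar form. -/
def rk (u v : Fin 8 → E) : Mat8 E := Matrix.of fun i j => u i * v (par j)

lemma rk_apply (u v : Fin 8 → E) (i j : Fin 8) : rk u v i j = u i * v (par j) := rfl

lemma adj8_rk (u v : Fin 8 → E) : adj8 (rk u v) = rk v u := by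
  ext i j
  rw [adj8_apply, rk_apply, rk_apply, par_par, mul_comm]

lemma rk_add_right (u v v' : Fin 8 → E) : rk u (v + v') = rk u v + rk u v' := by
  ext i j
  simp [rk_apply, mul_add]

lemma rk_smul_right (u : Fin 8 → E) (c : E) (v : Fin 8 → E) : rk u (c • v) = c • rk u v := by
  ext i j
  simp [rk_apply, mul_left_comm]

lemma rk_mul_mul_rk (u v v' w : Fin 8 → E) (x : Mat8 E) :
    rk u v * x * rk v' w = (∑ j, ∑ k, v (par j) * x j k * v' k) • rk u w := by
  ext i l
  simp only [Matrix.mul_apply, rk_apply, Matrix.smul_apply, smul_eq_mul, Finset.sum_mul]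
  rw [Finset.sum_comm]
  exact Finset.sum_congr rfl fun j _ => Finset.sum_congr rfl fun k _ => by ring

lemma rk_mul_rk (u v v' w : Fin 8 → E) : rk u v * rk v' w = bil v v' • rk u w := by
  ext i l
  simp only [Matrix.mul_apply, rk_apply, Matrix.smul_apply, smul_eq_mul, bil, Finset.sum_mul]
  rw [← sum_par]
  exact Finset.sum_congr rfl fun j _ => by rw [par_par]; ring

lemma rk_mul_adj8_mul_rk (u v w : Fin 8 → E) (x : Mat8 E) :
    rk u v * adj8 x * rk v w = rk u v * x * rk v w := by
  rw [rk_mul_mul_rk, rk_mul_mul_rk]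
  congr 1
  rw [Finset.sum_comm, ← sum_par]
  refine Finset.sum_congr rfl fun j _ => ?_
  rw [← sum_par]
  refine Finset.sum_congr rfl fun k _ => ?_
  rw [adj8_apply, par_par, par_par]
  ring

lemma sum_par_mul {d : Fin 8 → E} (hd : ∀ i, d i + d (par i) = 1) (u : Fin 8 → E) :
    ∑ i, u (par i) * d i * u i = quad u := by
  have h : par 0 = 1 ∧ par 1 = 0 ∧ par 2 = 5 ∧ par 3 = 6 ∧ par 4 = 7 ∧ par 5 = 2 ∧ par 6 = 3 ∧
    par 7 = 4 := by decide
  obtain ⟨h0, h1, h2, h3, h4, h5, h6, h7⟩ := h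
  have e0 := hd 0
  have e2 := hd 2
  have e3 := hd 3
  have e4 := hd 4
  simp only [h0, h1, h2, h3, h4, h5, h6, h7, Fin.sum_univ_eight, quad] at e0 e2 e3 e4 ⊢
  linear_combination u 0 * u 1 * e0 + u 2 * u 5 * e2 + u 3 * u 6 * e3 + u 4 * u 7 * e4

lemma rk_mul_diagonal_mul_rk {d : Fin 8 → E} (hd : ∀ i, d i + d (par i) = 1) (u v w : Fin 8 → E) :
    rk u v * Matrix.diagonal d * rk v w = quad v • rk u w := by
  rw [rk_mul_mul_rk, ← sum_par_mul hd]
  congr 1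
  refine Finset.sum_congr rfl fun j _ => ?_
  rw [Finset.sum_eq_single j]
  · rw [Matrix.diagonal_apply_eq]
  · intro k _ hk
    rw [Matrix.diagonal_apply_ne _ hk.symm, mul_zero, zero_mul]
  · exact fun h => absurd (Finset.mem_univ _) h

lemma trace_diagonal_mul_rk (d : Fin 8 → E) (u v : Fin 8 → E) :
    (Matrix.diagonal d * rk u v).trace = ∑ i, v (par i) * d i * u i := by
  simp only [Matrix.trace, Matrix.diag_apply, Matrix.diagonal_mul, rk_apply]
  exact Finset.sum_congr rfl fun i _ => by ring

lemma trace_diagonal_mul_rk_add {d : Fin 8 → E} (hd : ∀ i, d i + d (par i) = 1)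
    (u v : Fin 8 → E) : (Matrix.diagonal d * (rk u v + rk v u)).trace = bil u v := by
  rw [mul_add, Matrix.trace_add, trace_diagonal_mul_rk, trace_diagonal_mul_rk, bil,
    ← sum_par fun i => u (par i) * d i * v i, ← Finset.sum_add_distrib]
  refine Finset.sum_congr rfl fun i _ => ?_
  rw [par_par]
  linear_combination u i * v (par i) * hd i

lemma single_eq_rk (i j : Fin 8) :
    Matrix.single i j (1 : E) = rk (Pi.single i 1) (Pi.single (par j) 1) := by
  ext a b
  simp only [Matrix.single_apply, rk_apply, Pi.single_apply, par_inj]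
  by_cases h1 : a = i
  · by_cases h2 : b = j
    · simp [h1, h2]
    · simp [h1, h2, Ne.symm h2]
  · simp [h1, Ne.symm h1]

end rank_one

variable {F E : Type} [Field F] [Field E] [Algebra F E] (B : BiquadExt F E)
variable [CharP E 2] [Module.Finite F E] (t : Twist F) {ℓ : t.form B} {d : Fin 8 → E}

lemma cliffE_rk_mul_rk (hl : (ℓ : Mat8 E) = Matrix.diagonal d) (hd : ∀ i, d i + d (par i) = 1)
    (u v w : Fin 8 → E) :
    cliffE B t ℓ (rk u v) * cliffE B t ℓ (rk v w) = quad v • cliffE B t ℓ (rk u w) := by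
  rw [cliffE_mul B t ℓ (rk_mul_adj8_mul_rk u v w), hl, rk_mul_diagonal_mul_rk hd, map_smul]

lemma cliffE_rk_add_rk (hl : (ℓ : Mat8 E) = Matrix.diagonal d) (hd : ∀ i, d i + d (par i) = 1)
    (u v : Fin 8 → E) : cliffE B t ℓ (rk u v) + cliffE B t ℓ (rk v u) = bil u v • 1 := by
  rw [← map_add, cliffE_symm B t ℓ (by rw [map_add, adj8_rk, adj8_rk, add_comm]), hl,
    trace_diagonal_mul_rk_add hd]

lemma cliffE_rk_self (hl : (ℓ : Mat8 E) = Matrix.diagonal d) (hd : ∀ i, d i + d (par i) = 1)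
    (u : Fin 8 → E) : cliffE B t ℓ (rk u u) = quad u • 1 := by
  rw [cliffE_symm B t ℓ (adj8_rk u u), hl, trace_diagonal_mul_rk, sum_par_mul hd]

/-- A vector on which the hyperbolic form takes the value one. -/
def unitVec (E : Type) [Field E] : Fin 8 → E := Pi.single 0 1 + Pi.single 1 1

lemma quad_unitVec : quad (unitVec E) = 1 := by
  simp [quad, unitVec]

/-- The images of the rank one matrices with fixed first vector. -/
def cliffH (ℓ : t.form B) : (Fin 8 → E) →ₗ[E] CliffE B t ℓ :=
  cliffE B t ℓ ∘ₗ
    { toFun := rk (unitVec E)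
      map_add' := rk_add_right _
      map_smul' := rk_smul_right _ }

lemma cliffE_rk (hl : (ℓ : Mat8 E) = Matrix.diagonal d) (hd : ∀ i, d i + d (par i) = 1)
    (u w : Fin 8 → E) : cliffE B t ℓ (rk u w) =
      (bil u (unitVec E) • 1 - cliffH B t ℓ u) * cliffH B t ℓ w := by
  have h := cliffE_rk_mul_rk B t hl hd u (unitVec E) w
  rw [quad_unitVec, one_smul] at h
  rw [← h, ← cliffE_rk_add_rk B t hl hd u (unitVec E)]
  exact congrArg (· * cliffE B t ℓ (rk (unitVec E) w)) (eq_sub_of_add_eq rfl)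

lemma cliffH_sq (hl : (ℓ : Mat8 E) = Matrix.diagonal d) (hd : ∀ i, d i + d (par i) = 1)
    (u : Fin 8 → E) : cliffH B t ℓ u * cliffH B t ℓ u =
      bil u (unitVec E) • cliffH B t ℓ u - quad u • 1 := by
  have h := cliffE_rk B t hl hd u u
  rw [cliffE_rk_self B t hl hd, sub_mul, smul_mul_assoc, one_mul] at h
  rw [h, sub_sub_cancel]

lemma bil_add_left (u v w : Fin 8 → E) : bil (u + v) w = bil u w + bil v w := by
  simp [bil, add_mul, Finset.sum_add_distrib]

lemma cliffH_anti (hl : (ℓ : Mat8 E) = Matrix.diagonal d) (hd : ∀ i, d i + d (par i) = 1)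
    (u w : Fin 8 → E) : cliffH B t ℓ u * cliffH B t ℓ w + cliffH B t ℓ w * cliffH B t ℓ u =
      bil w (unitVec E) • cliffH B t ℓ u + bil u (unitVec E) • cliffH B t ℓ w +
        (-bil u w) • 1 := by
  have h := cliffH_sq B t hl hd (u + w)
  have h1 := cliffH_sq B t hl hd u
  have h2 := cliffH_sq B t hl hd w
  rw [map_add, mul_add, add_mul, add_mul, h1, h2, quad_add, bil_add_left] at h
  have h3 : cliffH B t ℓ u * cliffH B t ℓ w + cliffH B t ℓ w * cliffH B t ℓ u =
    (bil u (unitVec E) • cliffH B t ℓ u - quad u • 1 + cliffH B t ℓ w * cliffH B t ℓ u +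
      (cliffH B t ℓ u * cliffH B t ℓ w + (bil w (unitVec E) • cliffH B t ℓ w - quad w • 1))) -
      (bil u (unitVec E) • cliffH B t ℓ u - quad u • 1) -
      (bil w (unitVec E) • cliffH B t ℓ w - quad w • 1) := by abel
  rw [h3, h]
  simp only [add_smul, smul_add, neg_smul]
  abel

lemma cliffH_unitVec (hl : (ℓ : Mat8 E) = Matrix.diagonal d) (hd : ∀ i, d i + d (par i) = 1) :
    cliffH B t ℓ (unitVec E) = 1 :=
  (cliffE_rk_self B t hl hd _).trans (by rw [quad_unitVec, one_smul])

/-- The dimension of the Clifford algebra is at most 128. -/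
lemma finrank_CliffE_le (hl : (ℓ : Mat8 E) = Matrix.diagonal d)
    (hd : ∀ i, d i + d (par i) = 1) :
    Module.Finite E (CliffE B t ℓ) ∧ finrank E (CliffE B t ℓ) ≤ 128 := by
  let h : ℕ → CliffE B t ℓ := fun k => cliffH B t ℓ (Pi.single (Fin.ofNat 8 (k + 1)) 1)
  have hsq : ∀ u, ∃ a b : E, cliffH B t ℓ u * cliffH B t ℓ u = a • cliffH B t ℓ u + b • 1 :=
    fun u => ⟨bil u (unitVec E), -quad u, (cliffH_sq B t hl hd u).trans (by rw [neg_smul, ← sub_eq_add_neg])⟩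
  refine finrank_le_of_quadratic h 7 (fun i => hsq _) (fun i j => ⟨_, _, _,
    cliffH_anti B t hl hd _ _⟩) ?_
  · set S := Algebra.adjoin E (h '' Set.Iio 7) with hS
    have h1 : ∀ i : Fin 8, cliffH B t ℓ (Pi.single i 1) ∈ S := by
      have hk : ∀ i : Fin 8, i ≠ 0 → cliffH B t ℓ (Pi.single i 1) ∈ S := by
        intro i hi
        have hi' : (i : ℕ) ≠ 0 := fun h => hi (Fin.ext h)
        have : h (i - 1) = cliffH B t ℓ (Pi.single i 1) := by
          have : Fin.ofNat 8 ((i : ℕ) - 1 + 1) = i := by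
            rw [Nat.sub_add_cancel (Nat.one_le_iff_ne_zero.2 hi')]
            exact Fin.ext (Nat.mod_eq_of_lt i.2)
          change cliffH B t ℓ (Pi.single (Fin.ofNat 8 ((i : ℕ) - 1 + 1)) 1) = _
          rw [this]
        rw [← this]
        exact Algebra.subset_adjoin ⟨i - 1, by rw [Set.mem_Iio]; omega, rfl⟩
      intro i
      by_cases hi : i = 0
      · have h2 := cliffH_unitVec B t hl hd
        rw [unitVec, map_add] at h2
        rw [hi, eq_sub_of_add_eq h2]
        exact sub_mem S.one_mem (hk 1 (by decide))
      · exact hk i hi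
    have h2 : ∀ i j, cliffE B t ℓ (Matrix.single i j 1) ∈ S := by
      intro i j
      rw [single_eq_rk, cliffE_rk B t hl hd]
      exact S.mul_mem (sub_mem (S.smul_mem S.one_mem _) (h1 i)) (h1 _)
    rw [← top_le_iff, ← adjoin_cliffE B t ℓ, Algebra.adjoin_le_iff]
    rintro _ ⟨M, rfl⟩
    rw [Matrix.matrix_eq_sum_single M, map_sum]
    refine S.sum_mem fun i _ => ?_
    rw [map_sum]
    refine S.sum_mem fun j _ => ?_
    have : Matrix.single i j (M i j) = M i j • Matrix.single i j (1 : E) := by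
      rw [Matrix.smul_single, smul_eq_mul, mul_one]
    rw [this, map_smul]
    exact S.smul_mem (h2 i j) _

variable (y : Fin 2 → F) (hy : ∀ v, y v ≠ 0)

/-- The Clifford algebra after scalar extension maps to the product of two matrix algebras. -/
def cliffSplit (n : Fin 3) : CliffE B (tw y hy n) (ell B y hy n) →ₐ[E] Mat8 E × Mat8 E :=
  Algebra.TensorProduct.lift (Algebra.ofId E _)
    (((tw y hy (tgt true n)).form B).val.comp (proj B y hy true n) |>.prod
      (((tw y hy (tgt false n)).form B).val.comp (proj B y hy false n)))
    fun c _ => Algebra.commutes c _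

lemma cliffSplit_one_tmul (n : Fin 3) (c) : cliffSplit B y hy n (1 ⊗ₜ c) =
    ((proj B y hy true n c : Mat8 E), (proj B y hy false n c : Mat8 E)) := by
  refine (Algebra.TensorProduct.lift_tmul _ _ _ _ _).trans ?_
  rw [map_one, one_mul]
  rfl

lemma cliffSplit_cliffE (n : Fin 3) (M : Mat8 E) :
    cliffSplit B y hy n (cliffE B _ _ M) = (κ true M, κ false M) := by
  refine LinearMap.congr_fun (f := (cliffSplit B y hy n).toLinearMap ∘ₗ cliffE B _ _)
    (g := (κ true).prod (κ false)) ((tw y hy n).form_ext B fun N => ?_) M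
  rw [LinearMap.comp_apply, cliffE_coe]
  refine (cliffSplit_one_tmul B y hy n _).trans ?_
  rw [cliffLin_apply, proj_cliffGen, proj_cliffGen]
  rfl

lemma cliffSplit_surjective (n : Fin 3) : Function.Surjective (cliffSplit B y hy n) := by
  rw [← AlgHom.range_eq_top]
  exact eq_top_of_κ fun M => ⟨_, cliffSplit_cliffE B y hy n M⟩

lemma cliffSplit_injective (n : Fin 3) : Function.Injective (cliffSplit B y hy n) := by
  obtain ⟨h1, h2⟩ := finrank_CliffE_le B (tw y hy n) (coe_ell B y hy n) (dg_par B n)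
  have h3 : finrank E (Mat8 E × Mat8 E) = 128 := by
    rw [Module.finrank_prod, Module.finrank_matrix]
    simp
  have h4 := (cliffSplit B y hy n).toLinearMap.finrank_le_finrank_of_surjective
    (cliffSplit_surjective B y hy n)
  exact (LinearMap.injective_iff_surjective_of_finrank_eq_finrank
    (f := (cliffSplit B y hy n).toLinearMap) (le_antisymm (h3 ▸ h2) h4)).2
    (cliffSplit_surjective B y hy n)

/-- The Clifford algebra of a member of the triple is the product of the two others. -/
lemma exists_cliffordAlg_equiv (n : Fin 3) :
    ∃ φ : CliffordAlg F ((tw y hy n).form B) ((tw y hy n).T B) ((tw y hy n).σ B) (ell B y hy n) ≃ₐ[F]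
      ((tw y hy (tgt true n)).form B × (tw y hy (tgt false n)).form B),
      ∀ a, φ (cliffGen F _ _ _ _ a) = (spin B y hy true n a, spin B y hy false n a) := by
  let φ := (proj B y hy true n).prod (proj B y hy false n)
  have hinj : Function.Injective φ := by
    intro a b hab
    have h1 : cliffSplit B y hy n (1 ⊗ₜ a) = cliffSplit B y hy n (1 ⊗ₜ b) := by
      rw [cliffSplit_one_tmul, cliffSplit_one_tmul]
      exact Prod.ext (congrArg (fun p => (p.1 : Mat8 E)) hab)
        (congrArg (fun p => (p.2 : Mat8 E)) hab)
    have h2 := cliffSplit_injective B y hy n h1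
    exact Algebra.TensorProduct.includeRight_injective (R := F) (A := E)
      (FaithfulSMul.algebraMap_injective F E) h2
  have hf : ∀ m, Module.Finite F ((tw y hy m).form B) := fun m =>
    Module.finite_of_finrank_pos (by rw [Twist.finrank_form]; norm_num)
  have h0 := hf (tgt true n)
  have h0' := hf (tgt false n)
  have : Module.Finite F (CliffordAlg F ((tw y hy n).form B) ((tw y hy n).T B) ((tw y hy n).σ B)
    (ell B y hy n)) := Module.Finite.of_injective φ.toLinearMap hinj
  have hd : finrank F (CliffordAlg F ((tw y hy n).form B) ((tw y hy n).T B) ((tw y hy n).σ B)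
      (ell B y hy n)) =
      finrank F ((tw y hy (tgt true n)).form B × (tw y hy (tgt false n)).form B) := by
    rw [← Module.finrank_baseChange (R := E), LinearEquiv.finrank_eq (LinearEquiv.ofBijective
      (cliffSplit B y hy n).toLinearMap ⟨cliffSplit_injective B y hy n,
        cliffSplit_surjective B y hy n⟩), Module.finrank_prod, Module.finrank_prod,
      Module.finrank_matrix, Twist.finrank_form, Twist.finrank_form]
    simp
  have hsurj : Function.Surjective φ :=
    (LinearMap.injective_iff_surjective_of_finrank_eq_finrank (f := φ.toLinearMap) hd).1 hinj
  refine ⟨AlgEquiv.ofBijective φ ⟨hinj, hsurj⟩, fun a => ?_⟩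
  exact Prod.ext (proj_cliffGen B y hy true n a) (proj_cliffGen B y hy false n a)

end

noncomputable section

/-- An algebra of dimension 64 whose underlying division algebra has degree `d`. -/
def HasIndex (F A : Type) [Field F] [Ring A] [Algebra F A] (d : ℕ) : Prop :=
  ∃ (k : ℕ) (D : Type) (_ : DivisionRing D) (_ : Algebra F D), k * d = 8 ∧ IsCSA F D ∧
    finrank F D = d * d ∧ Nonempty (A ≃ₐ[F] Matrix (Fin k) (Fin k) D)

namespace HasIndex

variable {F A : Type} [Field F] [Ring A] [Algebra F A] {d : ℕ}

lemma schurIndex (h : HasIndex F A d) : schurIndex F A = d := by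
  obtain ⟨k, D, _, _, hk, hD, hd, ⟨e⟩⟩ := h
  have h0 : 0 < k * d := by rw [hk]; norm_num
  exact schurIndex_eq hD hd (Nat.pos_of_mul_pos_left h0) (Nat.pos_of_mul_pos_right h0) e

lemma exists_idempotent (h : HasIndex F A d) (I : Submodule F A) (hI : IsRightIdeal F A I)
    (h0 : I ≠ ⊥) : ∃ ε ∈ I, ε * ε = ε ∧
      finrank F (LinearMap.range (LinearMap.mulLeft F ε)) = 8 * d := by
  obtain ⟨k, D, _, _, hk, hD, hd, ⟨e⟩⟩ := h
  have := hD.2.2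
  rw [← hk, mul_assoc, ← hd]
  exact Triality.exists_idempotent e I hI h0

lemma le_finrank (h : HasIndex F A d) (I : Submodule F A) (hI : IsRightIdeal F A I)
    (h0 : I ≠ ⊥) : 8 * d ≤ finrank F I := by
  obtain ⟨k, D, _, _, hk, hD, hd, ⟨e⟩⟩ := h
  have := hD.2.2
  rw [← hk, mul_assoc, ← hd]
  exact le_finrank_of_isRightIdeal e I hI h0

lemma isCSA (h : HasIndex F A d) (hc : Algebra.IsCentral F A) : IsCSA F A := by
  obtain ⟨k, D, _, _, hk, hD, hd, ⟨e⟩⟩ := h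
  have := hD.2.2
  have h0 : k ≠ 0 := by
    rintro rfl
    simp at hk
  have : NeZero k := ⟨h0⟩
  have hs : IsSimpleRing (Matrix (Fin k) (Fin k) D) := inferInstance
  exact ⟨hc, IsSimpleRing.of_ringEquiv e.symm.toRingEquiv hs,
    Module.Finite.equiv e.symm.toLinearEquiv⟩

end HasIndex

section rep

variable {F A W D : Type} [Field F] [Ring A] [Algebra F A] [Ring D] [Algebra F D]
  [AddCommGroup W] [Module F W] [Module.Finite F W] [NoZeroDivisors D] [Module.Finite F D]
  [Module.Finite F A]

lemma isCentral_of_matrix {k : ℕ} (hk : k ≠ 0) {D : Type} [Ring D] [Algebra F D]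
    (hc : Algebra.IsCentral F A) (e : A ≃ₐ[F] Matrix (Fin k) (Fin k) D) :
    Algebra.IsCentral F D := by
  refine ⟨fun z hz => ?_⟩
  rw [Subalgebra.mem_center_iff] at hz
  have h1 : e.symm (Matrix.diagonal fun _ => z) ∈ Subalgebra.center F A := by
    rw [Subalgebra.mem_center_iff]
    intro b
    apply e.injective
    rw [map_mul, map_mul, e.apply_symm_apply]
    ext i j
    rw [Matrix.mul_diagonal, Matrix.diagonal_mul, hz]
  obtain ⟨f, hf⟩ := hc.out h1
  refine ⟨f, ?_⟩
  have h2 := congrArg e hf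
  rw [e.apply_symm_apply] at h2
  have h3 := congrFun (congrFun h2 ⟨0, Nat.pos_of_ne_zero hk⟩) ⟨0, Nat.pos_of_ne_zero hk⟩
  rw [Matrix.diagonal_apply_eq] at h3
  rw [← h3]
  change _ = e (algebraMap F A f) _ _
  rw [e.commutes, Matrix.algebraMap_matrix_apply, if_pos rfl]
  rfl

/-- A faithful module with commuting action of a division algebra determines the index. -/
lemma hasIndex_of_rep [Nontrivial D] (hc : Algebra.IsCentral F A) (hA : finrank F A = 64) {d : ℕ}
    (hd : finrank F D = d * d) (hd8 : d ∣ 8)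
    (μ : D →ₐ[F] Module.End F W) (ρ : A →ₐ[F] Module.End F W) (hρ : Function.Injective ρ)
    (hcomm : ∀ q a, μ q * ρ a = ρ a * μ q) (hW : finrank F W = 8 * d) : HasIndex F A d := by
  obtain ⟨k, hk⟩ := hd8
  have hd0 : 0 < d := Nat.pos_of_ne_zero (by rintro rfl; simp at hk)
  have : IsDomain D := NoZeroDivisors.to_isDomain D
  let _ : DivisionRing D := divisionRingOfFiniteDimensional F D
  let _ : Module D W := Module.compHom W (μ : D →+* Module.End F W)
  have hs : ∀ (q : D) (w : W), q • w = μ q w := fun _ _ => rfl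
  have : IsScalarTower F D W := ⟨fun c q w => by
    rw [hs, hs, map_smul, LinearMap.smul_apply]⟩
  let ρ' : A →ₐ[F] Module.End D W :=
    { toFun := fun a =>
        { toFun := ρ a
          map_add' := map_add _
          map_smul' := fun q w => by
            rw [hs, hs, ← Module.End.mul_apply, ← hcomm]
            rfl }
      map_one' := by
        ext w
        change ρ 1 w = w
        rw [map_one]
        rfl
      map_mul' := fun a b => by
        ext w
        change ρ (a * b) w = ρ a (ρ b w)
        rw [map_mul]
        rfl
      map_zero' := by
        ext w
        change ρ 0 w = 0
        rw [map_zero]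
        rfl
      map_add' := fun a b => by
        ext w
        change ρ (a + b) w = ρ a w + ρ b w
        rw [map_add]
        rfl
      commutes' := fun f => by
        ext w
        change ρ (algebraMap F A f) w = f • w
        rw [AlgHom.commutes]
        rfl }
  have hρ' : Function.Injective ρ' := fun a b hab => hρ <| LinearMap.ext fun w =>
    LinearMap.congr_fun hab w
  obtain ⟨k', hk', ⟨e⟩⟩ := exists_algEquiv_matrix ρ' hρ' (by
    rw [hA, hW, hd]
    ring)
  have hkk : k' = k := by
    rw [hd, hW, hk] at hk'
    have h2 : d * d * k' = d * d * k := by rw [hk']; ring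
    exact Nat.eq_of_mul_eq_mul_left (by positivity) h2
  subst hkk
  have hk0 : k' ≠ 0 := by rintro rfl; simp at hk
  refine ⟨k', Dᵐᵒᵖ, inferInstance, inferInstance, by rw [hk, mul_comm], ⟨isCentral_of_matrix hk0 hc e,
    inferInstance, Module.Finite.equiv (MulOpposite.opLinearEquiv F)⟩, ?_, ⟨e⟩⟩
  rw [← hd]
  exact (MulOpposite.opLinearEquiv F).symm.finrank_eq

end rep

end

noncomputable section

section quatPair

variable {F : Type} [Field F] [CharP F 2] {A : Type} [Ring A] [Algebra F A]

/-- A pair of elements satisfying the relations of the quaternion algebra `[x, y)`. -/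
structure IsQuatPair (x y : F) (i j : A) : Prop where
  ii : i * i = i + x • (1 : A)
  jj : j * j = y • (1 : A)
  ji : j * i = j + i * j

lemma add_self_of_charTwo (F : Type) [Field F] [CharP F 2] {M : Type} [AddCommGroup M] [Module F M]
    (v : M) : v + v = 0 := by
  rw [← two_smul F, CharTwo.two_eq_zero, zero_smul]

/-- The quaternion basis attached to a pair of elements. -/
def IsQuatPair.basis {x y : F} {i j : A} (h : IsQuatPair x y i j) :
    QuaternionAlgebra.Basis A x 1 y where
  i := i
  j := j
  k := i * j
  i_mul_i := by rw [h.ii, one_smul, add_comm]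
  j_mul_j := h.jj
  i_mul_j := rfl
  j_mul_i := by
    rw [h.ji, one_smul, sub_eq_add_neg, neg_eq_of_add_eq_zero_left (add_self_of_charTwo F (i * j))]

/-- The homomorphism from a quaternion algebra attached to a pair of elements. -/
def IsQuatPair.hom {x y : F} {i j : A} (h : IsQuatPair x y i j) : ℍ[F,x,1,y] →ₐ[F] A :=
  h.basis.liftHom

lemma IsQuatPair.commute_hom {x y : F} {i j : A} (h : IsQuatPair x y i j) {a : A}
    (hi : Commute i a) (hj : Commute j a) (q : ℍ[F,x,1,y]) : Commute (h.hom q) a :=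
  ((Commute.add_left (Algebra.commutes q.re a) (hi.smul_left q.imI)).add_left
    (hj.smul_left q.imJ)).add_left ((hi.mul_left hj).smul_left q.imK)

lemma quat_nontrivial (x y : F) : Nontrivial ℍ[F,x,1,y] :=
  ⟨⟨0, 1, fun h => zero_ne_one (congrArg (·.re) h)⟩⟩

lemma finrank_quat (x y : F) : finrank F ℍ[F,x,1,y] = 2 * 2 :=
  (Module.finrank_eq_card_basis (quatBasis F x y)).trans rfl

lemma finrank_biquat (a b c d : F) : finrank F (Biquat F a b c d) = 4 * 4 :=
  (Module.finrank_eq_card_basis (biquatBasis F a b c d)).trans rfl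

lemma quat_finite (x y : F) : Module.Finite F ℍ[F,x,1,y] := Module.Finite.of_basis (quatBasis F x y)

lemma biquat_nontrivial (a b c d : F) : Nontrivial (Biquat F a b c d) :=
  Module.nontrivial_of_finrank_pos (R := F) (by rw [finrank_biquat]; norm_num)

variable {V : Type} [AddCommGroup V] [Module F V] [Module.Finite F V] [Module.Finite F A]

lemma hasIndex_four {x y x' y' : F} [NoZeroDivisors (Biquat F x y x' y')]
    (hc : Algebra.IsCentral F A) (hA : finrank F A = 64) (hV : finrank F V = 32)
    (ρ : A →ₐ[F] Module.End F V) (hρ : Function.Injective ρ) {i j i' j' : Module.End F V}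
    (h : IsQuatPair x y i j) (h' : IsQuatPair x' y' i' j')
    (hi : Commute i i') (hij : Commute i j') (hji : Commute j i') (hj : Commute j j')
    (ρi : ∀ a, Commute i (ρ a)) (ρj : ∀ a, Commute j (ρ a))
    (ρi' : ∀ a, Commute i' (ρ a)) (ρj' : ∀ a, Commute j' (ρ a)) : HasIndex F A 4 := by
  have := quat_finite x y
  have := quat_finite x' y'
  have := biquat_nontrivial x y x' y'
  have hcm : ∀ q q', Commute (h.hom q) (h'.hom q') := fun q q' =>
    h.commute_hom (h'.commute_hom hi.symm hij.symm q').symm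
      (h'.commute_hom hji.symm hj.symm q').symm q
  refine hasIndex_of_rep hc hA (finrank_biquat x y x' y') (by decide)
    (Algebra.TensorProduct.lift h.hom h'.hom hcm) ρ hρ (fun q a => ?_) hV
  induction q using TensorProduct.induction_on with
  | zero => rw [map_zero, zero_mul, mul_zero]
  | add q q' hq hq' => rw [map_add, add_mul, mul_add, hq, hq']
  | tmul q q' =>
    rw [Algebra.TensorProduct.lift_tmul]
    exact (h.commute_hom (ρi a) (ρj a) q).mul_left (h'.commute_hom (ρi' a) (ρj' a) q')

/-- The restriction of a representation to a stable subspace. -/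
def repRestrict (ρ : A →ₐ[F] Module.End F V) (W : Submodule F V) (hW : ∀ a, ∀ w ∈ W, ρ a w ∈ W) :
    A →ₐ[F] Module.End F W where
  toFun a := (ρ a).restrict (hW a)
  map_one' := by ext; simp
  map_mul' _ _ := by ext; simp
  map_zero' := by ext; simp
  map_add' _ _ := by ext; simp
  commutes' _ := by ext; simp

lemma hasIndex_two {x y : F} [NoZeroDivisors ℍ[F,x,1,y]]
    (hc : Algebra.IsCentral F A) (hA : finrank F A = 64) (hV : finrank F V = 32)
    (ρ : A →ₐ[F] Module.End F V) (hρ : Function.Injective ρ) {i j s : Module.End F V}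
    (h : IsQuatPair x y i j) (ρi : ∀ a, Commute i (ρ a)) (ρj : ∀ a, Commute j (ρ a))
    (ρs : ∀ a, Commute s (ρ a)) (W : Submodule F V) (hW : ∀ a, ∀ w ∈ W, ρ a w ∈ W)
    (hi : ∀ w ∈ W, i w ∈ W) (hj : ∀ w ∈ W, j w ∈ W)
    (hs : ∀ v, ∃ w ∈ W, ∃ w' ∈ W, v = w + s w')
    (hs0 : ∀ w ∈ W, ∀ w' ∈ W, w + s w' = 0 → w = 0 ∧ w' = 0) : HasIndex F A 2 := by
  have := quat_finite x y
  have := quat_nontrivial x y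
  have h' : IsQuatPair x y (i.restrict hi) (j.restrict hj) :=
    ⟨by ext w; exact LinearMap.congr_fun h.ii w, by ext w; exact LinearMap.congr_fun h.jj w,
      by ext w; exact LinearMap.congr_fun h.ji w⟩
  have hW16 : finrank F W = 8 * 2 := by
    let f : W × W →ₗ[F] V := W.subtype.coprod (s.comp W.subtype)
    have hf : Function.Bijective f := by
      constructor
      · rw [injective_iff_map_eq_zero]
        rintro ⟨w, w'⟩ hw
        obtain ⟨h1, h2⟩ := hs0 w w.2 w' w'.2 hw
        exact Prod.ext (Subtype.ext h1) (Subtype.ext h2)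
      · intro v
        obtain ⟨w, hw, w', hw', rfl⟩ := hs v
        exact ⟨(⟨w, hw⟩, ⟨w', hw'⟩), rfl⟩
    have h1 := (LinearEquiv.ofBijective f hf).finrank_eq
    rw [Module.finrank_prod, hV] at h1
    lia
  refine hasIndex_of_rep hc hA (finrank_quat x y) (by decide) h'.hom (repRestrict ρ W hW) ?_
    (fun q a => ?_) hW16
  · rw [injective_iff_map_eq_zero]
    intro a ha
    have h0 : ∀ w ∈ W, ρ a w = 0 := fun w hw => congrArg Subtype.val
      (LinearMap.congr_fun ha ⟨w, hw⟩)
    refine (injective_iff_map_eq_zero ρ).1 hρ a (LinearMap.ext fun v => ?_)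
    obtain ⟨w, hw, w', hw', rfl⟩ := hs v
    rw [map_add, h0 w hw, ← Module.End.mul_apply, ← (ρs a).eq, Module.End.mul_apply, h0 w' hw',
      map_zero, zero_add]
    rfl
  · exact h'.commute_hom (by ext w; exact LinearMap.congr_fun (ρi a).eq w)
      (by ext w; exact LinearMap.congr_fun (ρj a).eq w) q

end quatPair

variable {F E : Type} [Field F] [Field E] [Algebra F E] (B : BiquadExt F E) (t : Twist F)

/-- Multiplication by scalars on the standard space. -/
def lmul (c : E) : Module.End F (Fin 8 → E) := Algebra.lsmul F F (Fin 8 → E) c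

lemma lmul_apply (c : E) (v : Fin 8 → E) : (lmul c : Module.End F (Fin 8 → E)) v = c • v := rfl

/-- The natural representation of the twisted algebra. -/
def stdRep : t.form B →ₐ[F] Module.End F (Fin 8 → E) :=
  AlgHom.ofLinearMap
    { toFun := fun M => (Matrix.toLin' (M : Mat8 E)).restrictScalars F
      map_add' := fun M N => LinearMap.ext fun v => Matrix.add_mulVec (M : Mat8 E) N v
      map_smul' := fun c M => LinearMap.ext fun v => Matrix.smul_mulVec c (M : Mat8 E) v }
    (LinearMap.ext fun v => Matrix.one_mulVec v)
    (fun M N => LinearMap.ext fun v => (Matrix.mulVec_mulVec v (M : Mat8 E) N).symm)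

lemma stdRep_apply (M : t.form B) (v : Fin 8 → E) : stdRep B t M v = (M : Mat8 E).mulVec v := rfl

lemma stdRep_injective : Function.Injective (stdRep B t) := fun M N h => by
  refine Subtype.ext (Matrix.toLin'.injective (LinearMap.ext fun v => ?_))
  exact LinearMap.congr_fun h v

lemma commute_lmul (c : E) (M : t.form B) : Commute (lmul c) (stdRep B t M) := by
  refine LinearMap.ext fun v => ?_
  exact (Matrix.mulVec_smul (M : Mat8 E) c v).symm

/-- The semilinear operators commuting with the twisted algebra. -/
def semi (a : Fin 2) (m : F) : Module.End F (Fin 8 → E) where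
  toFun v i := algebraMap F E (m / t.l a i) * B.s a (v (t.π a i))
  map_add' v w := by
    ext i
    simp [mul_add]
  map_smul' c v := by
    ext i
    simp

lemma semi_apply (a : Fin 2) (m : F) (v : Fin 8 → E) (i : Fin 8) :
    semi B t a m v i = algebraMap F E (m / t.l a i) * B.s a (v (t.π a i)) := rfl

lemma semi_smul (a : Fin 2) (m : F) (c : E) (v : Fin 8 → E) :
    semi B t a m (c • v) = B.s a c • semi B t a m v := by
  ext i
  simp only [semi_apply, Pi.smul_apply, smul_eq_mul, map_mul]
  ring

lemma commute_semi (a : Fin 2) (m : F) (M : t.form B) :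
    Commute (semi B t a m) (stdRep B t M) := by
  refine LinearMap.ext fun v => funext fun i => ?_
  simp only [Module.End.mul_apply, semi_apply, stdRep_apply, Matrix.mulVec, dotProduct, map_sum,
    map_mul, Finset.mul_sum]
  rw [← t.sum_π a]
  refine Finset.sum_congr rfl fun j _ => ?_
  have h : (M : Mat8 E) i j = algebraMap F E (t.r a i j) *
    B.s a ((M : Mat8 E) (t.π a i) (t.π a j)) := (congrFun₂ (M.2 a) i j).symm
  have h2 : algebraMap F E (m / t.l a i) = algebraMap F E (t.r a i j) *
      algebraMap F E (m / t.l a j) := by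
    have := t.l_ne a i
    have := t.l_ne a j
    rw [← map_mul, Twist.r]
    congr 1
    field_simp
  rw [h, h2]
  ring

lemma semi_semi (a : Fin 2) (m q : F) (hq : m * m = q * (t.l a 0 * t.l a (t.π a 0))) :
    semi B t a m * semi B t a m = q • (1 : Module.End F (Fin 8 → E)) := by
  refine LinearMap.ext fun v => funext fun i => ?_
  simp only [Module.End.mul_apply, semi_apply, map_mul, AlgHom.commutes, B.s_s, t.π_π]
  rw [← mul_assoc, ← map_mul, LinearMap.smul_apply, Pi.smul_apply, Algebra.smul_def]
  congr 2
  have := t.l_ne a i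
  have := t.l_ne a (t.π a i)
  rw [div_mul_div_comm, div_eq_iff (by positivity), hq, t.l_inv a 0 i]

lemma commute_semi_semi (a b : Fin 2) (m n : F) : Commute (semi B t a m) (semi B t b n) := by
  refine LinearMap.ext fun v => funext fun i => ?_
  simp only [Module.End.mul_apply, semi_apply, map_mul, AlgHom.commutes]
  rw [← mul_assoc, ← mul_assoc, ← map_mul, ← map_mul, B.s_comm a b, t.π_comm b a]
  congr 2
  rw [div_mul_div_comm, div_mul_div_comm, mul_comm n m, t.l_comm a b i]

lemma isQuatPair_semi (a : Fin 2) (m q : F) (hq : m * m = q * (t.l a 0 * t.l a (t.π a 0))) (c : E)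
    (x : F) (hc : c * c = c + algebraMap F E x) (hs : B.s a c = c + 1) :
    IsQuatPair x q (lmul c) (semi B t a m) where
  ii := by
    refine LinearMap.ext fun v => ?_
    change c • c • v = c • v + x • v
    rw [smul_smul, hc, add_smul, algebraMap_smul]
  jj := semi_semi B t a m q hq
  ji := by
    refine LinearMap.ext fun v => ?_
    change semi B t a m (c • v) = semi B t a m v + c • semi B t a m v
    rw [semi_smul, hs, add_smul, one_smul, add_comm]

lemma commute_lmul_semi (a : Fin 2) (m : F) (c : E) (hs : B.s a c = c) :
    Commute (lmul c) (semi B t a m) := by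
  refine LinearMap.ext fun v => ?_
  change c • semi B t a m v = semi B t a m (c • v)
  rw [semi_smul, hs]

lemma commute_lmul_lmul (c d : E) : Commute (lmul c : Module.End F (Fin 8 → E)) (lmul d) := by
  refine LinearMap.ext fun v => ?_
  exact smul_comm c d v

variable [CharP F 2] [CharP E 2] [Module.Finite F E]

lemma finrank_std (B : BiquadExt F E) : finrank F (Fin 8 → E) = 32 := by
  rw [Module.finrank_pi_fintype, B.finrank_eq_four]
  rfl

lemma Twist.hasIndex_four (m : Fin 2 → F) (q : Fin 2 → F)
    (hq : ∀ a, m a * m a = q a * (t.l a 0 * t.l a (t.π a 0))) (a b : Fin 2) (hab : a ≠ b)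
    [NoZeroDivisors (Biquat F (B.x a) (q a) (B.x b) (q b))] : HasIndex F (t.form B) 4 :=
  Triality.hasIndex_four (t.isCentral B) (t.finrank_form B) (finrank_std B) (stdRep B t)
    (stdRep_injective B t) (isQuatPair_semi B t a (m a) (q a) (hq a) _ _ (B.sq a) (B.s_self a))
    (isQuatPair_semi B t b (m b) (q b) (hq b) _ _ (B.sq b) (B.s_self b))
    (commute_lmul_lmul _ _) (commute_lmul_semi B t b _ _ (B.s_other b a hab.symm))
    (commute_lmul_semi B t a _ _ (B.s_other a b hab)).symm (commute_semi_semi B t a b _ _)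
    (commute_lmul B t _) (commute_semi B t a _) (commute_lmul B t _) (commute_semi B t b _)

end

noncomputable section

variable {F E : Type} [Field F] [Field E] [Algebra F E] (B : BiquadExt F E)
variable (y : Fin 2 → F) (hy : ∀ v, y v ≠ 0)

/-- The slots of the quaternion algebras attached to the three descent data. -/
def slot : Fin 3 → Fin 2 → F :=
  ![![y 0 * y 1, y 0 * y 1], ![y 1, y 0], ![y 0, y 1]]

lemma slot_spec (n : Fin 3) (a : Fin 2) : (y 0 * y 1) * (y 0 * y 1) =
    slot y n a * ((tw y hy n).l a 0 * (tw y hy n).l a ((tw y hy n).π a 0)) := by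
  change _ = slot y n a * (y 0 ^ ex 0 n a 0 * y 1 ^ ex 1 n a 0 *
    (y 0 ^ ex 0 n a (pm n a 0) * y 1 ^ ex 1 n a (pm n a 0)))
  fin_cases n <;> fin_cases a <;>
    simp [slot, ex, pm] <;> ring

variable [CharP F 2] [CharP E 2] [Module.Finite F E]

lemma hasIndex_form_four (n : Fin 3) (a b : Fin 2) (hab : a ≠ b)
    [NoZeroDivisors (Biquat F (B.x a) (slot y n a) (B.x b) (slot y n b))] :
    HasIndex F ((tw y hy n).form B) 4 :=
  (tw y hy n).hasIndex_four B (fun _ => y 0 * y 1) (slot y n) (slot_spec y hy n) a b hab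

lemma hasIndex_form_zero [NoZeroDivisors ℍ[F,B.x 0 + B.x 1,1,y 0 * y 1]] :
    HasIndex F ((tw y hy 0).form B) 2 := by
  let t := tw y hy 0
  let j := semi B t 0 (y 0 * y 1)
  let j' := semi B t 1 (y 0 * y 1)
  have hyy : y 0 * y 1 ≠ 0 := mul_ne_zero (hy 0) (hy 1)
  have s01 : B.s 0 (B.θ 0 + B.θ 1) = B.θ 0 + B.θ 1 + 1 := by
    rw [map_add, B.s_self, B.s_other 0 1 (by decide)]
    ring
  have hsq : (B.θ 0 + B.θ 1) * (B.θ 0 + B.θ 1) =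
      B.θ 0 + B.θ 1 + algebraMap F E (B.x 0 + B.x 1) := by
    rw [CharTwo.add_mul_self, B.sq, B.sq, map_add]
    ring
  have h := isQuatPair_semi B t 0 (y 0 * y 1) (y 0 * y 1) (slot_spec y hy 0 0) _ _ hsq s01
  have hjj' : j' * j' = (y 0 * y 1) • (1 : Module.End F (Fin 8 → E)) :=
    semi_semi B t 1 _ (y 0 * y 1) (slot_spec y hy 0 1)
  have hc : Commute j j' := commute_semi_semi B t 0 1 _ _
  let P : Module.End F (Fin 8 → E) := (y 0 * y 1)⁻¹ • (j * j')
  have hPP : ∀ v, P (P v) = v := fun v => by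
    have h1 : P * P = 1 := by
      rw [smul_mul_smul_comm, hc.symm.mul_mul_mul_comm, h.jj, hjj', smul_mul_smul_comm, smul_smul,
        mul_one, show (y 0 * y 1)⁻¹ * (y 0 * y 1)⁻¹ * (y 0 * y 1 * (y 0 * y 1)) = 1 by
          rw [mul_mul_mul_comm, inv_mul_cancel₀ hyy, one_mul],
        one_smul]
    exact LinearMap.congr_fun h1 v
  have hPc : ∀ (c : E) v, P (c • v) = B.s 0 (B.s 1 c) • P v := fun c v => by
    change (y 0 * y 1)⁻¹ • j (j' (c • v)) = B.s 0 (B.s 1 c) • ((y 0 * y 1)⁻¹ • j (j' v))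
    rw [semi_smul, semi_smul, smul_comm]
  have hPθ : ∀ v, P (B.θ 0 • v) = (B.θ 0 + 1) • P v := fun v => by
    rw [hPc, B.s_other 1 0 (by decide), B.s_self]
  have hPj : Commute P j := ((Commute.refl j).mul_left hc.symm).smul_left _
  have hadd : ∀ v : Fin 8 → E, v + v = 0 := add_self_of_charTwo F
  refine Triality.hasIndex_two (t.isCentral B) (t.finrank_form B) (finrank_std B) (stdRep B t)
    (stdRep_injective B t) h (commute_lmul B t _) (commute_semi B t 0 _)
    (commute_lmul B t (B.θ 0)) (LinearMap.ker (P - 1)) ?_ ?_ ?_ ?_ ?_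
  all_goals simp only [LinearMap.mem_ker, LinearMap.sub_apply, Module.End.one_apply, sub_eq_zero]
  · intro a w hw
    have h1 : Commute P (stdRep B t a) :=
      ((commute_semi B t 0 _ a).mul_left (commute_semi B t 1 _ a)).smul_left _
    rw [← Module.End.mul_apply, h1.eq, Module.End.mul_apply, hw]
  · intro w hw
    rw [lmul_apply, hPc, hw, map_add, map_add, B.s_other 1 0 (by decide), B.s_self, B.s_self,
      map_add, B.s_other 0 1 (by decide), map_one,
      show B.θ 0 + 1 + (B.θ 1 + 1) = B.θ 0 + B.θ 1 + (1 + 1) by ring, CharTwo.add_self_eq_zero,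
      add_zero]
  · intro w hw
    rw [← Module.End.mul_apply, hPj.eq, Module.End.mul_apply, hw]
  · intro v
    have hw : P (v + P v) = v + P v := by rw [map_add, hPP, add_comm]
    refine ⟨v + B.θ 0 • (v + P v), ?_, v + P v, hw, ?_⟩
    · rw [map_add, hPθ, hw, add_smul, one_smul,
        show P v + (B.θ 0 • (v + P v) + (v + P v)) = v + B.θ 0 • (v + P v) + (P v + P v) by abel,
        hadd, add_zero]
    · rw [lmul_apply, add_assoc, hadd, add_zero]
  · intro w hw w' hw' h0
    have h1 := congrArg P h0
    rw [lmul_apply, map_add, hPθ, hw, hw', map_zero, add_smul, one_smul, ← add_assoc] at h1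
    rw [lmul_apply] at h0
    rw [h0, zero_add] at h1
    rw [h1, smul_zero, add_zero] at h0
    exact ⟨h0, h1⟩

lemma hasIndex_form_one [NoZeroDivisors ℍ[F,B.x 0,1,y 1]] (m : F) (hm : B.x 1 = y 0 * m ^ 2) :
    HasIndex F ((tw y hy 1).form B) 2 := by
  let t := tw y hy 1
  let T := semi B t 1 (y 0 * y 1)
  have h := isQuatPair_semi B t 0 (y 0 * y 1) (y 1) (slot_spec y hy 1 0) _ _ (B.sq 0) (B.s_self 0)
  have h' : IsQuatPair (B.x 1) (y 0) (lmul (B.θ 1)) T :=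
    isQuatPair_semi B t 1 (y 0 * y 1) (y 0) (slot_spec y hy 1 1) _ _ (B.sq 1) (B.s_self 1)
  have hadd : ∀ v : Fin 8 → E, v + v = 0 := add_self_of_charTwo F
  have hadd' : ∀ f : Module.End F (Fin 8 → E), f + f = 0 := add_self_of_charTwo F
  let p : Module.End F (Fin 8 → E) := lmul (B.θ 1) + m • T
  have hp : ∀ v, p (p v) = p v := fun v => by
    have h1 : p * p = p := by
      have h2 : p * p = lmul (B.θ 1) * lmul (B.θ 1) + m • (lmul (B.θ 1) * T + T * lmul (B.θ 1)) +
          (m * m) • (T * T) := by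
        simp only [p, add_mul, mul_add, smul_mul_assoc, mul_smul_comm, smul_add, smul_smul]
        abel
      have h3 : lmul (B.θ 1) * T + (T + lmul (B.θ 1) * T) = T := by
        rw [add_comm, add_assoc, hadd', add_zero]
      rw [h2, h'.ii, h'.ji, h'.jj, hm, h3, smul_smul, show m * m * y 0 = y 0 * m ^ 2 by ring,
        add_right_comm, add_assoc _ _ ((y 0 * m ^ 2) • (1 : Module.End F (Fin 8 → E))), hadd',
        add_zero]
    exact LinearMap.congr_fun h1 v
  have hpT : ∀ v, p (T v) = T (p v) + T v := fun v => by
    have h1 : p * T = T * p + T := by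
      have h2 : T * p + T = (T * lmul (B.θ 1) + T) + m • (T * T) := by
        simp only [p, mul_add, mul_smul_comm]
        abel
      rw [h2, h'.ji, add_right_comm T, hadd', zero_add, add_mul, smul_mul_assoc]
    exact LinearMap.congr_fun h1 v
  have hTT : ∀ v, T (T v) = y 0 • v := fun v => LinearMap.congr_fun h'.jj v
  refine Triality.hasIndex_two (t.isCentral B) (t.finrank_form B) (finrank_std B) (stdRep B t)
    (stdRep_injective B t) h (commute_lmul B t _) (commute_semi B t 0 _)
    (commute_semi B t 1 (y 0 * y 1)) (LinearMap.ker (p - 1)) ?_ ?_ ?_ ?_ ?_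
  all_goals simp only [LinearMap.mem_ker, LinearMap.sub_apply, Module.End.one_apply, sub_eq_zero]
  · intro a w hw
    have h1 : Commute p (stdRep B t a) :=
      (commute_lmul B t _ a).add_left ((commute_semi B t 1 _ a).smul_left _)
    rw [← Module.End.mul_apply, h1.eq, Module.End.mul_apply, hw]
  · intro w hw
    have h1 : Commute p (lmul (B.θ 0)) := (commute_lmul_lmul _ _).add_left
      ((commute_lmul_semi B t 1 _ _ (B.s_other 1 0 (by decide))).symm.smul_left _)
    rw [← Module.End.mul_apply, h1.eq, Module.End.mul_apply, hw]
  · intro w hw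
    have h1 : Commute p (semi B t 0 (y 0 * y 1)) :=
      (commute_lmul_semi B t 0 _ _ (B.s_other 0 1 (by decide))).add_left
        ((commute_semi_semi B t 1 0 _ _).smul_left _)
    rw [← Module.End.mul_apply, h1.eq, Module.End.mul_apply, hw]
  · intro v
    refine ⟨p v, hp v, (y 0)⁻¹ • T (v + p v), ?_, ?_⟩
    · rw [map_smul, hpT, map_add p, hp, hadd, map_zero, zero_add]
    · change v = p v + T ((y 0)⁻¹ • T (v + p v))
      rw [map_smul, hTT, smul_smul, inv_mul_cancel₀ (hy 0), one_smul, add_comm, add_assoc, hadd,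
        add_zero]
  · intro w hw w' hw' h0
    change w + T w' = 0 at h0
    have h1 := congrArg p h0
    rw [map_add, hpT, hw, hw', map_zero, hadd, add_zero] at h1
    rw [h1, zero_add] at h0
    have h2 := hTT w'
    rw [h0, map_zero] at h2
    exact ⟨h1, (smul_eq_zero.1 h2.symm).resolve_left (hy 0)⟩

end

noncomputable section

section matrix

variable {E : Type} [Field E]

/-- Rank factorization of an idempotent matrix. -/
lemma exists_rank_factor {ε : Mat8 E} (hε : ε * ε = ε) {r : ℕ}
    (hr : finrank E (LinearMap.range (LinearMap.mulLeft E ε)) = 8 * r) :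
    ∃ (P : Matrix (Fin 8) (Fin r) E) (Q : Matrix (Fin r) (Fin 8) E), P * Q = ε ∧ Q * P = 1 := by
  let R := LinearMap.range ε.mulVecLin
  have hmem : ∀ {M : Mat8 E}, M ∈ LinearMap.range (LinearMap.mulLeft E ε) ↔ ε * M = M :=
    ⟨fun ⟨N, hN⟩ => by rw [← hN, LinearMap.mulLeft_apply, ← mul_assoc, hε], fun h => ⟨_, h⟩⟩
  have hmemR : ∀ {v : Fin 8 → E}, v ∈ R ↔ ε.mulVec v = v :=
    ⟨fun ⟨w, hw⟩ => by rw [← hw, Matrix.mulVecLin_apply, Matrix.mulVec_mulVec, hε], fun h => ⟨_, h⟩⟩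
  let f : LinearMap.range (LinearMap.mulLeft E ε) ≃ₗ[E] (Fin 8 → R) :=
    { toFun := fun M j => ⟨fun i => M.1 i j, hmemR.2 (funext fun i =>
        congrFun₂ (hmem.1 M.2) i j)⟩
      map_add' := fun _ _ => rfl
      map_smul' := fun _ _ => rfl
      invFun := fun w => ⟨Matrix.of fun i j => (w j).1 i, hmem.2 (by
        ext i j
        exact congrFun (hmemR.1 (w j).2) i)⟩
      left_inv := fun _ => rfl
      right_inv := fun _ => rfl }
  have h1 : finrank E R = r := by
    have h2 := f.finrank_eq
    rw [hr, Module.finrank_pi_fintype, Finset.sum_const, Finset.card_univ, Fintype.card_fin,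
      smul_eq_mul] at h2
    lia
  let b : Basis (Fin r) E R := (Module.finBasis E R).reindex (finCongr h1)
  let P : Matrix (Fin 8) (Fin r) E := Matrix.of fun i k => (b k).1 i
  let Q : Matrix (Fin r) (Fin 8) E :=
    Matrix.of fun k j => b.repr ⟨ε.mulVec (Pi.single j 1), ⟨_, rfl⟩⟩ k
  have hP : ∀ c : Fin r → E, P.mulVec c = ((∑ k, c k • b k : R) : Fin 8 → E) := fun c => by
    ext i
    rw [Submodule.coe_sum, Finset.sum_apply]
    change ∑ k, P i k * c k = ∑ k, c k * P i k
    exact Finset.sum_congr rfl fun k _ => mul_comm _ _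
  have hPQ : P * Q = ε := by
    ext i j
    have h2 := congrFun (hP fun k => Q k j) i
    change (P.mulVec fun k => Q k j) i = _
    rw [h2, show (∑ k, Q k j • b k : R) = ⟨ε.mulVec (Pi.single j 1), ⟨_, rfl⟩⟩ from b.sum_repr _]
    exact congrFun (Matrix.mulVec_single_one ε j) i
  refine ⟨P, Q, hPQ, ?_⟩
  have hinj : Function.Injective P.mulVec := fun c d hcd => by
    rw [hP, hP] at hcd
    have h2 := congrArg b.repr (Subtype.ext hcd)
    ext k
    have h3 := DFunLike.congr_fun h2 k
    rwa [Basis.repr_sum_self, Basis.repr_sum_self] at h3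
  have h2 : P * (Q * P) = P := by
    rw [← Matrix.mul_assoc, hPQ]
    ext i k
    exact congrFun (hmemR.1 (b k).2) i
  refine Matrix.ext_of_mulVec_single fun k => hinj ?_
  rw [Matrix.mulVec_mulVec, h2, Matrix.one_mulVec]

lemma mul_rk_mul (M N : Mat8 E) (u v : Fin 8 → E) :
    M * rk u v * adj8 N = rk (M.mulVec u) (N.mulVec v) := by
  ext i j
  simp only [Matrix.mul_apply, rk_apply, adj8_apply, Matrix.mulVec, dotProduct, Finset.sum_mul,
    Finset.mul_sum]
  rw [← sum_par]
  refine Finset.sum_congr rfl fun k _ => Finset.sum_congr rfl fun l _ => ?_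
  rw [par_par]
  ring

lemma not_adj8_rk {u v : Fin 8 → E} (h : ∀ c d : E, c • u + d • v = 0 → c = 0 ∧ d = 0) :
    rk u v ≠ rk v u := by
  intro h1
  have h2 : ∀ j, v j = 0 := fun j => by
    refine (h (v j) (-u j) ?_).1
    ext i
    have h3 := congrFun₂ h1 i (par j)
    rw [rk_apply, rk_apply, par_par] at h3
    simp only [Pi.add_apply, Pi.smul_apply, smul_eq_mul, Pi.zero_apply]
    linear_combination h3
  have h3 : v = 0 := funext h2
  have h4 := (h 0 1 (by rw [h3, zero_smul, smul_zero, add_zero])).2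
  exact one_ne_zero h4

lemma eq_zero_of_offDiag {N : Mat8 E} (h : ∀ i j, i ≠ j → N i j = 0) (hN : N * N = 0) : N = 0 := by
  ext i j
  by_cases hij : i = j
  · subst hij
    have h1 := congrFun₂ hN i i
    rw [Matrix.mul_apply, Finset.sum_eq_single i (fun k _ hk => by rw [h i k hk.symm, zero_mul])
      (fun hi => absurd (Finset.mem_univ _) hi)] at h1
    exact mul_self_eq_zero.1 h1
  · exact h i j hij

variable [CharP E 2] (s : Bool)

lemma κ_rk (u v : Fin 8 → E) : κ s (rk u v) = vec s u * vec (!s) v := κ_vecMulVec s u v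

lemma vec_swap {u v : Fin 8 → E} (h : bil u v = 0) :
    vec s v * vec (!s) u = vec s u * vec (!s) v := by
  have h1 := vec_anti s u v
  rw [h, zero_smul] at h1
  exact (CharTwo.add_eq_zero.1 h1).symm

lemma mul_eq_sum_rk {r : ℕ} (P : Matrix (Fin 8) (Fin r) E) (Q : Matrix (Fin r) (Fin 8) E)
    (M : Mat8 E) : P * Q * M = ∑ k, rk (fun i => P i k) fun j => (Q * M) k (par j) := by
  ext a b
  rw [Matrix.mul_assoc, Matrix.mul_apply, Matrix.sum_apply]
  exact Finset.sum_congr rfl fun k _ => by rw [rk_apply, par_par]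

lemma exists_eq_sum_smul_rk {r : ℕ} (P : Matrix (Fin 8) (Fin r) E) (Q : Matrix (Fin r) (Fin 8) E)
    (M : Mat8 E) : ∃ c : Fin r → Fin r → E, P * Q * M * adj8 (P * Q) =
      ∑ k, ∑ l, c k l • rk (fun i => P i k) fun i => P i l := by
  refine ⟨fun k l => ∑ j, (Q * M) k j * Q l (par j), ?_⟩
  ext a b
  have h : adj8 (P * Q) = Matrix.of (fun j l => Q l (par j)) * Matrix.of fun l b => P (par b) l := by
    ext i j
    rw [adj8_apply, Matrix.mul_apply, Matrix.mul_apply]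
    exact Finset.sum_congr rfl fun k _ => mul_comm _ _
  rw [h, Matrix.mul_assoc, Matrix.mul_assoc, Matrix.mul_apply, Matrix.sum_apply]
  refine Finset.sum_congr rfl fun k _ => ?_
  rw [← Matrix.mul_assoc, ← Matrix.mul_assoc, Matrix.mul_apply, Matrix.sum_apply, Finset.mul_sum]
  refine Finset.sum_congr rfl fun l _ => ?_
  rw [Matrix.smul_apply, rk_apply, Matrix.mul_apply, smul_eq_mul]
  simp only [Matrix.of_apply]
  ring

/-- The half-spin map is injective modulo symmetric matrices, on square-zero elements. -/
lemma adj8_eq_of_κ_eq_zero {M : Mat8 E} (h : κ s M = 0) (h0 : (M + adj8 M) * (M + adj8 M) = 0) :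
    adj8 M = M :=
  (CharTwo.add_eq_zero.1 (eq_zero_of_offDiag
    (fun _ _ hij => add_adj8_apply_of_κ_eq_zero s h hij) h0)).symm

lemma linearIndependent_of_mul_eq_one {P : Matrix (Fin 8) (Fin 2) E} {Q : Matrix (Fin 2) (Fin 8) E}
    (hQP : Q * P = 1) {c d : E} (h : (c • fun i => P i 0) + (d • fun i => P i 1) = 0) :
    c = 0 ∧ d = 0 := by
  have h1 : P.mulVec ![c, d] = 0 := by
    rw [← h]
    ext i
    rw [Matrix.mulVec, dotProduct, Fin.sum_univ_two]
    exact congrArg₂ (· + ·) (mul_comm _ _) (mul_comm _ _)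
  have h2 := congrArg Q.mulVec h1
  rw [Matrix.mulVec_mulVec, hQP, Matrix.one_mulVec, Matrix.mulVec_zero] at h2
  exact ⟨congrFun h2 0, congrFun h2 1⟩

/-- The image under the half-spin map of the ideal given by a totally singular plane. -/
lemma exists_κ_plane {u v : Fin 8 → E} (hu : quad u = 0) (hv : quad v = 0) (hb : bil u v = 0)
    {ε : Mat8 E} {P : Matrix (Fin 8) (Fin 2) E} {Q : Matrix (Fin 2) (Fin 8) E} (hPQ : P * Q = ε)
    (hPu : (fun i => P i 0) = u) (hPv : (fun i => P i 1) = v) :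
    (∀ M, ∃ c : E, κ s (ε * M * adj8 ε) = c • (vec s u * vec (!s) v)) ∧
    (∀ M, vec s u * vec (!s) v * κ s (ε * M) = 0) ∧
    ∀ M, κ s (M * adj8 ε) * (vec s u * vec (!s) v) = 0 := by
  have hself : ∀ (s : Bool) {w : Fin 8 → E}, quad w = 0 → vec s w * vec (!s) w = 0 :=
    fun s w hw => by rw [vec_self, hw, zero_smul]
  have huu := hself s hu
  have hvv := hself s hv
  have huu' : vec (!s) u * vec s u = 0 := by simpa using hself (!s) hu
  have hvv' : vec (!s) v * vec s v = 0 := by simpa using hself (!s) hv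
  have hsw := vec_swap s hb
  have hsw' : vec (!s) v * vec s u = vec (!s) u * vec s v := by simpa using vec_swap (!s) hb
  have hκ : ∀ M : Mat8 E, ∃ p q : Fin 8 → E, κ s (ε * M) =
      vec s u * vec (!s) p + vec s v * vec (!s) q := fun M => by
    refine ⟨fun j => (Q * M) 0 (par j), fun j => (Q * M) 1 (par j), ?_⟩
    rw [← hPQ, mul_eq_sum_rk, Fin.sum_univ_two, map_add, κ_rk, κ_rk, hPu, hPv]
  refine ⟨fun M => ?_, fun M => ?_, fun M => ?_⟩
  · obtain ⟨c, hc⟩ := exists_eq_sum_smul_rk P Q M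
    refine ⟨c 0 1 + c 1 0, ?_⟩
    rw [← hPQ, hc]
    simp only [Fin.sum_univ_two, map_add, map_smul, κ_rk, hPu, hPv]
    rw [huu, hvv, hsw, smul_zero, smul_zero, zero_add, add_zero, add_smul]
  · obtain ⟨p, q, h⟩ := hκ M
    have h1 : vec s u * vec (!s) v * (vec s u * vec (!s) p) =
        vec s u * (vec (!s) v * vec s u) * vec (!s) p := by noncomm_ring
    have h2 : vec s u * vec (!s) v * (vec s v * vec (!s) q) =
        vec s u * (vec (!s) v * vec s v) * vec (!s) q := by noncomm_ring
    rw [h, mul_add, h1, h2, hsw', hvv', ← mul_assoc (vec s u), huu]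
    simp
  · obtain ⟨p, q, h⟩ := hκ (adj8 M)
    have h0 : M * adj8 ε = adj8 (ε * adj8 M) := by rw [adj8_mul, adj8_adj8]
    have h1 : vec s p * vec (!s) u * (vec s u * vec (!s) v) =
        vec s p * (vec (!s) u * vec s u) * vec (!s) v := by noncomm_ring
    have h2 : vec s q * vec (!s) v * (vec s u * vec (!s) v) =
        vec s q * (vec (!s) v * vec s u) * vec (!s) v := by noncomm_ring
    have h3 : vec s q * (vec (!s) u * vec s v) * vec (!s) v =
        vec s q * vec (!s) u * (vec s v * vec (!s) v) := by noncomm_ring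
    rw [h0, κ_adj8, h, map_add, adj8_mul, adj8_mul, adj8_vec, adj8_vec, adj8_vec, adj8_vec,
      Bool.not_not, add_mul, h1, h2, huu', hsw', h3, hvv]
    simp

lemma eq_zero_of_vec_mul {s : Bool} {M : Mat8 E} (h : ∀ w, vec s w * M = 0) : M = 0 := by
  have hb : bil (Pi.single 0 1) (Pi.single 1 1 : Fin 8 → E) = 1 := by
    rw [bil, Finset.sum_eq_single 0 (fun k _ hk => by rw [Pi.single_eq_of_ne hk, zero_mul])
      fun h => absurd (Finset.mem_univ _) h]
    exact (congrArg₂ (· * ·) (Pi.single_eq_same _ _) (Pi.single_eq_same _ _)).trans (mul_one 1)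
  have h1 := congrArg (· * M) (vec_anti (!s) (Pi.single 0 1) (Pi.single 1 1 : Fin 8 → E))
  simp only [hb, one_smul, one_mul, add_mul, mul_assoc, Bool.not_not, h, mul_zero, add_zero] at h1
  exact h1.symm

lemma adj8_rk_eq_of_κ_mul_κ {u v : Fin 8 → E} (hu : quad u = 0) (hv : quad v = 0) (hb : bil u v = 0)
    {ε : Mat8 E} (hεu : ε.mulVec u = u) (hεv : ε.mulVec v = v)
    (h : ∀ M N, κ s (M * adj8 ε) * κ s (ε * N) = 0) : rk u v = rk v u := by
  have h1 : ∀ w w', vec s w * (vec (!s) u * vec s v) * vec (!s) w' = 0 := fun w w' => by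
    have h2 := h (rk w u) (rk v w')
    have h3 : rk w u * adj8 ε = rk w u := by
      rw [← one_mul (rk w u), mul_rk_mul, hεu, one_mul, Matrix.one_mulVec]
    have h4 : ε * rk v w' = rk v w' := by
      rw [← mul_one (ε * _), ← adj8_one, mul_rk_mul, hεv, Matrix.one_mulVec]
    rw [h3, h4, κ_rk, κ_rk] at h2
    rw [← h2]
    noncomm_ring
  have h2 : ∀ w', vec (!s) u * vec s v * vec (!s) w' = 0 := fun w' =>
    eq_zero_of_vec_mul (s := s) fun w => by rw [← mul_assoc, h1]
  have h3 : vec (!s) u * vec s v = 0 := by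
    have h4 : adj8 (vec (!s) u * vec s v) = 0 := eq_zero_of_vec_mul (s := s) fun w => by
      have h5 := congrArg adj8 (h2 w)
      rwa [adj8_mul, adj8_vec, Bool.not_not, map_zero] at h5
    rw [← adj8_adj8 (vec (!s) u * vec s v), h4, map_zero]
  have h4 : κ (!s) (rk u v) = 0 := by rw [κ_rk, Bool.not_not, h3]
  refine ((adj8_eq_of_κ_eq_zero (!s) h4 ?_).symm.trans (adj8_rk u v))
  have hb' : bil v u = 0 := by
    have h5 := quad_add v u
    rwa [add_comm v u, quad_add, add_comm (quad v), hb, add_right_inj, eq_comm] at h5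
  have hs : ∀ w : Fin 8 → E, bil w w = 2 * quad w := fun w => by
    have h5 := quad_add w w
    have h6 : w + w = 0 := funext fun i => CharTwo.add_self_eq_zero _
    rw [h6, CharTwo.add_self_eq_zero, zero_add] at h5
    rw [← h5, CharTwo.two_eq_zero, zero_mul]
    simp [quad]
  rw [adj8_rk, add_mul, mul_add, mul_add, rk_mul_rk, rk_mul_rk, rk_mul_rk, rk_mul_rk, hb', hs, hs,
    hu, hv, hb]
  simp

end matrix

section isotropic

variable {F E : Type} [Field F] [Field E] [Algebra F E] (B : BiquadExt F E) (t : Twist F)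
variable [CharP E 2] [Module.Finite F E]

lemma Twist.finrank_range_mulLeft {ε : t.form B} (hε : (ε : Mat8 E) * ε = ε) :
    finrank E (LinearMap.range (LinearMap.mulLeft E (ε : Mat8 E))) =
      finrank F (LinearMap.range (LinearMap.mulLeft F ε)) := by
  refine (t.finrank_fixed B _ ?_ _ ?_).symm
  · rintro a _ ⟨N, rfl⟩
    exact ⟨(t.descent B).τ a N, by
      rw [LinearMap.mulLeft_apply, LinearMap.mulLeft_apply, t.τ_mul, ε.2 a]⟩
  · intro M
    constructor
    · rintro ⟨N, rfl⟩
      exact ⟨(N : Mat8 E), rfl⟩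
    · rintro ⟨N, hN⟩
      refine ⟨M, Subtype.ext ?_⟩
      change (ε : Mat8 E) * M = M
      rw [← hN, LinearMap.mulLeft_apply, ← mul_assoc, hε]

/-- The semi-trace vanishes on the symmetric elements over `E` of an isotropic ideal. -/
lemma trace_eq_zero_of_isotropic {ℓ ε : t.form B}
    (h : ∀ x, t.σ B x = x → t.T B (ℓ * (ε * x * t.σ B ε)) = 0) {N : Mat8 E} (hN : adj8 N = N) :
    ((ℓ : Mat8 E) * (ε * N * adj8 (ε : Mat8 E))).trace = 0 := by
  obtain ⟨u, hu, h1, hd⟩ := (t.descent B).exists_decomp (LinearMap.ker (adj8 - LinearMap.id))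
    (fun a M hM => by
      rw [LinearMap.mem_ker, LinearMap.sub_apply, LinearMap.id_apply, sub_eq_zero] at hM ⊢
      rw [← t.τ_adj8, hM]) N (by
      rw [LinearMap.mem_ker, LinearMap.sub_apply, LinearMap.id_apply, sub_eq_zero, hN])
  simp only [hd, Finset.mul_sum, Finset.sum_mul, Matrix.trace_sum, mul_smul_comm, smul_mul_assoc,
    Matrix.trace_smul]
  refine Finset.sum_eq_zero fun k _ => ?_
  have h2 : t.σ B ⟨u k, hu k⟩ = ⟨u k, hu k⟩ := by
    refine Subtype.ext ?_
    have := h1 k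
    rwa [LinearMap.mem_ker, LinearMap.sub_apply, LinearMap.id_apply, sub_eq_zero] at this
  have h3 := t.algebraMap_T B (ℓ * (ε * ⟨u k, hu k⟩ * t.σ B ε))
  rw [h _ h2, map_zero] at h3
  simp only [Subalgebra.coe_mul, t.coe_σ] at h3
  rw [← h3, smul_zero]

lemma exists_not_symm {ε : t.form B} {u v : Fin 8 → E} (hεu : (ε : Mat8 E).mulVec u = u)
    (hεv : (ε : Mat8 E).mulVec v = v) (h : rk u v ≠ rk v u) :
    ∃ x : t.form B, adj8 ((ε : Mat8 E) * (x : Mat8 E) * adj8 (ε : Mat8 E)) ≠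
      (ε : Mat8 E) * (x : Mat8 E) * adj8 (ε : Mat8 E) := by
  by_contra! hall
  have h1 : adj8 ∘ₗ LinearMap.mulRight E (adj8 (ε : Mat8 E)) ∘ₗ LinearMap.mulLeft E (ε : Mat8 E) =
      LinearMap.mulRight E (adj8 (ε : Mat8 E)) ∘ₗ LinearMap.mulLeft E (ε : Mat8 E) :=
    t.form_ext B hall
  have h2 := LinearMap.congr_fun h1 (rk u v)
  simp only [LinearMap.comp_apply, LinearMap.mulLeft_apply, LinearMap.mulRight_apply] at h2
  rw [mul_rk_mul, hεu, hεv, adj8_rk] at h2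
  exact h h2.symm

/-- In an algebra of degree 8 and index 4, an element `z` with `z * z = 0` generates the
right ideal annihilated by `z`. -/
lemma HasIndex.exists_eq_mul {A : Type} [Ring A] [Algebra F A] [Module.Finite F A]
    (hd : finrank F A = 64) (h : HasIndex F A 4) {z w : A} (hz : z ≠ 0) (hzz : z * z = 0)
    (hw : z * w = 0) : ∃ x, w = z * x := by
  have h1 := h.le_finrank (LinearMap.range (LinearMap.mulLeft F z)) (by
    rintro _ ⟨x, rfl⟩ a
    exact ⟨x * a, (mul_assoc _ _ _).symm⟩) fun h0 => hz (by
    have h2 : z * 1 ∈ LinearMap.range (LinearMap.mulLeft F z) := ⟨1, rfl⟩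
    rwa [h0, Submodule.mem_bot, mul_one] at h2)
  have h2 := LinearMap.finrank_range_add_finrank_ker (LinearMap.mulLeft F z)
  have h3 : LinearMap.range (LinearMap.mulLeft F z) ≤ LinearMap.ker (LinearMap.mulLeft F z) := by
    rintro _ ⟨x, rfl⟩
    rw [LinearMap.mem_ker, LinearMap.mulLeft_apply, LinearMap.mulLeft_apply, ← mul_assoc, hzz,
      zero_mul]
  have h4 := Submodule.eq_of_le_of_finrank_le h3 (by lia)
  have h5 : w ∈ LinearMap.range (LinearMap.mulLeft F z) := by
    rw [h4]
    exact hw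
  obtain ⟨x, hx⟩ := h5
  exact ⟨x, hx.symm⟩

variable (y : Fin 2 → F) (hy : ∀ v, y v ≠ 0)

lemma not_isotropic_of_index (s : Bool) (n : Fin 3) (h2 : HasIndex F ((tw y hy n).form B) 2)
    (h4 : HasIndex F ((tw y hy (tgt s n)).form B) 4) :
    ¬ QPIsotropic F ((tw y hy n).form B) ((tw y hy n).T B) ((tw y hy n).σ B) (ell B y hy n) := by
  rintro ⟨I, ⟨hI, hσ, hT⟩, h0⟩
  obtain ⟨ε, hεI, hε, hr⟩ := h2.exists_idempotent I hI h0
  obtain ⟨hσmul, hσσ⟩ := (tw y hy n).isInvolution B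
  have hη : adj8 (ε : Mat8 E) * ε = 0 := congrArg Subtype.val (hσ _ hεI _ hεI)
  have hε' : (ε : Mat8 E) * ε = ε := congrArg Subtype.val hε
  obtain ⟨P, Q, hPQ, hQP⟩ := exists_rank_factor (r := 2) hε' (by
    rw [(tw y hy n).finrank_range_mulLeft B hε', hr])
  obtain ⟨u, hu⟩ : ∃ u : Fin 8 → E, (fun i => P i 0) = u := ⟨_, rfl⟩
  obtain ⟨v, hv⟩ : ∃ v : Fin 8 → E, (fun i => P i 1) = v := ⟨_, rfl⟩
  have hεP : (ε : Mat8 E) * P = P := by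
    rw [← hPQ, Matrix.mul_assoc, hQP, Matrix.mul_one]
  have hεu : (ε : Mat8 E).mulVec u = u := by
    rw [← hu]
    exact funext fun i => congrFun₂ hεP i 0
  have hεv : (ε : Mat8 E).mulVec v = v := by
    rw [← hv]
    exact funext fun i => congrFun₂ hεP i 1
  have hne : rk u v ≠ rk v u := not_adj8_rk fun c d h =>
    linearIndependent_of_mul_eq_one hQP (by rw [hu, hv, h])
  have hquad : ∀ w, (ε : Mat8 E).mulVec w = w → quad w = 0 := fun w hw => by
    have h1 := trace_eq_zero_of_isotropic B (tw y hy n) (ℓ := ell B y hy n) (ε := ε) (fun x hx =>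
      hT _ (hI _ (hI _ hεI _) _) (by rw [hσmul, hσmul, hσσ, hx, mul_assoc])) (adj8_rk w w)
    rwa [mul_rk_mul, hw, coe_ell, trace_diagonal_mul_rk, sum_par_mul (dg_par B n)] at h1
  have hqu := hquad u hεu
  have hqv := hquad v hεv
  have hb : bil u v = 0 := by
    have h1 := hquad (u + v) (by rw [Matrix.mulVec_add, hεu, hεv])
    rwa [quad_add, hqu, hqv, zero_add, zero_add] at h1
  obtain ⟨x, hx⟩ := exists_not_symm B (tw y hy n) hεu hεv hne
  obtain ⟨h5, h6, h7⟩ := exists_κ_plane s hqu hqv hb hPQ hu hv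
  obtain ⟨c, hc⟩ := h5 x
  obtain ⟨z, hz⟩ : ∃ z : (tw y hy (tgt s n)).form B,
      (z : Mat8 E) = κ s ((ε : Mat8 E) * (x : Mat8 E) * adj8 (ε : Mat8 E)) :=
    ⟨spin B y hy s n (ε * x * (tw y hy n).σ B ε), rfl⟩
  have hz0 : z ≠ 0 := fun h => hx (adj8_eq_of_κ_eq_zero s (by rw [← hz, h]; rfl) (by
    have h8 : ∀ a b : Mat8 E, ε * a * adj8 (ε : Mat8 E) * (ε * b * adj8 (ε : Mat8 E)) = 0 := fun a b => by
      have h9 : ε * a * adj8 (ε : Mat8 E) * (ε * b * adj8 (ε : Mat8 E)) =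
        ε * a * (adj8 (ε : Mat8 E) * ε) * (b * adj8 (ε : Mat8 E)) := by noncomm_ring
      rw [h9, hη, mul_zero, zero_mul]
    rw [adj8_mul, adj8_mul, adj8_adj8, ← mul_assoc, ← add_mul, ← mul_add, h8]))
  rw [hc] at hz
  have hzl : ∀ M : Mat8 E, (z : Mat8 E) * κ s ((ε : Mat8 E) * M) = 0 := fun M => by
    rw [hz, smul_mul_assoc, h6, smul_zero]
  have hzr : ∀ M, κ s (M * adj8 (ε : Mat8 E)) * (z : Mat8 E) = 0 := fun M => by
    rw [hz, mul_smul_comm, h7, smul_zero]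
  have hzz : z * z = 0 := Subtype.ext (by
    change (z : Mat8 E) * z = 0
    nth_rw 2 [hz]
    rw [← hc, mul_assoc, hzl])
  have hker : ∀ x' : (tw y hy n).form B, ∃ z' : (tw y hy (tgt s n)).form B,
      κ s ((ε : Mat8 E) * (x' : Mat8 E)) = (z : Mat8 E) * (z' : Mat8 E) := fun x' => by
    have : Module.Finite F ((tw y hy (tgt s n)).form B) :=
      Module.finite_of_finrank_pos (by
        rw [(tw y hy (tgt s n)).finrank_form B]
        norm_num)
    obtain ⟨z', hz'⟩ := h4.exists_eq_mul ((tw y hy (tgt s n)).finrank_form B) hz0 hzz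
      (w := spin B y hy s n (ε * x')) (Subtype.ext (hzl x'))
    exact ⟨z', congrArg Subtype.val hz'⟩
  refine hne (adj8_rk_eq_of_κ_mul_κ s hqu hqv hb hεu hεv fun M N => ?_)
  obtain ⟨w, rfl⟩ := exists_mat_decomp B (tw y hy n) N
  rw [Finset.mul_sum, map_sum, Finset.mul_sum]
  refine Finset.sum_eq_zero fun k _ => ?_
  obtain ⟨z', hz'⟩ := hker (w k)
  rw [mul_smul_comm, map_smul, mul_smul_comm, hz', ← mul_assoc, hzr, zero_mul, smul_zero]

end isotropic

end

noncomputable section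

section spinor

variable {E : Type} [Field E] {ι : Type} (u : ι → Fin 8 → E)

/-- The product of the vectors of a list, as an operator from a half-spin representation. -/
def word : Bool → List ι → Mat8 E
  | _, [] => 1
  | s, i :: l => vec s (u i) * word (!s) l

lemma word_nil (s : Bool) : word u s [] = 1 := rfl

lemma word_cons (s : Bool) (i : ι) (l : List ι) :
    word u s (i :: l) = vec s (u i) * word u (!s) l := rfl

/-- The spinors annihilated by the vectors of a list. -/
def spinKer (l : List ι) (s : Bool) : Submodule E (Fin 8 → E) :=
  ⨅ i ∈ l, LinearMap.ker (vec s (u i)).mulVecLin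

lemma mem_spinKer {l : List ι} {s : Bool} {w : Fin 8 → E} :
    w ∈ spinKer u l s ↔ ∀ i ∈ l, (vec s (u i)).mulVec w = 0 := by
  simp [spinKer, Submodule.mem_iInf]

variable [CharP E 2]

lemma bil_comm (v w : Fin 8 → E) : bil v w = bil w v := by
  have h := quad_add w v
  rwa [add_comm w v, quad_add, add_comm (quad v), add_right_inj] at h

lemma quad_smul (c : E) (v : Fin 8 → E) : quad (c • v) = c ^ 2 * quad v := by
  simp only [quad, Pi.smul_apply, smul_eq_mul]
  ring

lemma bil_add (v w x : Fin 8 → E) : bil (v + w) x = bil v x + bil w x := by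
  simp only [bil, Pi.add_apply, add_mul, Finset.sum_add_distrib]

lemma bil_smul (c : E) (v w : Fin 8 → E) : bil (c • v) w = c * bil v w := by
  simp only [bil, Pi.smul_apply, smul_eq_mul, Finset.mul_sum, mul_assoc]

section dual

variable {u} {w : Fin 8 → E}

lemma exists_vec_mul_word {l : List ι} (h : ∀ i ∈ l, bil w (u i) = 0) :
    ∀ s, ∃ s', vec s w * word u (!s) l = word u s l * vec s' w := by
  induction l with
  | nil => exact fun s => ⟨s, by rw [word_nil, word_nil, one_mul, mul_one]⟩
  | cons j l ih =>
    intro s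
    obtain ⟨s', hs'⟩ := ih (fun i hi => h i (List.mem_cons_of_mem j hi)) (!s)
    refine ⟨s', ?_⟩
    rw [word_cons, word_cons, ← mul_assoc, ← vec_swap s (h j List.mem_cons_self), mul_assoc, hs',
      mul_assoc]

lemma mulVec_mem_spinKer {l : List ι} (h : ∀ i ∈ l, bil w (u i) = 0) {s : Bool} {x : Fin 8 → E}
    (hx : x ∈ spinKer u l s) : (vec s w).mulVec x ∈ spinKer u l (!s) := by
  rw [mem_spinKer] at hx ⊢
  intro i hi
  have h1 := vec_swap (!s) (h i hi)
  rw [Bool.not_not] at h1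
  rw [Matrix.mulVec_mulVec, h1, ← Matrix.mulVec_mulVec, hx i hi, Matrix.mulVec_zero]

end dual

variable {u}

lemma word_cons_eq_zero (hq : ∀ i, quad (u i) = 0) (hb : ∀ i j, bil (u i) (u j) = 0)
    {i : ι} {l : List ι} (h : i ∈ l) : ∀ s, word u s (i :: l) = 0 := by
  induction l with
  | nil => exact absurd h List.not_mem_nil
  | cons j l ih =>
    intro s
    rw [word_cons, word_cons, ← mul_assoc]
    rcases List.mem_cons.1 h with rfl | h1
    · rw [vec_self, hq, zero_smul, zero_mul]
    · rw [vec_swap s (hb j i), mul_assoc, ← word_cons, ih h1, mul_zero]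

lemma word_eq_zero (hq : ∀ i, quad (u i) = 0) (hb : ∀ i j, bil (u i) (u j) = 0)
    {l : List ι} (h : ¬ l.Nodup) : ∀ s, word u s l = 0 := by
  induction l with
  | nil => exact absurd List.nodup_nil h
  | cons i l ih =>
    intro s
    by_cases hi : i ∈ l
    · exact word_cons_eq_zero hq hb hi s
    · rw [word_cons, ih fun hl => h (List.nodup_cons.2 ⟨hi, hl⟩), mul_zero]

variable {v : ι → Fin 8 → E}

lemma not_word_eq_zero (h1 : ∀ i, bil (v i) (u i) = 1) (h0 : ∀ i j, i ≠ j → bil (v i) (u j) = 0)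
    {l : List ι} (hl : l.Nodup) : ¬ ∀ s, word u s l = 0 := by
  induction l with
  | nil => exact fun h => one_ne_zero (h true)
  | cons i l ih =>
    rw [List.nodup_cons] at hl
    intro h
    refine ih hl.2 fun s => ?_
    obtain ⟨s', hs'⟩ := exists_vec_mul_word (w := v i) (u := u) (l := l)
      (fun j hj => h0 i j fun hij => hl.1 (hij ▸ hj)) (!s)
    have h2 := congrArg (· * word u s l) (vec_anti s (v i) (u i))
    rw [h1, one_smul, one_mul, add_mul] at h2
    have h3 := h (!s)
    rw [word_cons, Bool.not_not] at h3
    rw [Bool.not_not] at hs'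
    rw [← h2, mul_assoc, h3, mul_zero, zero_add, mul_assoc, hs', ← mul_assoc, ← word_cons, h,
      zero_mul]

lemma finrank_spinKer (hq : ∀ i, quad (u i) = 0) (hb : ∀ i j, bil (u i) (u j) = 0)
    (h1 : ∀ i, bil (v i) (u i) = 1) (h0 : ∀ i j, i ≠ j → bil (v i) (u j) = 0)
    {l : List ι} {i k : ι} (hi : i ∉ l) (hk : k ∉ i :: l) (s : Bool) :
    finrank E (spinKer u l s) = 2 * finrank E (spinKer u (i :: l) s) := by
  obtain ⟨g, hg⟩ : ∃ g, v k + (quad (v k) + 1) • u k = g := ⟨_, rfl⟩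
  have hgq : quad g = 1 := by
    have h2 : quad (v k) + quad (v k) = 0 := CharTwo.add_self_eq_zero _
    rw [← hg, quad_add, quad_smul, hq, bil_comm, bil_smul, bil_comm, h1]
    linear_combination h2
  have hgu : ∀ j ∈ i :: l, bil g (u j) = 0 := fun j hj => by
    rw [← hg, bil_add, bil_smul, hb, mul_zero, add_zero, h0 k j fun h => hk (h ▸ hj)]
  have hle : ∀ s, finrank E (spinKer u (i :: l) s) ≤ finrank E (spinKer u (i :: l) (!s)) := by
    intro s
    refine LinearMap.finrank_le_finrank_of_injective
      (f := (vec s g).mulVecLin.restrict fun x hx => mulVec_mem_spinKer hgu hx) ?_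
    refine fun x x' hx => Subtype.ext ?_
    have h2 : (vec s g).mulVec x = (vec s g).mulVec x' := congrArg Subtype.val hx
    have h3 := congrArg (vec (!s) g).mulVec h2
    have h4 := vec_self (!s) g
    rw [Bool.not_not, hgq, one_smul] at h4
    rwa [Matrix.mulVec_mulVec, Matrix.mulVec_mulVec, h4, Matrix.one_mulVec, Matrix.one_mulVec] at h3
  have heq : finrank E (spinKer u (i :: l) s) = finrank E (spinKer u (i :: l) (!s)) :=
    (hle s).antisymm ((hle (!s)).trans_eq (by rw [Bool.not_not]))
  have hrn := LinearMap.finrank_range_add_finrank_ker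
    ((vec s (u i)).mulVecLin.domRestrict (spinKer u l s))
  have hker : (LinearMap.ker ((vec s (u i)).mulVecLin.domRestrict (spinKer u l s))).map
      (spinKer u l s).subtype = spinKer u (i :: l) s := by
    ext x
    simp only [Submodule.mem_map, LinearMap.mem_ker, LinearMap.domRestrict_apply,
      Submodule.subtype_apply, Subtype.exists, exists_and_right, exists_eq_right, mem_spinKer,
      List.forall_mem_cons, Matrix.mulVecLin_apply]
    exact ⟨fun ⟨h2, h3⟩ => ⟨h3, h2⟩, fun ⟨h2, h3⟩ => ⟨h3, h2⟩⟩
  have hrange : LinearMap.range ((vec s (u i)).mulVecLin.domRestrict (spinKer u l s)) =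
      spinKer u (i :: l) (!s) := by
    have hself := vec_self (!s) (u i)
    rw [hq, zero_smul, Bool.not_not] at hself
    ext x
    constructor
    · rintro ⟨x, rfl⟩
      have h2 := mulVec_mem_spinKer (fun j _ => hb i j) x.2
      rw [mem_spinKer] at h2 ⊢
      refine List.forall_mem_cons.2 ⟨?_, h2⟩
      rw [LinearMap.domRestrict_apply, Matrix.mulVecLin_apply, Matrix.mulVec_mulVec, hself,
        Matrix.zero_mulVec]
    · intro hx
      have hx' := (mem_spinKer u).1 hx
      have h2 := mulVec_mem_spinKer (w := v i) (fun j hj => h0 i j fun h => hi (h ▸ hj))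
        ((mem_spinKer u).2 fun j hj => hx' j (List.mem_cons_of_mem i hj))
      rw [Bool.not_not] at h2
      refine ⟨⟨_, h2⟩, ?_⟩
      have h3 := congrArg (·.mulVec x) (vec_anti s (u i) (v i))
      rw [bil_comm, h1, one_smul, Matrix.one_mulVec, Matrix.add_mulVec, ← Matrix.mulVec_mulVec x (vec s (v i)),
        hx' i List.mem_cons_self, Matrix.mulVec_zero, add_zero] at h3
      rw [LinearMap.domRestrict_apply, Matrix.mulVecLin_apply, Matrix.mulVec_mulVec, h3]
  rw [hrange, ← Submodule.finrank_map_subtype_eq, hker, ← heq] at hrn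
  lia

end spinor

section isotropic

variable {F E : Type} [Field F] [Field E] [Algebra F E] (B : BiquadExt F E)
variable [CharP E 2] [Module.Finite F E]

variable (y : Fin 2 → F) (hy : ∀ v, y v ≠ 0)

lemma finrank_spinKer_of_dual {u v : Fin 4 → Fin 8 → E} (hq : ∀ i, quad (u i) = 0)
    (hb : ∀ i j, bil (u i) (u j) = 0) (h1 : ∀ i, bil (v i) (u i) = 1)
    (h0 : ∀ i j, i ≠ j → bil (v i) (u j) = 0) (s : Bool) :
    finrank E (spinKer u [0, 1, 2] s) = 1 := by
  have e1 := finrank_spinKer hq hb h1 h0 (l := []) (i := 2) (k := 3) (by decide) (by decide) s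
  have e2 := finrank_spinKer hq hb h1 h0 (l := [2]) (i := 1) (k := 3) (by decide) (by decide) s
  have e3 := finrank_spinKer hq hb h1 h0 (l := [1, 2]) (i := 0) (k := 3) (by decide) (by decide) s
  have e0 : finrank E (spinKer u [] s) = 8 := by
    have h : spinKer u [] s = ⊤ := by simp [spinKer]
    rw [h, finrank_top, finrank_fin_fun]
  lia

/-- A fixed algebra of index at least 2 contains no nonzero element of rank 1. -/
lemma eq_zero_of_finrank_le (t : Twist F) {d : ℕ} (hd : 2 ≤ d) (h : HasIndex F (t.form B) d)
    (K : Submodule E (Fin 8 → E)) (hK : finrank E K = 1) (z : t.form B)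
    (hz : ∀ w, (z : Mat8 E).mulVec w ∈ K) : z = 0 := by
  by_contra h0
  obtain ⟨ε, ⟨x, hx⟩, hε, hr⟩ := h.exists_idempotent (LinearMap.range (LinearMap.mulLeft F z)) (by
    rintro _ ⟨x, rfl⟩ a
    exact ⟨x * a, (mul_assoc _ _ _).symm⟩) fun hbot => h0 (by
      have h2 : z * 1 ∈ LinearMap.range (LinearMap.mulLeft F z) := ⟨1, rfl⟩
      rwa [hbot, Submodule.mem_bot, mul_one] at h2)
  have hε' : (ε : Mat8 E) * ε = ε := congrArg Subtype.val hε
  have hεK : ∀ w, (ε : Mat8 E).mulVec w ∈ K := fun w => by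
    have h2 : (ε : Mat8 E) = (z : Mat8 E) * (x : Mat8 E) := congrArg Subtype.val hx.symm
    rw [h2, ← Matrix.mulVec_mulVec]
    exact hz _
  rw [← t.finrank_range_mulLeft B hε'] at hr
  have hle : finrank E (LinearMap.range (LinearMap.mulLeft E (ε : Mat8 E))) ≤
      finrank E (Fin 8 → K) := by
    refine LinearMap.finrank_le_finrank_of_injective (f :=
      { toFun := fun M j => ⟨fun i => M.1 i j, ?_⟩
        map_add' := fun _ _ => rfl
        map_smul' := fun _ _ => rfl }) fun M N hMN => Subtype.ext (Matrix.ext fun i j =>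
          congrFun (congrArg Subtype.val (congrFun hMN j)) i)
    obtain ⟨N, hN⟩ := M.2
    rw [← hN]
    exact hεK fun i => N i j
  rw [hr, Module.finrank_pi_fintype, Finset.sum_const, Finset.card_univ, Fintype.card_fin,
    smul_eq_mul, hK] at hle
  lia

lemma not_isotropic_of_index_four (n : Fin 3) (h4 : HasIndex F ((tw y hy n).form B) 4)
    (h2 : ∀ s, ∃ d, 2 ≤ d ∧ HasIndex F ((tw y hy (tgt s n)).form B) d) :
    ¬ QPIsotropic F ((tw y hy n).form B) ((tw y hy n).T B) ((tw y hy n).σ B) (ell B y hy n) := by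
  rintro ⟨I, ⟨hI, hσ, hT⟩, h0⟩
  obtain ⟨ε, hεI, hε, hr⟩ := h4.exists_idempotent I hI h0
  obtain ⟨hσmul, hσσ⟩ := (tw y hy n).isInvolution B
  have hε' : (ε : Mat8 E) * ε = ε := congrArg Subtype.val hε
  obtain ⟨P, Q, hPQ, hQP⟩ := exists_rank_factor (r := 4) hε' (by
    rw [(tw y hy n).finrank_range_mulLeft B hε', hr])
  obtain ⟨u, hu⟩ : ∃ u : Fin 4 → Fin 8 → E, (fun k i => P i k) = u := ⟨_, rfl⟩
  have hεu : ∀ k, (ε : Mat8 E).mulVec (u k) = u k := fun k => by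
    have hεP : (ε : Mat8 E) * P = P := by
      rw [← hPQ, Matrix.mul_assoc, hQP, Matrix.mul_one]
    rw [← hu]
    exact funext fun i => congrFun₂ hεP i k
  have hquad : ∀ w, (ε : Mat8 E).mulVec w = w → quad w = 0 := fun w hw => by
    have h1 := trace_eq_zero_of_isotropic B (tw y hy n) (ℓ := ell B y hy n) (ε := ε) (fun x hx =>
      hT _ (hI _ (hI _ hεI _) _) (by rw [hσmul, hσmul, hσσ, hx, mul_assoc])) (adj8_rk w w)
    rwa [mul_rk_mul, hw, coe_ell, trace_diagonal_mul_rk, sum_par_mul (dg_par B n)] at h1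
  have hq : ∀ k, quad (u k) = 0 := fun k => hquad _ (hεu k)
  have hb : ∀ k l, bil (u k) (u l) = 0 := fun k l => by
    have h1 := hquad (u k + u l) (by rw [Matrix.mulVec_add, hεu, hεu])
    rwa [quad_add, hq, hq, zero_add, zero_add] at h1
  let v : Fin 4 → Fin 8 → E := fun l j => Q l (par j)
  have hvu : ∀ l k, bil (v l) (u k) = (1 : Matrix (Fin 4) (Fin 4) E) l k := fun l k => by
    rw [← hQP, Matrix.mul_apply, ← hu]
    exact sum_par fun j => Q l j * P j k
  have h1 : ∀ i, bil (v i) (u i) = 1 := fun i => by rw [hvu, Matrix.one_apply_eq]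
  have h0 : ∀ i j, i ≠ j → bil (v i) (u j) = 0 := fun i j h => by
    rw [hvu, Matrix.one_apply_ne h]
  have hκ : ∀ (s : Bool) (M : Mat8 E), ∃ c : Fin 4 → Fin 4 → E,
      κ s ((ε : Mat8 E) * M * adj8 (ε : Mat8 E)) = ∑ k, ∑ l, c k l • word u s [k, l] := by
    intro s M
    obtain ⟨c, hc⟩ := exists_eq_sum_smul_rk P Q M
    refine ⟨c, ?_⟩
    rw [← hPQ, hc]
    simp only [map_sum, map_smul, κ_rk, word_cons, word_nil, mul_one, ← hu]
  have hker : ∀ (s : Bool) (M N : Mat8 E) (i : Fin 4), vec (!s) (u i) *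
      (κ s ((ε : Mat8 E) * M * adj8 (ε : Mat8 E)) * κ s ((ε : Mat8 E) * N * adj8 (ε : Mat8 E))) = 0 := by
    intro s M N i
    obtain ⟨c, hc⟩ := hκ s M
    obtain ⟨d, hd⟩ := hκ s N
    rw [hc, hd]
    simp only [Finset.sum_mul, Finset.mul_sum, Finset.smul_sum, smul_mul_assoc, mul_smul_comm]
    refine Finset.sum_eq_zero fun p _ => Finset.sum_eq_zero fun q _ => Finset.sum_eq_zero fun k _ =>
      Finset.sum_eq_zero fun l _ => ?_
    have h3 : vec (!s) (u i) * (word u s [k, l] * word u s [p, q]) = word u (!s) [i, k, l, p, q] := by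
      simp only [word_cons, word_nil, Bool.not_not, mul_one, mul_assoc]
    have h4 : ¬ [i, k, l, p, q].Nodup := fun h => by
      simpa using h.length_le_card
    simp only [h3, word_eq_zero hq hb h4, smul_zero]
  have hprod : ∀ (s : Bool) (x x' : (tw y hy n).form B),
      κ s ((ε : Mat8 E) * (x : Mat8 E) * adj8 (ε : Mat8 E)) *
        κ s ((ε : Mat8 E) * (x' : Mat8 E) * adj8 (ε : Mat8 E)) = 0 := by
    intro s x x'
    obtain ⟨d, hd, h5⟩ := h2 s
    have h6 := eq_zero_of_finrank_le B _ hd h5 (spinKer u [0, 1, 2] (!s))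
      (finrank_spinKer_of_dual hq hb h1 h0 _)
      (spin B y hy s n (ε * x * (tw y hy n).σ B ε) * spin B y hy s n (ε * x' * (tw y hy n).σ B ε))
      fun w => (mem_spinKer u).2 fun i _ => by
        have h7 := hker s x x' i
        rw [Matrix.mulVec_mulVec]
        exact (congrArg (·.mulVec w) h7).trans (Matrix.zero_mulVec w)
    exact congrArg Subtype.val h6
  have hprod' : ∀ (s : Bool) (M N : Mat8 E), κ s ((ε : Mat8 E) * M * adj8 (ε : Mat8 E)) *
      κ s ((ε : Mat8 E) * N * adj8 (ε : Mat8 E)) = 0 := by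
    intro s M N
    obtain ⟨w, rfl⟩ := exists_mat_decomp B (tw y hy n) M
    obtain ⟨w', rfl⟩ := exists_mat_decomp B (tw y hy n) N
    simp only [Finset.mul_sum, Finset.sum_mul, map_sum, mul_smul_comm, smul_mul_assoc, map_smul,
      hprod, smul_zero, Finset.sum_const_zero]
  refine not_word_eq_zero h1 h0 (l := [0, 1, 2, 3]) (by decide) fun s => ?_
  have h3 := hprod' s (rk (u 0) (u 1)) (rk (u 2) (u 3))
  rw [mul_rk_mul, mul_rk_mul, hεu, hεu, hεu, hεu, κ_rk, κ_rk] at h3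
  simp only [word_cons, word_nil, Bool.not_not, mul_one]
  rw [← mul_assoc, h3]

end isotropic

end

noncomputable section

variable {F E : Type} [Field F] [CharP F 2] [Field E] [CharP E 2] [Algebra F E]
  [Module.Finite F E] (B : BiquadExt F E) (y : Fin 2 → F) (hy : ∀ v, y v ≠ 0)

/-- The twisted form with its canonical quadratic pair. -/
def qpAlgebra (n : Fin 3) {d : ℕ} (h : HasIndex F ((tw y hy n).form B) d) : QPAlgebra F where
  A := (tw y hy n).form B
  T := (tw y hy n).T B
  σ := (tw y hy n).σ B
  ℓ := ell B y hy n
  csa := h.isCSA ((tw y hy n).isCentral B)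
  trd := (tw y hy n).isReducedTrace B
  pair := (tw y hy n).isQuadraticPair B (ell_add B y hy n)

lemma isTrialitarianTriple {dX dY dZ : ℕ} (hX : HasIndex F ((tw y hy 0).form B) dX)
    (hY : HasIndex F ((tw y hy 1).form B) dY) (hZ : HasIndex F ((tw y hy 2).form B) dZ) :
    IsTrialitarianTriple F (qpAlgebra B y hy 0 hX) (qpAlgebra B y hy 1 hY)
      (qpAlgebra B y hy 2 hZ) := by
  refine ⟨(tw y hy 0).finrank_form B, (tw y hy 1).finrank_form B, (tw y hy 2).finrank_form B, ?_⟩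
  obtain ⟨φ, hφ⟩ := exists_cliffordAlg_equiv B y hy 0
  refine ⟨φ, fun (a : (tw y hy 0).form B) => ?_⟩
  have h1 := hφ ((tw y hy 0).σ B a)
  rw [spin_σ, spin_σ] at h1
  refine h1.trans ?_
  have h2 := hφ a
  exact congrArg₂ Prod.mk (congrArg (fun p => (tw y hy 1).σ B p.1) h2.symm)
    (congrArg (fun p => (tw y hy 2).σ B p.2) h2.symm)

/-- The triple of forms is anisotropic if its last member has index 4 and the others have index
at least 2. -/
def tripleWitness {dY : ℕ} (i3 : I3Trivial F) (hX : HasIndex F ((tw y hy 0).form B) 2)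
    (hY : HasIndex F ((tw y hy 1).form B) dY) (hd : dY = 2 ∨ dY = 4)
    (hZ : HasIndex F ((tw y hy 2).form B) 4) : AnisotropicTripleWitness {2, dY, 4} where
  F := F
  char2 := ringChar.eq F 2
  i3 := i3
  X := qpAlgebra B y hy 0 hX
  Y := qpAlgebra B y hy 1 hY
  Z := qpAlgebra B y hy 2 hZ
  trial := isTrialitarianTriple B y hy hX hY hZ
  aniso := by
    have hd2 : 2 ≤ dY := by lia
    rintro (h | h | h)
    · exact not_isotropic_of_index B y hy false 0 hX hZ h
    · rcases hd with rfl | rfl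
      · exact not_isotropic_of_index B y hy true 1 hY hZ h
      · exact not_isotropic_of_index_four B y hy 1 hY
          (Bool.forall_bool.2 ⟨⟨2, le_rfl, hX⟩, ⟨4, hd2, hZ⟩⟩) h
    · exact not_isotropic_of_index_four B y hy 2 hZ
        (Bool.forall_bool.2 ⟨⟨dY, hd2, hY⟩, ⟨2, le_rfl, hX⟩⟩) h
  idx_eq := by
    have h1 : schurIndex F (qpAlgebra B y hy 0 hX).A = 2 := hX.schurIndex
    have h2 : schurIndex F (qpAlgebra B y hy 1 hY).A = dY := hY.schurIndex
    have h3 : schurIndex F (qpAlgebra B y hy 2 hZ).A = 4 := hZ.schurIndex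
    rw [indexMultiset, h1, h2, h3]

lemma nonempty_witness {F : Type} [Field F] [CharP F 2] (i3 : I3Trivial F) (x y : Fin 2 → F)
    (hy : ∀ v, y v ≠ 0) {d : ℕ} (hd : d = 2 ∨ d = 4)
    [NoZeroDivisors ℍ[F,x 0 + x 1,1,y 0 * y 1]] [NoZeroDivisors (Biquat F (x 0) (y 0) (x 1) (y 1))]
    (hY : ∀ (E : Type) [Field E] [CharP E 2] [Algebra F E] [Module.Finite F E] (B : BiquadExt F E),
      B.x = x → HasIndex F ((tw y hy 1).form B) d) :
    Nonempty (AnisotropicTripleWitness {2, d, 4}) := by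
  have := noZeroDivisors_left (F := F) (a := x 0) (b := y 0) (c := x 1) (d := y 1)
  have := noZeroDivisors_right (F := F) (a := x 0) (b := y 0) (c := x 1) (d := y 1)
  obtain ⟨E, _, _, B, rfl⟩ := exists_biquadExt x (quat_root (y := y 0)) (quat_root (y := y 1))
    (quat_root (y := y 0 * y 1))
  have : CharP E 2 := charP_of_injective_algebraMap (FaithfulSMul.algebraMap_injective F E) 2
  have : Module.Finite F E := B.moduleFinite
  have : NoZeroDivisors (Biquat F (B.x 0) (slot y 2 0) (B.x 1) (slot y 2 1)) :=
    inferInstanceAs (NoZeroDivisors (Biquat F (B.x 0) (y 0) (B.x 1) (y 1)))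
  exact ⟨tripleWitness B y hy i3 (hasIndex_form_zero B y hy) (hY E B rfl) hd
    (hasIndex_form_four B y hy 2 0 1 (by decide))⟩

end

/-- Example 4.5 of the paper.  There exists a field `F` of
characteristic 2 with `I_q³F = 0` carrying an anisotropic trialitarian triple of index
`(2,4,4)`, and a field `F'` of characteristic 2 with `I_q³F' = 0` carrying an
anisotropic trialitarian triple of index `(2,2,4)` (obtained by Merkurjev's
construction from the quaternion algebras of Example 4.5 over `k(X₁,Y₁,X₂,Y₂)`). -/
theorem exists_anisotropic_triples :
    Nonempty (AnisotropicTripleWitness ({2, 4, 4} : Multiset ℕ)) ∧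
    Nonempty (AnisotropicTripleWitness ({2, 2, 4} : Multiset ℕ)) := by
  constructor
  · obtain ⟨F, _, _, i3, x₁, y₁, x₂, y₂, h1, h2, hX, hY, hZ⟩ := exists_field_generic
    have hX' : NoZeroDivisors ℍ[F, ![x₁, x₂] 0 + ![x₁, x₂] 1, 1, ![y₁, y₂] 0 * ![y₁, y₂] 1] := hX
    have hZ' : NoZeroDivisors (Biquat F (![x₁, x₂] 0) (![y₁, y₂] 0) (![x₁, x₂] 1) (![y₁, y₂] 1)) := hZ
    refine nonempty_witness i3 ![x₁, x₂] ![y₁, y₂] (Fin.forall_fin_two.2 ⟨h1, h2⟩) (Or.inr rfl) ?_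
    intro E _ _ _ _ B hB
    have hY' : NoZeroDivisors (Biquat F (B.x 1) (slot ![y₁, y₂] 1 1) (B.x 0) (slot ![y₁, y₂] 1 0)) := by
      rw [hB]
      exact hY
    exact hasIndex_form_four B _ _ 1 1 0 (by decide)
  · obtain ⟨F, _, _, i3, x₁, y₁, m, y₂, h1, -, h2, hX, hY, hZ⟩ := exists_field_special
    have hX' : NoZeroDivisors ℍ[F, ![x₁, y₁ * m ^ 2] 0 + ![x₁, y₁ * m ^ 2] 1, 1,
      ![y₁, y₂] 0 * ![y₁, y₂] 1] := hX
    have hZ' : NoZeroDivisors (Biquat F (![x₁, y₁ * m ^ 2] 0) (![y₁, y₂] 0) (![x₁, y₁ * m ^ 2] 1)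
      (![y₁, y₂] 1)) := hZ
    refine nonempty_witness i3 ![x₁, y₁ * m ^ 2] ![y₁, y₂] (Fin.forall_fin_two.2 ⟨h1, h2⟩)
      (Or.inl rfl) ?_
    intro E _ _ _ _ B hB
    have hY' : NoZeroDivisors ℍ[F, B.x 0, 1, ![y₁, y₂] 1] := by
      rw [hB]
      exact hY
    exact hasIndex_form_one B _ _ m (by rw [hB]; rfl)

end Triality
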